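/- Suppose k ∈ ℕ and 1 ≤ p < ∞ with p ≠ N/j for j = 1, ..., k. If u ∈ D'(ℝ^N) and ∇^k u ∈ (L^p(ℝ^N))^{ν(k,N)}, there is a polynomial π_u ∈ P_{k-1}, independent of p within each connected component of ℝ \ {N/k, N/(k-1), ..., N} and unique if p < N/k, such that ∇^{k-j}(u - π_u) ∈ (L^q_{j-N/p})^{ν(k-j,N)} for every 1 ≤ j ≤ k and every q ∈ I_{j,p}, and for each such j, q there is a constant C > 0 independent of u such that ||\,|∇^{k-j}(u - π_u)|\,||_{L^q_{j-N/p}} ≤ C ||\,|∇^k u|\,||_{L^p}. Furthermore, lim_{|x|→∞} |x|^{-j+N/p} (∇^{k-j}u(x) - ∇^{k-j}π_u(x)) = 0 if 1 ≤ j ≤ k and p > N/j. -/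

import Mathlib

open MeasureTheory Metric Filter Topology ENNReal

noncomputable section

/-- Euclidean space `ℝ^N`. -/
abbrev Euc (N : ℕ) := EuclideanSpace ℝ (Fin N)

/-- Iterated classical partial derivative along a list of coordinate directions. -/
def pderivList {N : ℕ} : List (Fin N) → (Euc N → ℝ) → Euc N → ℝ
  | [], φ => φ
  | i :: l, φ => pderivList l fun x => fderiv ℝ φ x (EuclideanSpace.single i 1)

/-- `g` is the weak (distributional) partial derivative of `u` of order given by the
list `l` of coordinate directions, i.e. `g = ∂_{l₁} ⋯ ∂_{l_r} u` in `D'(ℝ^N)`. -/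
def IsWeakDerivList {N : ℕ} (l : List (Fin N)) (u g : Euc N → ℝ) : Prop :=
  LocallyIntegrable u volume ∧ LocallyIntegrable g volume ∧
    ∀ φ : Euc N → ℝ, ContDiff ℝ (⊤ : ℕ∞) φ → HasCompactSupport φ →
      ∫ x, u x * pderivList l φ x = (-1 : ℝ) ^ l.length * ∫ x, g x * φ x

/-- `g` is the weak partial derivative `∂ᵢ u`. -/
def IsWeakPartialDeriv {N : ℕ} (i : Fin N) (u g : Euc N → ℝ) : Prop :=
  IsWeakDerivList [i] u g

/-- The weight `(1+|x|)^{-s-N/q}` of the space `L^q_s` (with `N/∞ := 0`). -/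
def wt (N : ℕ) (s : ℝ) (q : ℝ≥0∞) (x : Euc N) : ℝ :=
  (1 + ‖x‖) ^ (-s - (N : ℝ) / q.toReal)

/-- Membership in the weighted space `L^q_s`. -/
def MemLs (N : ℕ) (s : ℝ) (q : ℝ≥0∞) (u : Euc N → ℝ) : Prop :=
  MemLp (fun x => wt N s q x * u x) q volume

/-- The norm of the weighted space `L^q_s`. -/
def LsNorm (N : ℕ) (s : ℝ) (q : ℝ≥0∞) (u : Euc N → ℝ) : ℝ :=
  (eLpNorm (fun x => wt N s q x * u x) q volume).toReal

/-- Membership in the exponentially weighted space `L^q_{exp,s}`. -/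
def MemLexp (N : ℕ) (s : ℝ) (q : ℝ≥0∞) (u : Euc N → ℝ) : Prop :=
  MemLp (fun x => Real.exp (-(s * ‖x‖)) * u x) q volume

/-- The norm of the exponentially weighted space `L^q_{exp,s}`. -/
def LexpNorm (N : ℕ) (s : ℝ) (q : ℝ≥0∞) (u : Euc N → ℝ) : ℝ :=
  (eLpNorm (fun x => Real.exp (-(s * ‖x‖)) * u x) q volume).toReal

/-- The pointwise Euclidean (Frobenius) norm `|∇^k u|` of the `k`-th gradient, whose
components `g m` are indexed by the `k`-tuples `m` of coordinate directions. -/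
def gradNormK {N k : ℕ} (g : (Fin k → Fin N) → Euc N → ℝ) (x : Euc N) : ℝ :=
  Real.sqrt (∑ m : Fin k → Fin N, g m x ^ 2)

/-- The pointwise Euclidean norm `|∇u|` of a first-order gradient. -/
def gradNorm1 {N : ℕ} (g : Fin N → Euc N → ℝ) (x : Euc N) : ℝ :=
  Real.sqrt (∑ i, g i x ^ 2)

/-- The interval `I_{j,p}` of admissible exponents `q`. -/
def Ijp (N j : ℕ) (p : ℝ) : Set ℝ≥0∞ :=
  if p = (N : ℝ) / (j : ℝ) ∧ 1 < N then Set.Ico (ENNReal.ofReal p) ⊤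
  else if p < (N : ℝ) / (j : ℝ) then
    Set.Icc (ENNReal.ofReal p) (ENNReal.ofReal ((N : ℝ) * p / ((N : ℝ) - (j : ℝ) * p)))
  else Set.Icc (ENNReal.ofReal p) ⊤

/-- The average of `u` on the ball `B_ρ`. -/
def ballAvg {N : ℕ} (ρ : ℝ) (u : Euc N → ℝ) : ℝ :=
  (volume (ball (0 : Euc N) ρ)).toReal⁻¹ * ∫ y in ball (0 : Euc N) ρ, u y

/-- The radial symmetrization `u_S(x) = (Nω_N)⁻¹ ∫_{S^{N-1}} u(|x|σ) dσ`. -/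
def radialSymmetrization {N : ℕ} (u : Euc N → ℝ) (x : Euc N) : ℝ :=
  ((N : ℝ) * (volume (ball (0 : Euc N) 1)).toReal)⁻¹ *
    ∫ σ : sphere (0 : Euc N) 1, u (‖x‖ • (σ : Euc N)) ∂((volume : Measure (Euc N)).toSphere)

/-- `u` is radially symmetric: `u x` only depends on `|x|`. -/
def RadSymm {N : ℕ} (u : Euc N → ℝ) : Prop :=
  ∀ x y : Euc N, ‖x‖ = ‖y‖ → u x = u y

/-- Evaluation of a polynomial on `ℝ^N` at a point. -/
def polyEval {N : ℕ} (π : MvPolynomial (Fin N) ℝ) (x : Euc N) : ℝ :=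
  MvPolynomial.eval (fun i => x i) π


section
lemma jensen_pow {α : Type*} [MeasurableSpace α] (ν : Measure α) {g : α → ℝ≥0∞}
    (hg : AEMeasurable g ν) {p : ℝ} (hp : 1 ≤ p) :
    (∫⁻ t, g t ∂ν) ^ p ≤ (ν Set.univ) ^ (p - 1) * ∫⁻ t, g t ^ p ∂ν := by
  have hp0 : 0 < p := by linarith
  have h := ENNReal.lintegral_mul_norm_pow_le (μ := ν) (f := fun t => g t ^ p)
    (g := fun _ => 1) (hg.pow_const p) aemeasurable_const (p := 1 / p) (q := 1 - 1 / p)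
    (by positivity) (by rw [sub_nonneg]; exact (div_le_one hp0).2 hp) (by ring)
  have e1 : ∀ t, ((g t ^ p) ^ (1 / p) : ℝ≥0∞) = g t := fun t => by
    rw [← ENNReal.rpow_mul, mul_one_div_cancel hp0.ne', ENNReal.rpow_one]
  simp only [e1, ENNReal.one_rpow, mul_one, lintegral_one] at h
  calc (∫⁻ t, g t ∂ν) ^ p ≤ ((∫⁻ t, g t ^ p ∂ν) ^ (1 / p) * (ν Set.univ) ^ (1 - 1 / p)) ^ p := by
        gcongr
    _ = _ := by
      rw [ENNReal.mul_rpow_of_nonneg _ _ hp0.le, ← ENNReal.rpow_mul, ← ENNReal.rpow_mul,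
        one_div_mul_cancel hp0.ne', ENNReal.rpow_one, mul_comm]
      congr 2; field_simp

lemma lintegral_smul_Euc {N : ℕ} (H : Euc N → ℝ≥0∞) {t : ℝ} (ht : 0 < t) :
    ∫⁻ x, H (t • x) = ENNReal.ofReal (t ^ (-(N : ℝ))) * ∫⁻ x, H x := by
  have h := Measure.map_addHaar_smul (volume : Measure (Euc N)) ht.ne'
  have hme : MeasurableEmbedding (fun x : Euc N => t • x) :=
    (Homeomorph.smulOfNeZero t ht.ne').measurableEmbedding
  rw [← hme.lintegral_map (μ := volume) H, h, lintegral_smul_measure]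
  simp only [smul_eq_mul, finrank_euclideanSpace, Fintype.card_fin]
  congr 2
  rw [abs_of_pos (by positivity), Real.rpow_neg ht.le, Real.rpow_natCast]

lemma dilation_le {N : ℕ} {H : Euc N → ℝ≥0∞} (hH : Measurable H) {p b : ℝ} (hp : 1 ≤ p)
    {s : Set ℝ} (hs : MeasurableSet s) (hs0 : ∀ t ∈ s, 0 < t) :
    ∫⁻ x, (∫⁻ t in s, ENNReal.ofReal (t ^ (b + N / p - 1)) * H (t • x)) ^ p ≤
      (∫⁻ t in s, ENNReal.ofReal (t ^ (b - 1))) ^ p * ∫⁻ x, H x ^ p := by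
  have hp0 : 0 < p := by linarith
  set w : ℝ → ℝ≥0∞ := fun t => ENNReal.ofReal (t ^ (b - 1)) with hw
  have hwm : Measurable w := by fun_prop
  set ν := (volume.restrict s).withDensity w with hν
  have hνu : ν Set.univ = ∫⁻ t in s, w t := by
    rw [hν, withDensity_apply _ MeasurableSet.univ, Measure.restrict_univ]
  have hHm : Measurable (fun z : Euc N × ℝ => H (z.2 • z.1)) :=
    hH.comp (measurable_snd.smul measurable_fst)
  have e1 : ∀ x, ∫⁻ t in s, ENNReal.ofReal (t ^ (b + N / p - 1)) * H (t • x)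
      = ∫⁻ t, ENNReal.ofReal (t ^ (N / p)) * H (t • x) ∂ν := by
    intro x
    rw [hν, lintegral_withDensity_eq_lintegral_mul _ hwm (by fun_prop)]
    refine setLIntegral_congr_fun hs fun t ht => ?_
    have := hs0 t ht
    simp only [Pi.mul_apply, hw, ← mul_assoc]
    rw [← ENNReal.ofReal_mul (by positivity), ← Real.rpow_add this]
    congr 3; ring
  calc ∫⁻ x, (∫⁻ t in s, ENNReal.ofReal (t ^ (b + N / p - 1)) * H (t • x)) ^ p
      ≤ ∫⁻ x, (ν Set.univ) ^ (p - 1) * ∫⁻ t, (ENNReal.ofReal (t ^ (N / p)) * H (t • x)) ^ p ∂ν := by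
        refine lintegral_mono fun x => ?_
        rw [e1]
        exact jensen_pow ν (by fun_prop) hp
    _ = (ν Set.univ) ^ (p - 1) *
          ∫⁻ x, ∫⁻ t, (ENNReal.ofReal (t ^ (N / p)) * H (t • x)) ^ p ∂ν := by
        rw [lintegral_const_mul]
        refine Measurable.lintegral_prod_right' (f := fun z : Euc N × ℝ =>
          (ENNReal.ofReal (z.2 ^ (N / p)) * H (z.2 • z.1)) ^ p) ?_
        fun_prop
    _ = (ν Set.univ) ^ (p - 1) *
          ∫⁻ t, (∫⁻ x : Euc N, (ENNReal.ofReal (t ^ (N / p)) * H (t • x)) ^ p) ∂ν := by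
        rw [lintegral_lintegral_swap]
        refine Measurable.aemeasurable ?_
        change Measurable (fun z : Euc N × ℝ => (ENNReal.ofReal (z.2 ^ (N / p)) * H (z.2 • z.1)) ^ p)
        fun_prop
    _ = (ν Set.univ) ^ (p - 1) * ∫⁻ _, (∫⁻ x : Euc N, H x ^ p) ∂ν := by
        congr 1
        have hae : ∀ᵐ t ∂ν, 0 < t := by
          refine (withDensity_absolutelyContinuous _ _).ae_le ?_
          filter_upwards [ae_restrict_mem hs] with t ht using hs0 t ht
        refine lintegral_congr_ae ?_
        filter_upwards [hae] with t ht
        simp only [ENNReal.mul_rpow_of_nonneg _ _ hp0.le]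
        rw [lintegral_const_mul _ (by fun_prop), lintegral_smul_Euc (fun x => H x ^ p) ht,
          ENNReal.ofReal_rpow_of_nonneg (by positivity) hp0.le, ← mul_assoc,
          ← ENNReal.ofReal_mul (by positivity), ← Real.rpow_mul ht.le, ← Real.rpow_add ht,
          div_mul_cancel₀ _ hp0.ne']
        simp
    _ = _ := by
        rw [lintegral_const, mul_comm (∫⁻ x, H x ^ p), ← mul_assoc, hνu]
        congr 1
        conv_lhs => rw [mul_comm]
        by_cases hz : (∫⁻ t in s, w t) = 0
        · rw [hz]; simp [hp0]
        · by_cases ht : (∫⁻ t in s, w t) = ⊤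
          · rw [ht, ENNReal.top_rpow_of_pos hp0]
            by_cases hp1 : p - 1 = 0
            · simp [hp1]
            · have : 0 < p - 1 := lt_of_le_of_ne (by linarith) (Ne.symm hp1)
              rw [ENNReal.top_rpow_of_pos this]; simp
          · conv_lhs => rw [← ENNReal.rpow_one (∫⁻ t in s, w t), ← ENNReal.rpow_mul]
            rw [← ENNReal.rpow_add _ _ hz ht]; simp

variable {N : ℕ} {F : Type*} [NormedAddCommGroup F] [NormedSpace ℝ F] 

lemma segment_le [CompleteSpace F] {f : Euc N → F} (hf : ContDiff ℝ 1 f) (y x : Euc N) {a b : ℝ} (hab : a ≤ b) :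
    ‖f (y + b • x) - f (y + a • x)‖ₑ ≤
      ∫⁻ t in Set.Ioo a b, ‖x‖ₑ * ‖fderiv ℝ f (y + t • x)‖ₑ := by
  have hd : ∀ t ∈ Set.uIcc a b, HasDerivAt (fun t : ℝ => f (y + t • x))
      (fderiv ℝ f (y + t • x) x) t := by
    intro t _
    have h1 : HasDerivAt (fun t : ℝ => y + t • x) x t := by
      simpa using ((hasDerivAt_id t).smul_const x).const_add y
    exact ((hf.differentiable one_ne_zero) _).hasFDerivAt.comp_hasDerivAt t h1
  have hc : Continuous (fun t : ℝ => fderiv ℝ f (y + t • x) x) := by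
    have := hf.continuous_fderiv one_ne_zero
    fun_prop
  rw [← intervalIntegral.integral_eq_sub_of_hasDerivAt hd (hc.intervalIntegrable _ _),
    intervalIntegral.integral_of_le hab]
  refine (enorm_integral_le_lintegral_enorm _).trans ?_
  rw [← restrict_Ioo_eq_restrict_Ioc]
  refine lintegral_mono fun t => ?_
  rw [mul_comm]
  exact ContinuousLinearMap.le_opENorm _ _
end

section
/-- Hardy constants. -/
def hardyCA (b : ℝ) : ℝ≥0∞ := ∫⁻ t in Set.Ioo (0:ℝ) 1, ENNReal.ofReal (t ^ (b - 1))
def hardyCB (b : ℝ) : ℝ≥0∞ := ∫⁻ t in Set.Ioi (1:ℝ), ENNReal.ofReal (t ^ (b - 1))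

lemma hardyCA_lt_top {b : ℝ} (hb : 0 < b) : hardyCA b < ⊤ := by
  have h : IntegrableOn (fun t : ℝ => t ^ (b - 1)) (Set.Ioo 0 1) :=
    (intervalIntegral.integrableOn_Ioo_rpow_iff one_pos).2 (by linarith)
  exact h.lintegral_lt_top

lemma hardyCB_lt_top {b : ℝ} (hb : b < 0) : hardyCB b < ⊤ := by
  have h : IntegrableOn (fun t : ℝ => t ^ (b - 1)) (Set.Ioi 1) :=
    integrableOn_Ioi_rpow_of_lt (by linarith) one_pos
  exact h.lintegral_lt_top

variable {N : ℕ} {F : Type*} [NormedAddCommGroup F] [NormedSpace ℝ F]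

lemma weight_aux {a t : ℝ} (ht : 0 < t) {x : Euc N} (hx : x ≠ 0) (e : ℝ≥0∞) :
    ENNReal.ofReal (‖x‖ ^ (-a)) * (‖x‖ₑ * e) =
      ENNReal.ofReal (t ^ (a - 1)) * (ENNReal.ofReal (‖t • x‖ ^ (1 - a)) * e) := by
  have hx' : 0 < ‖x‖ := norm_pos_iff.2 hx
  rw [← ofReal_norm, ← mul_assoc, ← mul_assoc, ← ENNReal.ofReal_mul (by positivity),
    ← ENNReal.ofReal_mul (by positivity), norm_smul, Real.norm_of_nonneg ht.le,
    Real.mul_rpow ht.le hx'.le, ← mul_assoc, ← Real.rpow_add ht]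
  simp only [sub_add_sub_cancel, sub_self, Real.rpow_zero, one_mul]
  congr 2
  rw [sub_eq_add_neg, Real.rpow_add hx', Real.rpow_one, mul_comm]

lemma hardyA [CompleteSpace F] {f : Euc N → F} (hf : ContDiff ℝ 1 f) (hf0 : f 0 = 0) {p a : ℝ} (hp : 1 ≤ p)
    {S : Set (Euc N)} (hS : MeasurableSet S) (hSt : ∀ x ∈ S, ∀ t ∈ Set.Ioo (0:ℝ) 1, t • x ∈ S) :
    ∫⁻ x in S, (ENNReal.ofReal (‖x‖ ^ (-a)) * ‖f x‖ₑ) ^ p ≤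
      (hardyCA (a - N / p)) ^ p *
        ∫⁻ x in S, (ENNReal.ofReal (‖x‖ ^ (1 - a)) * ‖fderiv ℝ f x‖ₑ) ^ p := by
  have hp0 : 0 < p := by linarith
  have hfd := hf.continuous_fderiv one_ne_zero
  set H : Euc N → ℝ≥0∞ :=
    S.indicator (fun x => ENNReal.ofReal (‖x‖ ^ (1 - a)) * ‖fderiv ℝ f x‖ₑ) with hH
  have hHm : Measurable H := by
    refine Measurable.indicator ?_ hS
    have := hfd.measurable
    fun_prop
  have h := dilation_le hHm (b := a - N / p) hp (s := Set.Ioo 0 1) measurableSet_Ioo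
    (fun t ht => ht.1)
  have e2 : ∫⁻ x, H x ^ p = ∫⁻ x in S, (ENNReal.ofReal (‖x‖ ^ (1 - a)) * ‖fderiv ℝ f x‖ₑ) ^ p := by
    rw [← lintegral_indicator hS]
    refine lintegral_congr fun x => ?_
    by_cases hx : x ∈ S <;> simp [hH, hx, hp0]
  rw [e2] at h
  refine le_trans ?_ h
  rw [← lintegral_indicator hS]
  refine lintegral_mono fun x => ?_
  by_cases hx : x ∈ S
  swap
  · simp [hx]
  simp only [Set.indicator_of_mem hx]
  gcongr
  by_cases hx0 : x = 0
  · simp [hx0, hf0]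
  have h1 := segment_le hf 0 x zero_le_one
  simp only [one_smul, zero_add, zero_smul, hf0, sub_zero] at h1
  calc _ ≤ ENNReal.ofReal (‖x‖ ^ (-a)) *
        ∫⁻ t in Set.Ioo (0:ℝ) 1, ‖x‖ₑ * ‖fderiv ℝ f (t • x)‖ₑ := by gcongr
    _ = ∫⁻ t in Set.Ioo (0:ℝ) 1, ENNReal.ofReal (‖x‖ ^ (-a)) * (‖x‖ₑ * ‖fderiv ℝ f (t • x)‖ₑ) := by
        rw [lintegral_const_mul' _ _ ENNReal.ofReal_ne_top]
    _ = _ := by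
        refine setLIntegral_congr_fun measurableSet_Ioo fun t ht => ?_
        rw [weight_aux ht.1 hx0, hH, Set.indicator_of_mem (hSt x hx t ht), sub_add_cancel]

lemma hardyB_aux [CompleteSpace F] {f : Euc N → F} (hf : ContDiff ℝ 1 f) {p a T : ℝ} (hp : 1 ≤ p)
    (hT : 1 ≤ T) :
    ∫⁻ x, (ENNReal.ofReal (‖x‖ ^ (-a)) * ‖f (T • x) - f x‖ₑ) ^ p ≤
      (hardyCB (a - N / p)) ^ p *
        ∫⁻ x, (ENNReal.ofReal (‖x‖ ^ (1 - a)) * ‖fderiv ℝ f x‖ₑ) ^ p := by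
  have hp0 : 0 < p := by linarith
  have hfd := hf.continuous_fderiv one_ne_zero
  set H : Euc N → ℝ≥0∞ :=
    (fun x => ENNReal.ofReal (‖x‖ ^ (1 - a)) * ‖fderiv ℝ f x‖ₑ) with hH
  have hHm : Measurable H := by
    have := hfd.measurable
    fun_prop
  have h := dilation_le hHm (b := a - N / p) hp (s := Set.Ioi 1) measurableSet_Ioi
    (fun t ht => one_pos.trans ht)
  refine le_trans ?_ h
  refine lintegral_mono fun x => ?_
  simp only []
  gcongr
  by_cases hx0 : x = 0
  · simp [hx0]
  have h1 := segment_le hf 0 x hT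
  simp only [one_smul, zero_add] at h1
  calc _ ≤ ENNReal.ofReal (‖x‖ ^ (-a)) *
        ∫⁻ t in Set.Ioo (1:ℝ) T, ‖x‖ₑ * ‖fderiv ℝ f (t • x)‖ₑ := by gcongr
    _ ≤ ENNReal.ofReal (‖x‖ ^ (-a)) *
        ∫⁻ t in Set.Ioi (1:ℝ), ‖x‖ₑ * ‖fderiv ℝ f (t • x)‖ₑ := by
        gcongr; exact Set.Ioo_subset_Ioi_self
    _ = ∫⁻ t in Set.Ioi (1:ℝ), ENNReal.ofReal (‖x‖ ^ (-a)) * (‖x‖ₑ * ‖fderiv ℝ f (t • x)‖ₑ) := by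
        rw [lintegral_const_mul' _ _ ENNReal.ofReal_ne_top]
    _ = _ := by
        refine setLIntegral_congr_fun measurableSet_Ioi fun t ht => ?_
        rw [weight_aux (one_pos.trans ht) hx0, hH, sub_add_cancel]

lemma hardyB [CompleteSpace F] {f : Euc N → F} (hf : ContDiff ℝ 1 f) {p a r : ℝ} (hp : 1 ≤ p)
    (hN : 1 ≤ N) (hr : 1 ≤ r) (hfr : ∫⁻ x, ‖f x‖ₑ ^ r ≠ ⊤) :
    ∫⁻ x, (ENNReal.ofReal (‖x‖ ^ (-a)) * ‖f x‖ₑ) ^ p ≤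
      (hardyCB (a - N / p)) ^ p *
        ∫⁻ x, (ENNReal.ofReal (‖x‖ ^ (1 - a)) * ‖fderiv ℝ f x‖ₑ) ^ p := by
  have hp0 : 0 < p := by linarith
  have hr0 : 0 < r := by linarith
  -- f (T_n x) → 0 a.e.
  have hfc := hf.continuous
  have hm1 : ∀ n : ℕ, Measurable (fun x : Euc N => ‖f ((2 ^ n : ℝ) • x)‖ₑ) := fun n =>
    Continuous.measurable (by fun_prop)
  have hm2 : ∀ n : ℕ, Measurable (fun x : Euc N => ‖f ((2 ^ n : ℝ) • x) - f x‖ₑ) := fun n =>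
    Continuous.measurable (by fun_prop)
  have hT : ∀ᵐ x : Euc N, Tendsto (fun n : ℕ => f ((2 ^ n : ℝ) • x)) atTop (𝓝 0) := by
    have hsum : ∫⁻ x : Euc N, ∑' n : ℕ, ‖f ((2 ^ n : ℝ) • x)‖ₑ ^ r ≠ ⊤ := by
      rw [lintegral_tsum (fun n => ((hm1 n).pow_const r).aemeasurable)]
      have : ∀ n : ℕ, ∫⁻ x : Euc N, ‖f ((2 ^ n : ℝ) • x)‖ₑ ^ r
          ≤ (2⁻¹ : ℝ≥0∞) ^ n * ∫⁻ x, ‖f x‖ₑ ^ r := by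
        intro n
        rw [lintegral_smul_Euc (fun x => ‖f x‖ₑ ^ r) (by positivity)]
        gcongr
        rw [Real.rpow_neg (by positivity), Real.rpow_natCast, ENNReal.ofReal_inv_of_pos (by positivity),
          ENNReal.ofReal_pow (by positivity), ENNReal.ofReal_pow (by positivity), ENNReal.ofReal_ofNat,
          ← ENNReal.inv_pow, ENNReal.inv_le_inv]
        exact le_self_pow₀ (one_le_pow₀ (by norm_num)) (by omega)
      refine ne_top_of_le_ne_top ?_ (ENNReal.tsum_le_tsum this)
      rw [ENNReal.tsum_mul_right]
      refine ENNReal.mul_ne_top ?_ hfr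
      rw [ENNReal.tsum_geometric]
      simp
    have := ae_lt_top' (AEMeasurable.tsum fun n => ((hm1 n).pow_const r).aemeasurable) hsum
    filter_upwards [this] with x hx
    have h0 := ENNReal.tendsto_atTop_zero_of_tsum_ne_top hx.ne
    have h1 : Tendsto (fun n : ℕ => (‖f ((2 ^ n : ℝ) • x)‖ₑ ^ r) ^ (1 / r)) atTop (𝓝 (0 ^ (1 / r))) :=
      (ENNReal.continuous_rpow_const.tendsto 0).comp h0
    simp only [← ENNReal.rpow_mul, mul_one_div_cancel hr0.ne', ENNReal.rpow_one] at h1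
    rw [ENNReal.zero_rpow_of_pos (by positivity)] at h1
    exact tendsto_zero_iff_enorm_tendsto_zero.2 h1
  calc ∫⁻ x, (ENNReal.ofReal (‖x‖ ^ (-a)) * ‖f x‖ₑ) ^ p
      = ∫⁻ x, liminf (fun n : ℕ =>
          (ENNReal.ofReal (‖x‖ ^ (-a)) * ‖f ((2 ^ n : ℝ) • x) - f x‖ₑ) ^ p) atTop := by
        refine lintegral_congr_ae ?_
        filter_upwards [hT] with x hx
        refine Eq.symm (Tendsto.liminf_eq ?_)
        refine (ENNReal.continuous_rpow_const.tendsto _).comp ?_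
        refine ENNReal.Tendsto.const_mul ?_ (Or.inr ENNReal.ofReal_ne_top)
        have := (hx.sub_const (f x)).enorm
        simpa using this
    _ ≤ liminf (fun n : ℕ => ∫⁻ x,
          (ENNReal.ofReal (‖x‖ ^ (-a)) * ‖f ((2 ^ n : ℝ) • x) - f x‖ₑ) ^ p) atTop :=
        lintegral_liminf_le (fun n => by have := hm2 n; fun_prop)
    _ ≤ _ := by
        refine liminf_le_of_le (by isBoundedDefault) fun b hb => ?_
        obtain ⟨n, hn⟩ := hb.exists
        exact hn.trans (hardyB_aux hf hp (one_le_pow₀ (by norm_num)))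
end

section
lemma eLpNorm_ofReal {α ε : Type*} [MeasurableSpace α] {μ : Measure α} [TopologicalSpace ε] [ContinuousENorm ε]
    (f : α → ε) {r : ℝ} (hr : 0 < r) :
    eLpNorm f (ENNReal.ofReal r) μ = (∫⁻ x, ‖f x‖ₑ ^ r ∂μ) ^ (1 / r) := by
  rw [eLpNorm_eq_lintegral_rpow_enorm_toReal (by simpa using hr) ENNReal.ofReal_ne_top,
    ENNReal.toReal_ofReal hr.le]

lemma eLpNorm_ofReal_rpow {α ε : Type*} [MeasurableSpace α] {μ : Measure α} [TopologicalSpace ε] [ContinuousENorm ε]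
    (f : α → ε) {r : ℝ} (hr : 0 < r) :
    eLpNorm f (ENNReal.ofReal r) μ ^ r = ∫⁻ x, ‖f x‖ₑ ^ r ∂μ := by
  rw [eLpNorm_ofReal f hr, ← ENNReal.rpow_mul, one_div_mul_cancel hr.ne', ENNReal.rpow_one]

variable {N : ℕ} {F : Type*} [NormedAddCommGroup F] [NormedSpace ℝ F]

lemma translation_le [CompleteSpace F] {f : Euc N → F} (hf : ContDiff ℝ 1 f) {r : ℝ} (hr : 1 ≤ r) (y : Euc N) :
    ∫⁻ x, ‖f (x + y) - f x‖ₑ ^ r ≤ ‖y‖ₑ ^ r * ∫⁻ x, ‖fderiv ℝ f x‖ₑ ^ r := by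
  have hr0 : 0 < r := by linarith
  have hfd := hf.continuous_fderiv one_ne_zero
  have hmeas : Measurable (fun z : Euc N × ℝ => (‖y‖ₑ * ‖fderiv ℝ f (z.1 + z.2 • y)‖ₑ) ^ r) := by
    have h0 : Measurable (fun z : Euc N × ℝ => ‖fderiv ℝ f (z.1 + z.2 • y)‖ₑ) :=
      Continuous.measurable (by fun_prop)
    fun_prop
  have hm1 : ∀ x : Euc N, Measurable (fun t : ℝ => ‖fderiv ℝ f (x + t • y)‖ₑ) := fun x =>
    Continuous.measurable (by fun_prop)
  calc ∫⁻ x, ‖f (x + y) - f x‖ₑ ^ r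
      ≤ ∫⁻ x, ∫⁻ t in Set.Ioo (0:ℝ) 1, (‖y‖ₑ * ‖fderiv ℝ f (x + t • y)‖ₑ) ^ r := by
        refine lintegral_mono fun x => ?_
        have h1 := segment_le hf x y zero_le_one
        simp only [one_smul, zero_smul, add_zero] at h1
        calc _ ≤ (∫⁻ t in Set.Ioo (0:ℝ) 1, ‖y‖ₑ * ‖fderiv ℝ f (x + t • y)‖ₑ) ^ r := by gcongr
          _ ≤ _ := by
            refine (jensen_pow _ (by have := hm1 x; fun_prop) hr).trans ?_
            simp
    _ = ∫⁻ t in Set.Ioo (0:ℝ) 1, ∫⁻ x, (‖y‖ₑ * ‖fderiv ℝ f (x + t • y)‖ₑ) ^ r := by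
        rw [lintegral_lintegral_swap]
        exact hmeas.aemeasurable
    _ = ∫⁻ t in Set.Ioo (0:ℝ) 1, ‖y‖ₑ ^ r * ∫⁻ x, ‖fderiv ℝ f x‖ₑ ^ r := by
        refine lintegral_congr fun t => ?_
        simp only [ENNReal.mul_rpow_of_nonneg _ _ hr0.le]
        rw [lintegral_const_mul' _ _ (by simp [hr0.le])]
        congr 1
        exact lintegral_add_right_eq_self (μ := volume) (fun x => ‖fderiv ℝ f x‖ₑ ^ r) (t • y)
    _ = _ := by simp

lemma gns_memLp [FiniteDimensional ℝ F] (hN : 1 ≤ N) {r r' : ℝ} (hr : 1 ≤ r) (hr' : 0 < r')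
    (hrr : r'⁻¹ = r⁻¹ - (N : ℝ)⁻¹) :
    ∃ C : NNReal, ∀ f : Euc N → F, ContDiff ℝ 1 f → eLpNorm f (ENNReal.ofReal r) volume ≠ ⊤ →
      eLpNorm f (ENNReal.ofReal r') volume ≤ C * eLpNorm (fderiv ℝ f) (ENNReal.ofReal r) volume := by
  refine ⟨SNormLESNormFDerivOfEqConst F (volume : Measure (Euc N)) r.toNNReal, fun f hf hfr => ?_⟩
  set C := SNormLESNormFDerivOfEqConst F (volume : Measure (Euc N)) r.toNNReal
  have hG : ∀ u : Euc N → F, ContDiff ℝ 1 u → HasCompactSupport u →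
      eLpNorm u (ENNReal.ofReal r') volume ≤ C * eLpNorm (fderiv ℝ u) (ENNReal.ofReal r) volume := by
    intro u hu hcu
    refine eLpNorm_le_eLpNorm_fderiv_of_eq volume hu hcu (p := r.toNNReal) (p' := r'.toNNReal) ?_ ?_ ?_
    · rwa [Real.one_le_toNNReal]
    · simp; omega
    · simp [hr'.le, hrr, (by linarith : (0:ℝ) ≤ r)]
  let χ : ContDiffBump (0 : Euc N) := ⟨1, 2, one_pos, by norm_num⟩
  have hχ : ContDiff ℝ 1 χ := χ.contDiff
  obtain ⟨K, hK⟩ : ∃ K : NNReal, ∀ x, ‖fderiv ℝ χ x‖₊ ≤ K := by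
    obtain ⟨K, hK⟩ := (hχ.continuous_fderiv one_ne_zero).bounded_above_of_compact_support
      (χ.hasCompactSupport.fderiv (𝕜 := ℝ))
    exact ⟨K.toNNReal, fun x => by rw [← NNReal.coe_le_coe]; exact (hK x).trans (Real.le_coe_toNNReal K)⟩
  let T : ℕ → Euc N → F := fun n x => χ (((n : ℝ) + 1)⁻¹ • x) • f x
  have hTs : ∀ n, ContDiff ℝ 1 (T n) := fun n => by
    refine ContDiff.smul (hχ.comp (contDiff_const_smul _)) hf
  have hTc : ∀ n, HasCompactSupport (T n) := fun n => by
    refine HasCompactSupport.smul_right (f := fun x : Euc N => χ (((n : ℝ) + 1)⁻¹ • x)) ?_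
    exact χ.hasCompactSupport.comp_homeomorph (Homeomorph.smulOfNeZero ((n : ℝ) + 1)⁻¹ (by positivity))
  have hTd : ∀ n x, ‖fderiv ℝ (T n) x‖ₑ ≤ ‖(‖fderiv ℝ f x‖ + ((n : ℝ) + 1)⁻¹ * K * ‖f x‖)‖ₑ := by
    intro n x
    rw [enorm_le_iff_norm_le]
    rw [Real.norm_of_nonneg (by positivity)]
    have hd1 : HasFDerivAt (fun x : Euc N => χ (((n : ℝ) + 1)⁻¹ • x))
        ((fderiv ℝ χ (((n : ℝ) + 1)⁻¹ • x)).comp (((n : ℝ) + 1)⁻¹ • ContinuousLinearMap.id ℝ _)) x := by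
      refine HasFDerivAt.comp (g := (χ : Euc N → ℝ)) (f := fun x : Euc N => ((n : ℝ) + 1)⁻¹ • x) x ((hχ.differentiable one_ne_zero) _).hasFDerivAt ?_
      exact (((n : ℝ) + 1)⁻¹ • ContinuousLinearMap.id ℝ (Euc N)).hasFDerivAt
    have hd2 := ((hf.differentiable one_ne_zero) x).hasFDerivAt
    have := (hd1.smul hd2).fderiv
    change ‖fderiv ℝ (fun x => χ (((n : ℝ) + 1)⁻¹ • x) • f x) x‖ ≤ _
    rw [show fderiv ℝ (fun x => χ (((n : ℝ) + 1)⁻¹ • x) • f x) x = _ from this]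
    refine (norm_add_le _ _).trans ?_
    gcongr
    · rw [norm_smul, Real.norm_of_nonneg χ.nonneg]
      exact mul_le_of_le_one_left (norm_nonneg _) χ.le_one
    · rw [ContinuousLinearMap.norm_smulRight_apply]
      gcongr
      refine (ContinuousLinearMap.opNorm_comp_le _ _).trans ?_
      rw [mul_comm, norm_smul, Real.norm_of_nonneg (by positivity)]
      have h1 := ContinuousLinearMap.norm_id_le (𝕜 := ℝ) (E := Euc N)
      have h2 : ‖fderiv ℝ χ (((n : ℝ) + 1)⁻¹ • x)‖ ≤ K := hK _
      gcongr
      exact mul_le_of_le_one_right (by positivity) h1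
  have hfc := hf.continuous
  have hfd := hf.continuous_fderiv one_ne_zero
  have hr1 : (1:ℝ≥0∞) ≤ ENNReal.ofReal r := by simpa using hr
  have hTn : ∀ n, eLpNorm (T n) (ENNReal.ofReal r') volume ≤
      C * (eLpNorm (fderiv ℝ f) (ENNReal.ofReal r) volume +
        ENNReal.ofReal (((n : ℝ) + 1)⁻¹ * K) * eLpNorm f (ENNReal.ofReal r) volume) := by
    intro n
    refine (hG _ (hTs n) (hTc n)).trans ?_
    gcongr
    refine (eLpNorm_mono_enorm (hTd n)).trans ?_
    refine (eLpNorm_add_le (f := fun x => ‖fderiv ℝ f x‖) (g := fun x => ((n : ℝ) + 1)⁻¹ * K * ‖f x‖)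
      hfd.norm.aestronglyMeasurable (by fun_prop) hr1).trans ?_
    rw [eLpNorm_norm]
    gcongr
    refine (eLpNorm_const_smul_le (c := ((n : ℝ) + 1)⁻¹ * K) (f := fun x => ‖f x‖)).trans ?_
    rw [eLpNorm_norm]
    gcongr
    rw [← ofReal_norm, Real.norm_of_nonneg (by positivity)]
  have hlim : ∀ x, Tendsto (fun n => T n x) atTop (𝓝 (f x)) := by
    intro x
    have h0 : Tendsto (fun n : ℕ => ((n : ℝ) + 1)⁻¹ • x) atTop (𝓝 ((0:ℝ) • x)) := by
      refine Tendsto.smul_const ?_ x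
      simpa using tendsto_one_div_add_atTop_nhds_zero_nat (𝕜 := ℝ)
    rw [zero_smul] at h0
    have h1 : Tendsto (fun n : ℕ => χ (((n : ℝ) + 1)⁻¹ • x)) atTop (𝓝 (χ 0)) :=
      (hχ.continuous.tendsto 0).comp h0
    have h2 : χ (0 : Euc N) = 1 := χ.one_of_mem_closedBall (by simp [χ])
    rw [h2] at h1
    simpa using h1.smul_const (f x)
  have hF := Lp.eLpNorm_lim_le_liminf_eLpNorm (μ := (volume : Measure (Euc N))) (p := ENNReal.ofReal r') (f := T)
    (fun n => (hTs n).continuous.aestronglyMeasurable) f (ae_of_all _ hlim)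
  refine hF.trans ?_
  refine (liminf_le_liminf (Eventually.of_forall hTn)).trans ?_
  refine (Tendsto.liminf_eq ?_).le
  refine ENNReal.Tendsto.const_mul ?_ (Or.inr ENNReal.coe_ne_top)
  have h3 : Tendsto (fun n : ℕ => ENNReal.ofReal (((n : ℝ) + 1)⁻¹ * K)) atTop (𝓝 0) := by
    have h0 : Tendsto (fun n : ℕ => ((n : ℝ) + 1)⁻¹ * K) atTop (𝓝 (0 * K)) :=
      Tendsto.mul_const _ (by simpa using tendsto_one_div_add_atTop_nhds_zero_nat (𝕜 := ℝ))
    simpa using ENNReal.tendsto_ofReal h0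
  simpa using (ENNReal.Tendsto.mul_const h3 (Or.inr hfr)).const_add
    (eLpNorm (fderiv ℝ f) (ENNReal.ofReal r) volume)
end

section
variable {N : ℕ} {F : Type*} [NormedAddCommGroup F] [NormedSpace ℝ F]

/-- Uniform probability measure on the unit ball. -/
def unifBall (N : ℕ) : Measure (Euc N) :=
  (volume (ball (0 : Euc N) 1))⁻¹ • volume.restrict (ball 0 1)

lemma vol_ball_ne_zero : volume (ball (0 : Euc N) 1) ≠ 0 := (measure_ball_pos _ _ one_pos).ne'
lemma vol_ball_ne_top : volume (ball (0 : Euc N) 1) ≠ ⊤ := measure_ball_lt_top.ne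

instance : IsProbabilityMeasure (unifBall N) := by
  constructor
  simp only [unifBall, Measure.smul_apply, Measure.restrict_apply_univ, smul_eq_mul]
  exact ENNReal.inv_mul_cancel vol_ball_ne_zero vol_ball_ne_top

lemma lintegral_unifBall_le (H : Euc N → ℝ≥0∞) :
    ∫⁻ z, H z ∂(unifBall N) ≤ (volume (ball (0 : Euc N) 1))⁻¹ * ∫⁻ z, H z := by
  rw [unifBall, lintegral_smul_measure, smul_eq_mul]
  gcongr
  exact Measure.restrict_le_self

lemma integrable_unifBall {f : Euc N → F} (hf : Continuous f) : Integrable f (unifBall N) := by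
  have h : IntegrableOn f (closedBall 0 1) volume :=
    hf.continuousOn.integrableOn_compact (isCompact_closedBall 0 1)
  exact Integrable.smul_measure (h.mono_set ball_subset_closedBall) (ENNReal.inv_ne_top.2 vol_ball_ne_zero)

lemma vol_univ_top (hN : 1 ≤ N) : volume (Set.univ : Set (Euc N)) = ⊤ := by
  have : Nonempty (Fin N) := ⟨⟨0, hN⟩⟩
  exact measure_univ_of_isAddLeftInvariant _

lemma sobolev_exists [FiniteDimensional ℝ F] (hN : 1 ≤ N) {r r' : ℝ} (hr : 1 ≤ r) (hr' : 1 ≤ r')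
    (hrr : r'⁻¹ = r⁻¹ - (N : ℝ)⁻¹) :
    ∃ C : NNReal, ∀ f : Euc N → F, ContDiff ℝ 1 f →
      eLpNorm (fderiv ℝ f) (ENNReal.ofReal r) volume ≠ ⊤ →
      ∃ c : F, eLpNorm (fun x => f x - c) (ENNReal.ofReal r') volume ≤
        C * eLpNorm (fderiv ℝ f) (ENNReal.ofReal r) volume := by
  have hr0 : 0 < r := by linarith
  have hr0' : 0 < r' := by linarith
  obtain ⟨C, hC⟩ := gns_memLp (F := F) hN hr hr0' hrr
  have : CompleteSpace F := FiniteDimensional.complete ℝ F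
  have : ProperSpace F := FiniteDimensional.proper_real F
  refine ⟨2 * C, fun f hf hfd => ?_⟩
  set D := eLpNorm (fderiv ℝ f) (ENNReal.ofReal r) volume with hD
  have hfc := hf.continuous
  have hfdc := hf.continuous_fderiv one_ne_zero
  have hr1 : (1:ℝ≥0∞) ≤ ENNReal.ofReal r := by simpa using hr
  -- translation estimates
  have hb : ∀ y : Euc N, eLpNorm (fun x => f (x + y) - f x) (ENNReal.ofReal r) volume ≤ ‖y‖ₑ * D := by
    intro y
    rw [← ENNReal.rpow_le_rpow_iff hr0, ENNReal.mul_rpow_of_nonneg _ _ hr0.le, hD,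
      eLpNorm_ofReal_rpow _ hr0, eLpNorm_ofReal_rpow _ hr0]
    exact translation_le hf hr y
  have hb' : ∀ y : Euc N, eLpNorm (fun x => f (x + y) - f x) (ENNReal.ofReal r') volume ≤
      (2 * C : NNReal) * D := by
    intro y
    have hs : ContDiff ℝ 1 (fun x => f (x + y)) := hf.comp (contDiff_id.add contDiff_const)
    refine (hC _ (hs.sub hf) (ne_top_of_le_ne_top (ENNReal.mul_ne_top (by simp) hfd) (hb y))).trans ?_
    have e1 : fderiv ℝ (fun x => f (x + y) - f x) = fun x => fderiv ℝ f (x + y) - fderiv ℝ f x := by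
      ext1 x
      rw [fderiv_fun_sub (hs.differentiable one_ne_zero x) (hf.differentiable one_ne_zero x),
        fderiv_comp_add_right]
    rw [e1]
    push_cast
    rw [mul_comm 2 (C:ℝ≥0∞), mul_assoc]
    gcongr
    refine (eLpNorm_sub_le (f := fun x => fderiv ℝ f (x + y)) (by fun_prop) (by fun_prop) hr1).trans ?_
    rw [two_mul]
    gcongr
    refine le_of_eq ?_
    rw [hD, eLpNorm_ofReal _ hr0, eLpNorm_ofReal _ hr0]
    congr 1
    exact lintegral_add_right_eq_self (μ := volume) (fun x => ‖fderiv ℝ f x‖ₑ ^ r) y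
  let R : ℕ → ℝ := fun n => (n : ℝ) + 1
  have hR : ∀ n, 0 < R n := fun n => by positivity
  let M : ℕ → Euc N → F := fun n x => ∫ z, f (x + R n • z) ∂(unifBall N)
  have hint : ∀ n x, Integrable (fun z => f (x + R n • z)) (unifBall N) := fun n x =>
    integrable_unifBall (by fun_prop)
  -- h_n bound
  have hh : ∀ n, eLpNorm (fun x => f x - M n x) (ENNReal.ofReal r') volume ≤ (2 * C : NNReal) * D := by
    intro n
    rw [← ENNReal.rpow_le_rpow_iff hr0', eLpNorm_ofReal_rpow _ hr0']
    have hm : Measurable (fun z : Euc N × Euc N => ‖f (z.1 + R n • z.2) - f z.1‖ₑ ^ r') := by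
      have h0 : Measurable (fun z : Euc N × Euc N => ‖f (z.1 + R n • z.2) - f z.1‖ₑ) :=
        Continuous.measurable (by fun_prop)
      fun_prop
    calc ∫⁻ x, ‖f x - M n x‖ₑ ^ r'
        ≤ ∫⁻ x, ∫⁻ z, ‖f (x + R n • z) - f x‖ₑ ^ r' ∂(unifBall N) := by
          refine lintegral_mono fun x => ?_
          have e : f x - M n x = - ∫ z, (f (x + R n • z) - f x) ∂(unifBall N) := by
            rw [integral_sub (hint n x) (integrable_const _)]; simp [M]
          have h0 : Measurable (fun z : Euc N => ‖f (x + R n • z) - f x‖ₑ) :=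
            Continuous.measurable (by fun_prop)
          rw [e, enorm_neg]
          refine (ENNReal.rpow_le_rpow (enorm_integral_le_lintegral_enorm _) hr0'.le).trans ?_
          refine (jensen_pow _ h0.aemeasurable hr').trans ?_
          simp
      _ = ∫⁻ z, (∫⁻ x, ‖f (x + R n • z) - f x‖ₑ ^ r') ∂(unifBall N) := by
          rw [lintegral_lintegral_swap]
          exact hm.aemeasurable
      _ ≤ ∫⁻ _, ((2 * C : NNReal) * D) ^ r' ∂(unifBall N) := by
          refine lintegral_mono fun z => ?_
          rw [← eLpNorm_ofReal_rpow _ hr0']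
          exact ENNReal.rpow_le_rpow (hb' _) hr0'.le
      _ = _ := by simp
  -- M n x - M n 0 → 0
  have hM0 : ∀ x, Tendsto (fun n => M n x - M n 0) atTop (𝓝 0) := by
    intro x
    have hle : ∀ n, ‖M n x - M n 0‖ₑ ^ r ≤ ENNReal.ofReal (R n ^ (-(N:ℝ))) *
        ((volume (ball (0 : Euc N) 1))⁻¹ * (‖x‖ₑ * D) ^ r) := by
      intro n
      have e : M n x - M n 0 = ∫ z, (f (x + R n • z) - f (0 + R n • z)) ∂(unifBall N) := by
        rw [integral_sub (hint n x) (hint n 0)]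
      have h0 : Measurable (fun z : Euc N => ‖f (x + R n • z) - f (0 + R n • z)‖ₑ) :=
        Continuous.measurable (by fun_prop)
      calc ‖M n x - M n 0‖ₑ ^ r ≤ ∫⁻ z, ‖f (x + R n • z) - f (0 + R n • z)‖ₑ ^ r ∂(unifBall N) := by
            rw [e]
            refine (ENNReal.rpow_le_rpow (enorm_integral_le_lintegral_enorm _) hr0.le).trans ?_
            refine (jensen_pow _ h0.aemeasurable hr).trans ?_
            simp
        _ ≤ (volume (ball (0 : Euc N) 1))⁻¹ * ∫⁻ z, ‖f (x + R n • z) - f (0 + R n • z)‖ₑ ^ r :=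
            lintegral_unifBall_le _
        _ = (volume (ball (0 : Euc N) 1))⁻¹ * (ENNReal.ofReal (R n ^ (-(N:ℝ))) *
              ∫⁻ z, ‖f (z + x) - f z‖ₑ ^ r) := by
            rw [← lintegral_smul_Euc (fun z => ‖f (z + x) - f z‖ₑ ^ r) (hR n)]
            simp only [zero_add, add_comm x]
        _ ≤ _ := by
            rw [mul_left_comm]
            gcongr
            rw [← eLpNorm_ofReal_rpow _ hr0]
            exact ENNReal.rpow_le_rpow (hb _) hr0.le
    have hz : Tendsto (fun n => ENNReal.ofReal (R n ^ (-(N:ℝ))) *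
        ((volume (ball (0 : Euc N) 1))⁻¹ * (‖x‖ₑ * D) ^ r)) atTop (𝓝 0) := by
      have h1 : Tendsto (fun n => R n ^ (-(N:ℝ))) atTop (𝓝 0) :=
        (tendsto_rpow_neg_atTop (by exact_mod_cast hN)).comp
          (tendsto_atTop_add_const_right _ _ tendsto_natCast_atTop_atTop)
      have h2 := ENNReal.tendsto_ofReal h1
      rw [ENNReal.ofReal_zero] at h2
      have := ENNReal.Tendsto.mul_const (b := ((volume (ball (0 : Euc N) 1))⁻¹ * (‖x‖ₑ * D) ^ r)) h2
        (Or.inr (ENNReal.mul_ne_top (ENNReal.inv_ne_top.2 vol_ball_ne_zero)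
          (ENNReal.rpow_ne_top_of_nonneg hr0.le (ENNReal.mul_ne_top (by simp) hfd))))
      simpa using this
    have h0 := tendsto_of_tendsto_of_tendsto_of_le_of_le tendsto_const_nhds hz (fun n => zero_le) hle
    have h1 : Tendsto (fun n : ℕ => (‖M n x - M n 0‖ₑ ^ r) ^ (1 / r)) atTop (𝓝 (0 ^ (1 / r))) :=
      (ENNReal.continuous_rpow_const.tendsto 0).comp h0
    simp only [← ENNReal.rpow_mul, mul_one_div_cancel hr0.ne', ENNReal.rpow_one] at h1
    rw [ENNReal.zero_rpow_of_pos (by positivity)] at h1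
    exact tendsto_zero_iff_enorm_tendsto_zero.2 h1
  have hMs : ∀ n, StronglyMeasurable (fun x => f x - M n x) := by
    intro n
    refine hfc.stronglyMeasurable.sub ?_
    refine (StronglyMeasurable.integral_prod_right' (f := fun z : Euc N × Euc N => f (z.1 + R n • z.2)) ?_)
    exact Continuous.stronglyMeasurable (by fun_prop)
  have hMc : ∀ n, AEStronglyMeasurable (fun x => f x - M n x) volume := fun n =>
    (hMs n).aestronglyMeasurable
  -- bounded subsequence
  obtain ⟨x₀, hx₀⟩ : ∃ x₀ : Euc N, liminf (fun n => ‖f x₀ - M n x₀‖ₑ ^ r') atTop < ⊤ := by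
    have h1 : ∫⁻ x, liminf (fun n => ‖f x - M n x‖ₑ ^ r') atTop ≤ ((2 * C : NNReal) * D) ^ r' := by
      refine (lintegral_liminf_le' (fun n => (hMc n).enorm.pow_const r')).trans ?_
      refine liminf_le_of_le (by isBoundedDefault) fun b hb => ?_
      obtain ⟨n, hn⟩ := hb.exists
      refine hn.trans ?_
      rw [← eLpNorm_ofReal_rpow _ hr0']
      exact ENNReal.rpow_le_rpow (hh n) hr0'.le
    have h2 := ae_lt_top (Measurable.liminf fun n => (hMs n).enorm.pow_const r')
      (ne_top_of_le_ne_top (ENNReal.rpow_ne_top_of_nonneg hr0'.le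
        (ENNReal.mul_ne_top ENNReal.coe_ne_top hfd)) h1)
    exact h2.exists
  obtain ⟨K, hK1, hK2⟩ := exists_between hx₀
  have hfr : ∃ᶠ n in atTop, ‖f x₀ - M n x₀‖ₑ ^ r' < K := frequently_lt_of_liminf_lt (by isBoundedDefault) hK1
  have hfr2 : ∃ᶠ n in atTop, M n 0 ∈ closedBall (f x₀) ((K ^ (1/r')).toReal + 1) := by
    have hev : ∀ᶠ n in atTop, ‖M n x₀ - M n 0‖ < 1 := by
      have := (hM0 x₀).norm
      rw [norm_zero] at this
      exact this.eventually (gt_mem_nhds one_pos)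
    refine (hfr.and_eventually hev).mono fun n hn => ?_
    have hKt : K ^ (1 / r') ≠ ⊤ := ENNReal.rpow_ne_top_of_nonneg (by positivity) hK2.ne
    have h3 : ‖f x₀ - M n x₀‖ ≤ (K ^ (1 / r')).toReal := by
      have : ‖f x₀ - M n x₀‖ₑ ≤ K ^ (1 / r') := by
        rw [← ENNReal.rpow_le_rpow_iff hr0', ← ENNReal.rpow_mul, one_div_mul_cancel hr0'.ne',
          ENNReal.rpow_one]
        exact hn.1.le
      have := ENNReal.toReal_mono hKt this
      simpa using this
    rw [mem_closedBall, dist_eq_norm]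
    calc ‖M n 0 - f x₀‖ = ‖-(f x₀ - M n x₀) - (M n x₀ - M n 0)‖ := by congr 1; abel
      _ ≤ _ := by
        refine (norm_sub_le _ _).trans ?_
        rw [norm_neg]
        linarith [hn.2]
  obtain ⟨c, -, φ, hφ, hc⟩ := tendsto_subseq_of_frequently_bounded isBounded_closedBall hfr2
  refine ⟨c, ?_⟩
  have hlim : ∀ x, Tendsto (fun n => f x - M (φ n) x) atTop (𝓝 (f x - c)) := by
    intro x
    have h1 := ((hM0 x).comp hφ.tendsto_atTop).add hc
    simp only [Function.comp_def, sub_add_cancel, zero_add] at h1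
    exact h1.const_sub _
  refine (Lp.eLpNorm_lim_le_liminf_eLpNorm (μ := (volume : Measure (Euc N))) (p := ENNReal.ofReal r')
    (f := fun n x => f x - M (φ n) x) (fun n => hMc _) (fun x => f x - c) (ae_of_all _ hlim)).trans ?_
  refine liminf_le_of_le (by isBoundedDefault) fun b hb => ?_
  obtain ⟨n, hn⟩ := hb.exists
  exact hn.trans (hh _)

lemma const_eq_zero_of_eLpNorm (hN : 1 ≤ N) {r : ℝ} (hr : 0 < r) {c : F}
    (h : eLpNorm (fun _ : Euc N => c) (ENNReal.ofReal r) volume ≠ ⊤) : c = 0 := by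
  by_contra hc
  rw [eLpNorm_const _ (by simpa using hr) (NeZero.ne _), vol_univ_top hN] at h
  apply h
  rw [ENNReal.toReal_ofReal hr.le, ENNReal.top_rpow_of_pos (by positivity), ENNReal.mul_top]
  simpa using hc

lemma sobolev [FiniteDimensional ℝ F] (hN : 1 ≤ N) {r r' : ℝ} (hr : 1 ≤ r) (hr' : 1 ≤ r')
    (hrr : r'⁻¹ = r⁻¹ - (N : ℝ)⁻¹) :
    ∃ C : NNReal, ∀ f : Euc N → F, ContDiff ℝ 1 f →
      eLpNorm (fderiv ℝ f) (ENNReal.ofReal r) volume ≠ ⊤ →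
      eLpNorm f (ENNReal.ofReal r') volume ≠ ⊤ → eLpNorm f (ENNReal.ofReal r') volume ≤
        C * eLpNorm (fderiv ℝ f) (ENNReal.ofReal r) volume := by
  obtain ⟨C, hC⟩ := sobolev_exists (F := F) hN hr hr' hrr
  refine ⟨C, fun f hf hfd hfr => ?_⟩
  obtain ⟨c, hc⟩ := hC f hf hfd
  have hfc := hf.continuous
  have h1 : eLpNorm (fun _ : Euc N => c) (ENNReal.ofReal r') volume ≠ ⊤ := by
    have : (fun _ : Euc N => c) = fun x => f x - (f x - c) := by ext; simp
    rw [this]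
    refine ne_top_of_le_ne_top ?_ (eLpNorm_sub_le (f := f) (by fun_prop) (by fun_prop) (by simpa using hr'))
    exact ENNReal.add_ne_top.2 ⟨hfr, ne_top_of_le_ne_top (ENNReal.mul_ne_top ENNReal.coe_ne_top hfd) hc⟩
  rw [const_eq_zero_of_eLpNorm hN (by linarith) h1] at hc
  simpa using hc
end

section
variable {N : ℕ} {F : Type*} [NormedAddCommGroup F] [NormedSpace ℝ F]

lemma morrey_local [CompleteSpace F] {r : ℝ} (hr : 1 ≤ r) (hNr : N < r) :
    ∃ K : ℝ≥0∞, K ≠ ⊤ ∧ ∀ f : Euc N → F, ContDiff ℝ 1 f → ∀ z : Euc N, z ≠ 0 →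
      (ENNReal.ofReal (‖z‖ ^ (-(1 - N / r))) * ‖f z‖ₑ) ^ r ≤
        K * ((∫⁻ x in ball z (‖z‖ / 2), (ENNReal.ofReal (‖x‖ ^ (-1 : ℝ)) * ‖f x‖ₑ) ^ r)
          + ∫⁻ x in ball z (‖z‖ / 2), ‖fderiv ℝ f x‖ₑ ^ r) := by
  have hr0 : 0 < r := by linarith
  have hb : 0 < 1 - N / r := by rw [sub_pos, div_lt_one hr0]; exact hNr
  set ω := volume (ball (0 : Euc N) 1) with hω
  set A := hardyCA (1 - N / r) ^ r with hA
  have hAt : A ≠ ⊤ := ENNReal.rpow_ne_top_of_nonneg hr0.le (hardyCA_lt_top hb).ne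
  refine ⟨(2 ^ N * ω⁻¹) * (2 ^ (r - 1) * (2 ^ r * (1 + A))), ?_, fun f hf z hz => ?_⟩
  · have : ω ≠ 0 := vol_ball_ne_zero
    refine ENNReal.mul_ne_top (ENNReal.mul_ne_top (by simp) (ENNReal.inv_ne_top.2 this))
      (ENNReal.mul_ne_top ?_ (ENNReal.mul_ne_top ?_ (by simp [hAt])))
    · exact ENNReal.rpow_ne_top_of_nonneg (by linarith) (by simp)
    · exact ENNReal.rpow_ne_top_of_nonneg hr0.le (by simp)
  have hfc := hf.continuous
  have hfdc := hf.continuous_fderiv one_ne_zero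
  set R := ‖z‖ with hRdef
  have hR : 0 < R := norm_pos_iff.2 hz
  set B := ball z (R / 2) with hB
  set I1 := ∫⁻ x in B, (ENNReal.ofReal (‖x‖ ^ (-1 : ℝ)) * ‖f x‖ₑ) ^ r with hI1
  set I2 := ∫⁻ x in B, ‖fderiv ℝ f x‖ₑ ^ r with hI2
  -- Hardy around z
  have hH : ∫⁻ x in B, (ENNReal.ofReal (‖x - z‖ ^ (-1 : ℝ)) * ‖f x - f z‖ₑ) ^ r ≤ A * I2 := by
    have hs : ContDiff ℝ 1 (fun x => f (x + z) - f z) :=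
      (hf.comp (contDiff_id.add contDiff_const)).sub contDiff_const
    have h := hardyA hs (by simp) hr (a := 1) (S := ball (0 : Euc N) (R / 2)) measurableSet_ball
      (fun x hx t ht => by
        rw [mem_ball_zero_iff] at hx ⊢
        rw [norm_smul, Real.norm_of_nonneg ht.1.le]
        exact (mul_le_of_le_one_left (norm_nonneg _) ht.2.le).trans_lt hx)
    have hpre : ∀ x : Euc N, x + z ∈ B ↔ x ∈ ball (0 : Euc N) (R / 2) := by
      intro x; simp [hB, mem_ball, dist_eq_norm]
    have e1 : ∀ G : Euc N → ℝ≥0∞, ∫⁻ x in B, G x = ∫⁻ x in ball (0 : Euc N) (R / 2), G (x + z) := by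
      intro G
      rw [← lintegral_indicator measurableSet_ball, ← lintegral_indicator measurableSet_ball,
        ← lintegral_add_right_eq_self _ z]
      refine lintegral_congr fun x => ?_
      by_cases hx : x ∈ ball (0 : Euc N) (R / 2)
      · rw [Set.indicator_of_mem hx, Set.indicator_of_mem ((hpre x).2 hx)]
      · rw [Set.indicator_of_notMem hx, Set.indicator_of_notMem (fun h => hx ((hpre x).1 h))]
    rw [hI2, e1, e1]
    simp only [add_sub_cancel_right]
    refine h.trans (le_of_eq ?_)
    congr 1
    refine lintegral_congr fun x => ?_
    rw [sub_self, Real.rpow_zero, ENNReal.ofReal_one, one_mul, fderiv_sub_const, fderiv_comp_add_right]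
  have hpt : ∀ y ∈ B, ‖f z‖ₑ ^ r ≤ 2 ^ (r - 1) * ((ENNReal.ofReal (2 * R)) ^ r *
      ((ENNReal.ofReal (‖y‖ ^ (-1 : ℝ)) * ‖f y‖ₑ) ^ r +
        (ENNReal.ofReal (‖y - z‖ ^ (-1 : ℝ)) * ‖f y - f z‖ₑ) ^ r)) := by
    intro y hy
    rw [hB, mem_ball, dist_eq_norm] at hy
    have hy1 : ‖y‖ ≤ 2 * R := by
      have := norm_add_le (y - z) z
      rw [sub_add_cancel] at this
      linarith
    have hy0 : 0 < ‖y‖ := by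
      have := norm_sub_le y (y - z)
      rw [_root_.sub_sub_cancel] at this
      linarith
    have aux : ∀ (w : ℝ) (e : ℝ≥0∞), 0 < w → w ≤ 2 * R →
        e ≤ ENNReal.ofReal (2 * R) * (ENNReal.ofReal (w ^ (-1 : ℝ)) * e) := by
      intro w e hw hwR
      rw [← mul_assoc, ← ENNReal.ofReal_mul (by positivity)]
      refine le_mul_of_one_le_left zero_le ?_
      rw [← ENNReal.ofReal_one]
      refine ENNReal.ofReal_le_ofReal ?_
      rw [Real.rpow_neg_one, ← div_eq_mul_inv, one_le_div hw]
      exact hwR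
    have h1 : ‖f z‖ₑ ≤ ENNReal.ofReal (2 * R) * (ENNReal.ofReal (‖y‖ ^ (-1 : ℝ)) * ‖f y‖ₑ) +
        ENNReal.ofReal (2 * R) * (ENNReal.ofReal (‖y - z‖ ^ (-1 : ℝ)) * ‖f y - f z‖ₑ) := by
      calc ‖f z‖ₑ = ‖f y - (f y - f z)‖ₑ := by rw [_root_.sub_sub_cancel]
        _ ≤ ‖f y‖ₑ + ‖f y - f z‖ₑ := enorm_sub_le
        _ ≤ _ := by
          gcongr
          · exact aux _ _ hy0 hy1
          · by_cases hyz : y = z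
            · simp [hyz]
            · exact aux _ _ (norm_pos_iff.2 (sub_ne_zero.2 hyz)) (by linarith)
    calc ‖f z‖ₑ ^ r ≤ _ := ENNReal.rpow_le_rpow h1 hr0.le
      _ ≤ _ := ENNReal.rpow_add_le_mul_rpow_add_rpow _ _ hr
      _ = _ := by
        rw [ENNReal.mul_rpow_of_nonneg (ENNReal.ofReal (2 * R)) _ hr0.le,
          ENNReal.mul_rpow_of_nonneg (ENNReal.ofReal (2 * R)) _ hr0.le, ← mul_add]
  have hm1 : Measurable fun y => (ENNReal.ofReal (‖y‖ ^ (-1 : ℝ)) * ‖f y‖ₑ) ^ r := by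
    have : Measurable fun y => ‖f y‖ₑ := Continuous.measurable (by fun_prop)
    fun_prop
  have hint : ‖f z‖ₑ ^ r * volume B ≤ 2 ^ (r - 1) * ((ENNReal.ofReal (2 * R)) ^ r * (I1 + A * I2)) := by
    calc ‖f z‖ₑ ^ r * volume B = ∫⁻ y in B, ‖f z‖ₑ ^ r := by simp
      _ ≤ _ := setLIntegral_mono' measurableSet_ball hpt
      _ = 2 ^ (r - 1) * ((ENNReal.ofReal (2 * R)) ^ r * (I1 +
            ∫⁻ x in B, (ENNReal.ofReal (‖x - z‖ ^ (-1 : ℝ)) * ‖f x - f z‖ₑ) ^ r)) := by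
          rw [lintegral_const_mul' _ _ (ENNReal.rpow_ne_top_of_nonneg (by linarith) (by simp)),
            lintegral_const_mul' _ _ (ENNReal.rpow_ne_top_of_nonneg hr0.le ENNReal.ofReal_ne_top),
            lintegral_add_left hm1]
      _ ≤ _ := by gcongr
  have hvol : volume B = ENNReal.ofReal ((R / 2) ^ N) * ω := by
    rw [hB, Measure.addHaar_ball_of_pos volume z (by positivity : 0 < R / 2)]; simp [hω]
  rw [hvol] at hint
  have hω0 : ω ≠ 0 := vol_ball_ne_zero
  have hωt : ω ≠ ⊤ := vol_ball_ne_top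
  have h2R : ENNReal.ofReal ((R / 2) ^ N) ≠ 0 := by simp; positivity
  have key : (ENNReal.ofReal (R ^ (-(1 - N / r))) * ‖f z‖ₑ) ^ r =
      (ENNReal.ofReal (R ^ (-r)) * (2 ^ N * ω⁻¹)) *
        (‖f z‖ₑ ^ r * (ENNReal.ofReal ((R / 2) ^ N) * ω)) := by
    rw [ENNReal.mul_rpow_of_nonneg _ _ hr0.le, ENNReal.ofReal_rpow_of_nonneg (by positivity) hr0.le,
      ← Real.rpow_mul hR.le]
    have e : R ^ (-(1 - N / r) * r) = R ^ (-r) * (2 ^ N * (R / 2) ^ N) := by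
      rw [← mul_pow, mul_div_cancel₀ _ two_ne_zero, ← Real.rpow_natCast, ← Real.rpow_add hR]
      congr 1; field_simp; ring
    rw [e, ENNReal.ofReal_mul (by positivity), ENNReal.ofReal_mul (by positivity),
      ENNReal.ofReal_pow zero_le_two, ENNReal.ofReal_ofNat]
    calc _ = ENNReal.ofReal (R ^ (-r)) * (2 ^ N * ENNReal.ofReal ((R / 2) ^ N)) * ‖f z‖ₑ ^ r * (ω⁻¹ * ω) := by
          rw [ENNReal.inv_mul_cancel hω0 hωt, mul_one]
      _ = _ := by ring
  rw [key]
  have e2 : ENNReal.ofReal (R ^ (-r)) * (ENNReal.ofReal (2 * R)) ^ r = 2 ^ r := by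
    rw [ENNReal.ofReal_rpow_of_nonneg (by positivity) hr0.le, ← ENNReal.ofReal_mul (by positivity),
      Real.mul_rpow zero_le_two hR.le, mul_left_comm, ← Real.rpow_add hR, neg_add_cancel, Real.rpow_zero,
      mul_one, ← ENNReal.ofReal_rpow_of_nonneg zero_le_two hr0.le, ENNReal.ofReal_ofNat]
  calc (ENNReal.ofReal (R ^ (-r)) * (2 ^ N * ω⁻¹)) * (‖f z‖ₑ ^ r * (ENNReal.ofReal ((R / 2) ^ N) * ω))
      ≤ (ENNReal.ofReal (R ^ (-r)) * (2 ^ N * ω⁻¹)) *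
        (2 ^ (r - 1) * ((ENNReal.ofReal (2 * R)) ^ r * (I1 + A * I2))) := by gcongr
    _ = (2 ^ N * ω⁻¹) * (2 ^ (r - 1) * ((ENNReal.ofReal (R ^ (-r)) * (ENNReal.ofReal (2 * R)) ^ r) *
          (I1 + A * I2))) := by ring
    _ ≤ (2 ^ N * ω⁻¹) * (2 ^ (r - 1) * (2 ^ r * ((1 + A) * (I1 + I2)))) := by
        rw [e2]
        gcongr
        calc I1 + A * I2 ≤ I1 + A * I2 + (I2 + A * I1) := le_self_add
          _ = _ := by ring
    _ = _ := by ring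

lemma morrey [CompleteSpace F] {r : ℝ} (hr : 1 ≤ r) (hNr : N < r) :
    ∃ K : ℝ≥0∞, K ≠ ⊤ ∧ ∀ f : Euc N → F, ContDiff ℝ 1 f → f 0 = 0 → ∀ z : Euc N, 
      (ENNReal.ofReal (‖z‖ ^ (-(1 - N / r))) * ‖f z‖ₑ) ^ r ≤ K * ∫⁻ x, ‖fderiv ℝ f x‖ₑ ^ r := by
  have hr0 : 0 < r := by linarith
  have hb : 0 < 1 - N / r := by rw [sub_pos, div_lt_one hr0]; exact hNr
  obtain ⟨K, hK, h⟩ := morrey_local (F := F) hr hNr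
  set A := hardyCA (1 - N / r) ^ r with hA
  have hAt : A ≠ ⊤ := ENNReal.rpow_ne_top_of_nonneg hr0.le (hardyCA_lt_top hb).ne
  refine ⟨K * (A + 1), ENNReal.mul_ne_top hK (by simp [hAt]), fun f hf hf0 z => ?_⟩
  by_cases hz : z = 0
  · simp [hz, hf0, hr0]
  refine (h f hf z hz).trans ?_
  rw [mul_assoc]
  gcongr
  rw [add_mul, one_mul]
  gcongr
  · refine (setLIntegral_le_lintegral _ _).trans ?_
    have := hardyA hf hf0 hr (a := 1) (S := Set.univ) MeasurableSet.univ (fun _ _ _ _ => trivial)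
    simpa using this
  · exact Measure.restrict_le_self

lemma tail_tendsto {G : Euc N → ℝ≥0∞} (hG : Measurable G) (hGi : ∫⁻ x, G x ≠ ⊤) :
    Tendsto (fun z : Euc N => ∫⁻ x in ball z (‖z‖ / 2), G x) (cocompact (Euc N)) (𝓝 0) := by
  rw [← Metric.cobounded_eq_cocompact, ← comap_norm_atTop]
  simp only [← lintegral_indicator (measurableSet_ball)]
  have h := tendsto_lintegral_filter_of_dominated_convergence (l := comap norm (atTop : Filter ℝ))
    (F := fun z : Euc N => (ball z (‖z‖ / 2)).indicator G) (f := fun _ => 0) (μ := volume) G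
    (Eventually.of_forall fun z => hG.indicator measurableSet_ball)
    (Eventually.of_forall fun z => ae_of_all _ fun x => Set.indicator_le_self _ _ _) hGi
    (ae_of_all _ fun x => ?_)
  · simpa using h
  · refine tendsto_const_nhds.congr' ?_
    have : ∀ᶠ z : Euc N in comap norm (atTop : Filter ℝ), 2 * ‖x‖ < ‖z‖ :=
      tendsto_comap.eventually (eventually_gt_atTop (2 * ‖x‖))
    filter_upwards [this] with z hz
    rw [Set.indicator_of_notMem]
    intro hx
    rw [mem_ball, dist_eq_norm] at hx
    have := norm_sub_le x (x - z)
    rw [_root_.sub_sub_cancel] at this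
    linarith

lemma morrey_tendsto [CompleteSpace F] {r : ℝ} (hr : 1 ≤ r) (hNr : N < r)
    {f : Euc N → F} (hf : ContDiff ℝ 1 f) (hf0 : f 0 = 0) (hfd : ∫⁻ x, ‖fderiv ℝ f x‖ₑ ^ r ≠ ⊤) :
    Tendsto (fun z => ‖z‖ ^ (-(1 - N / r)) * ‖f z‖) (cocompact (Euc N)) (𝓝 0) := by
  have hr0 : 0 < r := by linarith
  have hb : 0 < 1 - N / r := by rw [sub_pos, div_lt_one hr0]; exact hNr
  obtain ⟨K, hK, h⟩ := morrey_local (F := F) hr hNr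
  have hfc := hf.continuous
  have hfdc := hf.continuous_fderiv one_ne_zero
  have hm1 : Measurable fun y => (ENNReal.ofReal (‖y‖ ^ (-1 : ℝ)) * ‖f y‖ₑ) ^ r := by
    have : Measurable fun y => ‖f y‖ₑ := Continuous.measurable (by fun_prop)
    fun_prop
  have hm2 : Measurable fun y => ‖fderiv ℝ f y‖ₑ ^ r := by
    have : Measurable fun y => ‖fderiv ℝ f y‖ₑ := Continuous.measurable (by fun_prop)
    fun_prop
  have hi1 : ∫⁻ x, (ENNReal.ofReal (‖x‖ ^ (-1 : ℝ)) * ‖f x‖ₑ) ^ r ≠ ⊤ := by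
    have := hardyA hf hf0 hr (a := 1) (S := Set.univ) MeasurableSet.univ (fun _ _ _ _ => trivial)
    simp only [Measure.restrict_univ, sub_self, Real.rpow_zero, ENNReal.ofReal_one, one_mul] at this
    exact ne_top_of_le_ne_top (ENNReal.mul_ne_top
      (ENNReal.rpow_ne_top_of_nonneg hr0.le (hardyCA_lt_top hb).ne) hfd) this
  have ht := ENNReal.Tendsto.const_mul (a := K) ((tail_tendsto hm1 hi1).add (tail_tendsto hm2 hfd))
    (Or.inr hK)
  simp only [add_zero, mul_zero] at ht
  have h0 : Tendsto (fun z => (ENNReal.ofReal (‖z‖ ^ (-(1 - N / r))) * ‖f z‖ₑ) ^ r) (cocompact (Euc N)) (𝓝 0) := by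
    refine tendsto_of_tendsto_of_tendsto_of_le_of_le tendsto_const_nhds ht (fun n => zero_le) fun z => ?_
    by_cases hz : z = 0
    · simp [hz, hf0, hr0]
    · exact h f hf z hz
  have h1 := (ENNReal.continuous_rpow_const (y := 1 / r)).tendsto 0 |>.comp h0
  simp only [Function.comp_def, ← ENNReal.rpow_mul, mul_one_div_cancel hr0.ne', ENNReal.rpow_one] at h1
  rw [ENNReal.zero_rpow_of_pos (by positivity)] at h1
  have h2 := (ENNReal.tendsto_toReal ENNReal.zero_ne_top).comp h1
  refine h2.congr fun z => ?_
  simp [ENNReal.toReal_mul, ENNReal.toReal_ofReal (Real.rpow_nonneg (norm_nonneg z) _)]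
end

section
instance finDimCMM (N l : ℕ) : FiniteDimensional ℝ (ContinuousMultilinearMap ℝ (fun _ : Fin l => Euc N) ℝ) :=
  FiniteDimensional.of_injective
    (ContinuousMultilinearMap.toMultilinearMapLinear (R' := ℝ) (A := ℝ) (M₁ := fun _ : Fin l => Euc N) (M₂ := ℝ))
    ContinuousMultilinearMap.toMultilinearMap_injective

lemma contDiff_iter {E : Type*} [NormedAddCommGroup E] [NormedSpace ℝ E] {G : Type*} [NormedAddCommGroup G] [NormedSpace ℝ G] {f : E → G}
    (hf : ContDiff ℝ (⊤ : ℕ∞) f) (n : ℕ) : ContDiff ℝ (⊤ : ℕ∞) (iteratedFDeriv ℝ n f) :=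
  hf.iteratedFDeriv_right (by exact_mod_cast le_top)

lemma one_le_cinf : (1 : WithTop ℕ∞) ≤ ((⊤ : ℕ∞) : WithTop ℕ∞) := by exact_mod_cast le_top
lemma two_le_cinf : (2 : WithTop ℕ∞) ≤ ((⊤ : ℕ∞) : WithTop ℕ∞) :=
  WithTop.coe_le_coe.2 (le_top : (2 : ℕ∞) ≤ ⊤)

lemma iter_succ_tail {E : Type*} [NormedAddCommGroup E] [NormedSpace ℝ E] {f : E → ℝ}
    (hf : ContDiff ℝ (⊤ : ℕ∞) f) (n : ℕ) (v : Fin (n + 1) → E) (x : E) :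
    iteratedFDeriv ℝ (n + 1) f x v =
      fderiv ℝ (fun y => iteratedFDeriv ℝ n f y (Fin.tail v)) x (v 0) := by
  have hd : DifferentiableAt ℝ (iteratedFDeriv ℝ n f) x :=
    ((contDiff_iter hf n).differentiable (by simp)) x
  rw [iteratedFDeriv_succ_apply_left, fderiv_continuousMultilinear_apply_const_apply hd]

lemma contDiff_iter_apply {E : Type*} [NormedAddCommGroup E] [NormedSpace ℝ E] {f : E → ℝ}
    (hf : ContDiff ℝ (⊤ : ℕ∞) f) (n : ℕ) (v : Fin n → E) :
    ContDiff ℝ (⊤ : ℕ∞) (fun y => iteratedFDeriv ℝ n f y v) :=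
  (ContinuousMultilinearMap.apply ℝ (fun _ : Fin n => E) ℝ v).contDiff.comp (contDiff_iter hf n)

lemma iter_symm {E : Type*} [NormedAddCommGroup E] [NormedSpace ℝ E] {f : E → ℝ}
    (hf : ContDiff ℝ (⊤ : ℕ∞) f) : ∀ (n : ℕ) (σ : Equiv.Perm (Fin n)) (v : Fin n → E) (x : E),
    iteratedFDeriv ℝ n f x (v ∘ σ) = iteratedFDeriv ℝ n f x v := by
  intro n
  induction n with
  | zero => intro σ v x; congr 1; ext i; exact i.elim0
  | succ n ih =>
    intro σ
    have hσ : σ ∈ (⊤ : Submonoid (Equiv.Perm (Fin (n + 1)))) := trivial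
    rw [← Equiv.Perm.mclosure_swap_castSucc_succ n] at hσ
    induction hσ using Submonoid.closure_induction with
    | one => intro v x; rfl
    | mul a b _ _ ha hb =>
      intro v x
      rw [Equiv.Perm.coe_mul, ← Function.comp_assoc, hb, ha]
    | mem a ha =>
      obtain ⟨i, rfl⟩ := ha
      intro v x
      cases n with
      | zero => exact i.elim0
      | succ n =>
        refine Fin.cases ?_ (fun i' => ?_) i
        · rw [iter_succ_tail hf, iter_succ_tail hf]
          have key : ∀ w : Fin (n + 2) → E, fderiv ℝ (fun y => iteratedFDeriv ℝ (n+1) f y (Fin.tail w)) x (w 0)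
              = fderiv ℝ (fderiv ℝ (fun y => iteratedFDeriv ℝ n f y (Fin.tail (Fin.tail w)))) x (w 0) (w 1) := by
            intro w
            simp_rw [iter_succ_tail hf n]
            have h1 : ContDiff ℝ (⊤ : ℕ∞) (fderiv ℝ (fun y => iteratedFDeriv ℝ n f y (Fin.tail (Fin.tail w)))) :=
              (contDiff_iter_apply hf n _).fderiv_right (by simp)
            rw [fderiv_clm_apply ((h1.differentiable (by simp)) x) (differentiableAt_const _)]
            simp [Fin.tail]
          rw [key, key]
          have hs := ((contDiff_iter_apply hf n (Fin.tail (Fin.tail v))).contDiffAt (x := x)).isSymmSndFDerivAt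
            (by simpa using two_le_cinf)
          have e1 : Fin.tail (Fin.tail (v ∘ Equiv.swap (Fin.castSucc (0 : Fin (n+1))) (Fin.succ 0))) = Fin.tail (Fin.tail v) := by
            ext j
            simp only [Fin.tail, Function.comp]
            rw [Equiv.swap_apply_of_ne_of_ne] <;> simp [Fin.ext_iff]
          rw [e1]
          simp only [Function.comp]
          have e2 : (Equiv.swap (Fin.castSucc (0 : Fin (n+1))) (Fin.succ 0)) 0 = 1 := by
            exact Equiv.swap_apply_left _ _
          have e3 : (Equiv.swap (Fin.castSucc (0 : Fin (n+1))) (Fin.succ 0)) 1 = 0 := by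
            exact Equiv.swap_apply_right _ _
          rw [e2, e3]
          exact hs _ _
        · rw [iter_succ_tail hf, iter_succ_tail hf]
          have e0 : (v ∘ Equiv.swap (Fin.castSucc (Fin.succ i')) (Fin.succ (Fin.succ i'))) 0 = v 0 := by
            simp only [Function.comp]
            rw [Equiv.swap_apply_of_ne_of_ne] <;> simp [Fin.ext_iff]
          have e1 : Fin.tail (v ∘ Equiv.swap (Fin.castSucc (Fin.succ i')) (Fin.succ (Fin.succ i'))) =
              Fin.tail v ∘ Equiv.swap (Fin.castSucc i') (Fin.succ i') := by
            ext j
            simp only [Fin.tail, Function.comp]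
            rw [← Fin.succ_castSucc, ← (Fin.succ_injective _).map_swap]
          rw [e0, e1]
          simp_rw [ih]

lemma ind_norm {E : Type*} [NormedAddCommGroup E] [NormedSpace ℝ E] {f : E → ℝ} {n : ℕ} {x : E} : ‖fderiv ℝ (iteratedFDeriv ℝ n f) x‖ₑ = ‖iteratedFDeriv ℝ (n + 1) f x‖ₑ := by
  rw [← ofReal_norm, ← ofReal_norm, norm_fderiv_iteratedFDeriv]

/-- basis vectors -/
def ev {N k : ℕ} (m : Fin k → Fin N) : Fin k → Euc N := fun i => EuclideanSpace.single (m i) 1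

lemma pderivList_eq {N : ℕ} : ∀ (k : ℕ) (m : Fin k → Fin N) (φ : Euc N → ℝ), ContDiff ℝ (⊤ : ℕ∞) φ →
    ∀ x, pderivList (List.ofFn m) φ x = iteratedFDeriv ℝ k φ x (ev m) := by
  intro k
  induction k with
  | zero => intro m φ _ x; simp [pderivList]
  | succ k ih =>
    intro m φ hφ x
    rw [List.ofFn_succ, pderivList, ih (fun i => m i.succ) _ ((hφ.fderiv_right (by simp)).clm_apply contDiff_const)]
    have hr : iteratedFDeriv ℝ (k+1) φ x (ev m) = iteratedFDeriv ℝ (k+1) φ x (ev m ∘ finRotate (k+1)) :=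
      (iter_symm hφ _ _ _ _).symm
    rw [hr, iteratedFDeriv_succ_apply_right]
    have e1 : (ev m ∘ finRotate (k+1)) (Fin.last k) = EuclideanSpace.single (m 0) 1 := by
      simp [ev]
    have e2 : Fin.init (ev m ∘ finRotate (k+1)) = ev (fun i => m i.succ) := by
      ext1 i
      simp only [Fin.init, Function.comp, ev]
      rw [finRotate_apply, Fin.coeSucc_eq_succ]
    have hd : ContDiff ℝ (⊤ : ℕ∞) (fderiv ℝ φ) := hφ.fderiv_right (by simp)
    rw [e1, e2]
    have := (ContinuousLinearMap.apply ℝ ℝ (EuclideanSpace.single (m 0) (1:ℝ) : Euc N)).iteratedFDeriv_comp_left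
      (f := fderiv ℝ φ) (x := x) (hd.contDiffAt) (i := k) (by exact_mod_cast le_top)
    have h2 := congrArg (fun T => T (ev (fun i => m i.succ))) this
    simpa [Function.comp_def] using h2
end

section
def ps (N : ℕ) (p : ℝ) (j : ℕ) : ℝ := (p⁻¹ - j / N)⁻¹

lemma ps_zero {N : ℕ} {p : ℝ} : ps N p 0 = p := by simp [ps]

lemma ps_inv {N : ℕ} {p : ℝ} {j : ℕ} : (ps N p j)⁻¹ = p⁻¹ - j / N := by simp [ps]

lemma ps_inv_pos {N : ℕ} {p : ℝ} {j : ℕ} (hN : 1 ≤ N) (hp : 1 ≤ p) (hj : (j : ℝ) < N / p) :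
    0 < p⁻¹ - (j : ℝ) / N := by
  have hN' : (0 : ℝ) < N := by exact_mod_cast hN
  have hp0 : 0 < p := by linarith
  rw [sub_pos, div_lt_iff₀ hN', inv_mul_eq_div]
  exact hj

lemma ps_pos {N : ℕ} {p : ℝ} {j : ℕ} (hN : 1 ≤ N) (hp : 1 ≤ p) (hj : (j : ℝ) < N / p) :
    0 < ps N p j := inv_pos.2 (ps_inv_pos hN hp hj)

lemma one_le_ps {N : ℕ} {p : ℝ} {j : ℕ} (hN : 1 ≤ N) (hp : 1 ≤ p) (hj : (j : ℝ) < N / p) :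
    1 ≤ ps N p j := by
  have hp0 : 0 < p := by linarith
  refine (one_le_inv₀ (ps_inv_pos hN hp hj)).2 ?_
  have : p⁻¹ ≤ 1 := inv_le_one_of_one_le₀ hp
  have : (0 : ℝ) ≤ j / N := by positivity
  linarith

lemma ps_succ {N : ℕ} {p : ℝ} {j : ℕ} : (ps N p (j + 1))⁻¹ = (ps N p j)⁻¹ - (N : ℝ)⁻¹ := by
  rw [ps_inv, ps_inv]; push_cast; ring

lemma N_div_ps {N : ℕ} {p : ℝ} {j : ℕ} (hN : 1 ≤ N) : N / ps N p j = N / p - j := by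
  have hN' : (0 : ℝ) < N := by exact_mod_cast hN
  rw [div_eq_mul_inv, ps_inv]; field_simp

/-- nondegenerate exponents -/
structure Adm (N k : ℕ) (p : ℝ) : Prop where
  hN : 1 ≤ N
  hp : 1 ≤ p
  ne : ∀ j : ℕ, 1 ≤ j → j ≤ k → (j : ℝ) ≠ N / p

lemma Adm.lt_or {N k : ℕ} {p : ℝ} (h : Adm N k p) {j : ℕ} (hj : j ≤ k) :
    (j : ℝ) < N / p ∨ ((N / p < (j : ℝ)) ∧ 1 ≤ j) := by
  have h1 := h.hN
  have h2 := h.hp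
  rcases Nat.eq_zero_or_pos j with h0 | h0
  · left; subst h0; simp; positivity
  · rcases lt_or_gt_of_ne (h.ne j h0 hj) with h | h
    · exact Or.inl h
    · exact Or.inr ⟨h, h0⟩

structure Good (N k : ℕ) (p : ℝ) (w : Euc N → ℝ) : Prop where
  smooth : ContDiff ℝ (⊤ : ℕ∞) w
  lp : ∀ j : ℕ, j ≤ k → (j : ℝ) < N / p →
    eLpNorm (iteratedFDeriv ℝ (k - j) w) (ENNReal.ofReal (ps N p j)) volume ≠ ⊤
  van : ∀ j : ℕ, j ≤ k → N / p < (j : ℝ) → iteratedFDeriv ℝ (k - j) w 0 = 0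

lemma Good.sub {N k : ℕ} {p : ℝ} (ha : Adm N k p) {w w' : Euc N → ℝ} (h : Good N k p w) (h' : Good N k p w') :
    Good N k p (w - w') := by
  have e : ∀ n, iteratedFDeriv ℝ n (w - w') = iteratedFDeriv ℝ n w - iteratedFDeriv ℝ n w' := by
    intro n
    ext1 x
    have h1 : ContDiffAt ℝ n w x := h.smooth.contDiffAt.of_le (by exact_mod_cast le_top)
    have h2 : ContDiffAt ℝ n w' x := h'.smooth.contDiffAt.of_le (by exact_mod_cast le_top)
    rw [iteratedFDeriv_sub_apply h1 h2]; rfl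
  refine ⟨h.smooth.sub h'.smooth, fun j hj hj' => ?_, fun j hj hj' => ?_⟩
  · rw [e]
    have := eLpNorm_sub_le (μ := volume) (f := iteratedFDeriv ℝ (k - j) w) (g := iteratedFDeriv ℝ (k - j) w')
      (p := ENNReal.ofReal (ps N p j)) (contDiff_iter h.smooth _).continuous.aestronglyMeasurable
      (contDiff_iter h'.smooth _).continuous.aestronglyMeasurable
      (by simpa using one_le_ps ha.hN ha.hp hj')
    exact ne_top_of_le_ne_top (ENNReal.add_ne_top.2 ⟨h.lp j hj hj', h'.lp j hj hj'⟩) this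
  · rw [e, Pi.sub_apply, h.van j hj hj', h'.van j hj hj', sub_zero]

section
variable {N k : ℕ} {p : ℝ}

lemma Good.int_ne_top (ha : Adm N k p) {w : Euc N → ℝ} (h : Good N k p w) {j : ℕ} (hj : j ≤ k) (hj' : (j : ℝ) < N / p) :
    ∫⁻ x, ‖iteratedFDeriv ℝ (k - j) w x‖ₑ ^ ps N p j ≠ ⊤ := by
  have := ps_pos ha.hN ha.hp hj'
  rw [← eLpNorm_ofReal_rpow _ this]
  exact ENNReal.rpow_ne_top_of_nonneg this.le (h.lp j hj hj')

lemma est1 (ha : Adm N k p) : ∀ j : ℕ, j ≤ k → ∃ C : ℝ≥0∞, C ≠ ⊤ ∧ ∀ w, Good N k p w →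
    ∫⁻ x, (ENNReal.ofReal (‖x‖ ^ (-(j : ℝ))) * ‖iteratedFDeriv ℝ (k - j) w x‖ₑ) ^ p ≤
      C * ∫⁻ x, ‖iteratedFDeriv ℝ k w x‖ₑ ^ p := by
  have hp0 : 0 < p := by linarith [ha.hp]
  intro j
  induction j with
  | zero => intro _; exact ⟨1, by simp, fun w hw => by simp⟩
  | succ j ih =>
    intro hj
    obtain ⟨C, hC, h⟩ := ih (by omega)
    have ek : k - j = (k - (j + 1)) + 1 := by omega
    have e : ∀ (w : Euc N → ℝ) (x : Euc N), ENNReal.ofReal (‖x‖ ^ (1 - ((j + 1 : ℕ) : ℝ))) *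
        ‖fderiv ℝ (iteratedFDeriv ℝ (k - (j + 1)) w) x‖ₑ =
        ENNReal.ofReal (‖x‖ ^ (-(j : ℝ))) * ‖iteratedFDeriv ℝ (k - j) w x‖ₑ := by
      intro w x
      rw [ind_norm, ek]; congr 3; push_cast; ring
    rcases ha.lt_or hj with h1 | ⟨h1, -⟩
    · refine ⟨hardyCB (((j + 1 : ℕ) : ℝ) - N / p) ^ p * C, ENNReal.mul_ne_top
        (ENNReal.rpow_ne_top_of_nonneg hp0.le (hardyCB_lt_top (by linarith)).ne) hC, fun w hw => ?_⟩
      have := hardyB ((contDiff_iter hw.smooth (k - (j + 1))).of_le one_le_cinf) ha.hp (a := ((j + 1 : ℕ) : ℝ)) ha.hN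
        (one_le_ps ha.hN ha.hp h1) (hw.int_ne_top ha hj h1)
      simp_rw [e] at this
      refine this.trans ?_
      rw [mul_assoc]
      gcongr
      exact h w hw
    · refine ⟨hardyCA (((j + 1 : ℕ) : ℝ) - N / p) ^ p * C, ENNReal.mul_ne_top
        (ENNReal.rpow_ne_top_of_nonneg hp0.le (hardyCA_lt_top (by linarith)).ne) hC, fun w hw => ?_⟩
      have := hardyA ((contDiff_iter hw.smooth (k - (j + 1))).of_le one_le_cinf) (hw.van _ hj h1) ha.hp
        (a := ((j + 1 : ℕ) : ℝ)) (S := Set.univ) MeasurableSet.univ (fun _ _ _ _ => trivial)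
      simp_rw [e, Measure.restrict_univ] at this
      refine this.trans ?_
      rw [mul_assoc]
      gcongr
      exact h w hw

lemma eLpNorm_fderiv_iter {r : ℝ≥0∞} {n : ℕ} {w : Euc N → ℝ} : eLpNorm (fderiv ℝ (iteratedFDeriv ℝ n w)) r volume =
    eLpNorm (iteratedFDeriv ℝ (n + 1) w) r volume := by
  simp only [eLpNorm, eLpNorm', eLpNormEssSup, ind_norm]

lemma est2 (ha : Adm N k p) : ∀ j : ℕ, j ≤ k → (j : ℝ) < N / p → ∃ C : NNReal, ∀ w, Good N k p w →
    eLpNorm (iteratedFDeriv ℝ (k - j) w) (ENNReal.ofReal (ps N p j)) volume ≤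
      C * eLpNorm (iteratedFDeriv ℝ k w) (ENNReal.ofReal p) volume := by
  intro j
  induction j with
  | zero => intro _ _; exact ⟨1, fun w hw => by simp [ps_zero]⟩
  | succ j ih =>
    intro hj hj'
    have hj2 : (j : ℝ) < N / p := by push_cast at hj'; linarith
    obtain ⟨C, h⟩ := ih (by omega) hj2
    obtain ⟨C', h'⟩ := sobolev (F := ContinuousMultilinearMap ℝ (fun _ : Fin (k - (j + 1)) => Euc N) ℝ) ha.hN
      (one_le_ps ha.hN ha.hp hj2) (one_le_ps ha.hN ha.hp hj') ps_succ
    have ek : k - j = (k - (j + 1)) + 1 := by omega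
    refine ⟨C' * C, fun w hw => ?_⟩
    have hg := hw.lp j (by omega) hj2
    have h2 := h w hw
    rw [ek] at hg h2
    refine (h' _ ((contDiff_iter hw.smooth (k - (j + 1))).of_le one_le_cinf) ?_ (hw.lp _ hj hj')).trans ?_
    · rwa [eLpNorm_fderiv_iter]
    · rw [eLpNorm_fderiv_iter, ENNReal.coe_mul, mul_assoc]
      gcongr

lemma est3 (ha : Adm N k p) : ∀ j : ℕ, j ≤ k → N / p < (j : ℝ) → ∃ C : NNReal, ∀ w, Good N k p w →
    ∀ z, ENNReal.ofReal (‖z‖ ^ (-((j : ℝ) - N / p))) * ‖iteratedFDeriv ℝ (k - j) w z‖ₑ ≤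
      C * eLpNorm (iteratedFDeriv ℝ k w) (ENNReal.ofReal p) volume := by
  have hp0 : 0 < p := by linarith [ha.hp]
  intro j
  induction j with
  | zero => intro _ h; have : 0 ≤ N / p := by positivity
            simp at h; linarith
  | succ j ih =>
    intro hj hj'
    have ek : k - j = (k - (j + 1)) + 1 := by omega
    rcases ha.lt_or (show j ≤ k by omega) with h1 | ⟨h1, -⟩
    · have hps := ps_pos ha.hN ha.hp h1
      have hd := N_div_ps (p := p) (j := j) ha.hN
      obtain ⟨C, h⟩ := est2 ha j (by omega) h1
      obtain ⟨K, hK, h'⟩ := morrey (N := N) (F := ContinuousMultilinearMap ℝ (fun _ : Fin (k - (j + 1)) => Euc N) ℝ)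
        (one_le_ps ha.hN ha.hp h1) (by
          rw [← div_lt_one hps, hd]; push_cast at hj'; linarith)
      refine ⟨(K ^ (1 / ps N p j)).toNNReal * C, fun w hw z => ?_⟩
      have h3 := h' _ ((contDiff_iter hw.smooth (k - (j + 1))).of_le one_le_cinf) (hw.van _ hj hj') z
      have h4 := h w hw
      rw [ek] at h4
      rw [ENNReal.coe_mul, ENNReal.coe_toNNReal (ENNReal.rpow_ne_top_of_nonneg (by positivity) hK), mul_assoc]
      refine le_trans ?_ (mul_le_mul_right h4 _)
      rw [eLpNorm_ofReal _ hps, ← ENNReal.mul_rpow_of_nonneg _ _ (by positivity)]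
      have h5 := ENNReal.rpow_le_rpow h3 (z := 1 / ps N p j) (by positivity)
      rw [← ENNReal.rpow_mul, mul_one_div_cancel hps.ne', ENNReal.rpow_one, hd] at h5
      simp_rw [ind_norm] at h5
      have e : -(((j + 1 : ℕ) : ℝ) - N / p) = -(1 - (N / p - j)) := by push_cast; ring
      rw [e]
      exact h5
    · obtain ⟨C, h⟩ := ih (by omega) h1
      refine ⟨C, fun w hw z => ?_⟩
      set M := C * eLpNorm (iteratedFDeriv ℝ k w) (ENNReal.ofReal p) volume with hM
      have hMt : M ≠ ⊤ := by
        refine ENNReal.mul_ne_top (by simp) ?_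
        have := hw.lp 0 (by omega) (by simpa using by have := ha.hN; positivity)
        simpa [ps_zero] using this
      have hv := hw.van _ hj hj'
      by_cases hz : z = 0
      · simp [hz, hv]
      have hz0 : 0 < ‖z‖ := norm_pos_iff.2 hz
      have hs := (contDiff_iter hw.smooth (k - (j + 1)))
      have hb : ∀ x ∈ closedBall (0 : Euc N) ‖z‖, ‖fderiv ℝ (iteratedFDeriv ℝ (k - (j + 1)) w) x‖ ≤
          M.toReal * ‖z‖ ^ ((j : ℝ) - N / p) := by
        intro x hx
        rw [norm_fderiv_iteratedFDeriv, ← ek]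
        by_cases hx0 : x = 0
        · rw [hx0, hw.van j (by omega) h1, norm_zero]; positivity
        have hx0' : 0 < ‖x‖ := norm_pos_iff.2 hx0
        have h2 := ENNReal.toReal_mono hMt (h w hw x)
        rw [ENNReal.toReal_mul, ENNReal.toReal_ofReal (by positivity), toReal_enorm, Real.rpow_neg hx0'.le,
          inv_mul_le_iff₀ (by positivity)] at h2
        rw [mem_closedBall_zero_iff] at hx
        refine h2.trans ?_
        rw [mul_comm]
        gcongr
      have h3 := (convex_closedBall (0 : Euc N) ‖z‖).norm_image_sub_le_of_norm_fderiv_le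
        (fun x _ => (hs.differentiable (by simp)) x) hb (x := 0) (by simp) (show z ∈ closedBall (0 : Euc N) ‖z‖ by simp)
      rw [hv, sub_zero, sub_zero] at h3
      rw [← ENNReal.ofReal_toReal hMt, ← ofReal_norm, ← ENNReal.ofReal_mul (by positivity)]
      refine ENNReal.ofReal_le_ofReal ?_
      rw [Real.rpow_neg hz0.le, inv_mul_le_iff₀ (by positivity), mul_comm _ M.toReal]
      refine h3.trans (le_of_eq ?_)
      rw [mul_assoc, ← Real.rpow_add_one hz0.ne']
      congr 2; push_cast; ring

lemma est4 (ha : Adm N k p) {w : Euc N → ℝ} (hw : Good N k p w) : ∀ j : ℕ, j ≤ k → N / p < (j : ℝ) →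
    Tendsto (fun z => ‖z‖ ^ (-((j : ℝ) - N / p)) * ‖iteratedFDeriv ℝ (k - j) w z‖) (cocompact (Euc N)) (𝓝 0) := by
  have hp0 : 0 < p := by linarith [ha.hp]
  intro j
  induction j with
  | zero => intro _ h; have : 0 ≤ N / p := by positivity
            simp at h; linarith
  | succ j ih =>
    intro hj hj'
    have ek : k - j = (k - (j + 1)) + 1 := by omega
    rcases ha.lt_or (show j ≤ k by omega) with h1 | ⟨h1, -⟩
    · have hps := ps_pos ha.hN ha.hp h1
      have hd := N_div_ps (p := p) (j := j) ha.hN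
      have := morrey_tendsto (N := N) (F := ContinuousMultilinearMap ℝ (fun _ : Fin (k - (j + 1)) => Euc N) ℝ)
        (one_le_ps ha.hN ha.hp h1) (by
          rw [← div_lt_one hps, hd]; push_cast at hj'; linarith)
          ((contDiff_iter hw.smooth (k - (j + 1))).of_le one_le_cinf) (hw.van _ hj hj')
          (by have h3 := hw.int_ne_top ha (by omega) h1; rw [ek] at h3; simpa only [ind_norm] using h3)
      refine this.congr fun z => ?_
      rw [hd]; congr 2; push_cast; ring
    · have ih' := ih (by omega) h1
      have hs := (contDiff_iter hw.smooth (k - (j + 1)))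
      have hv := hw.van _ hj hj'
      set α := (j : ℝ) - N / p with hα
      have hα0 : 0 < α := by linarith
      rw [← Metric.cobounded_eq_cocompact, ← comap_norm_atTop] at ih' ⊢
      rw [Metric.tendsto_nhds] at ih' ⊢
      intro ε hε
      have h2 := ih' (ε / 2) (by positivity)
      rw [eventually_comap] at h2
      obtain ⟨R, hR⟩ := (h2.and (eventually_gt_atTop 0)).exists_forall_of_atTop
      have hR0 : 0 < R := (hR R le_rfl).2
      obtain ⟨K, hK⟩ := (isCompact_closedBall (0 : Euc N) R).exists_bound_of_continuousOn
        (contDiff_iter hw.smooth (k - j)).continuous.continuousOn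
      have hev : ∀ᶠ z : Euc N in comap norm (atTop : Filter ℝ), 0 < ‖z‖ ∧ max K 0 < ε / 2 * ‖z‖ ^ α := by
        refine (tendsto_comap (f := fun z : Euc N => ‖z‖)).eventually
          (p := fun t : ℝ => 0 < t ∧ max K 0 < ε / 2 * t ^ α) ((eventually_gt_atTop (0:ℝ)).and ?_)
        exact ((tendsto_rpow_atTop hα0).const_mul_atTop (by positivity : 0 < ε / 2)).eventually_gt_atTop _
      filter_upwards [hev] with z hz
      obtain ⟨hz0, hz⟩ := hz
      have hb : ∀ x ∈ closedBall (0 : Euc N) ‖z‖, ‖fderiv ℝ (iteratedFDeriv ℝ (k - (j + 1)) w) x‖ ≤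
          ε / 2 * ‖z‖ ^ α := by
        intro x hx
        rw [mem_closedBall_zero_iff] at hx
        rw [norm_fderiv_iteratedFDeriv, ← ek]
        by_cases hxR : ‖x‖ ≤ R
        · exact (hK x (by simpa using hxR)).trans ((le_max_left _ _).trans hz.le)
        · push Not at hxR
          have hx0 : 0 < ‖x‖ := hR0.trans hxR
          have h3 := (hR ‖x‖ hxR.le).1 x rfl
          rw [Real.dist_eq, sub_zero, abs_of_nonneg (by positivity), Real.rpow_neg hx0.le,
            inv_mul_lt_iff₀ (by positivity)] at h3
          refine h3.le.trans ?_
          rw [mul_comm]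
          gcongr
      have h3 := (convex_closedBall (0 : Euc N) ‖z‖).norm_image_sub_le_of_norm_fderiv_le
        (fun x _ => (hs.differentiable (by simp)) x) hb (x := 0) (by simp) (show z ∈ closedBall (0 : Euc N) ‖z‖ by simp)
      rw [hv, sub_zero, sub_zero] at h3
      rw [Real.dist_eq, sub_zero, abs_of_nonneg (by positivity), Real.rpow_neg hz0.le,
            inv_mul_lt_iff₀ (by positivity)]
      have e : ((j + 1 : ℕ) : ℝ) - N / p = α + 1 := by rw [hα]; push_cast; ring
      rw [e, Real.rpow_add_one hz0.ne']
      refine h3.trans_lt ?_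
      have : 0 < ‖z‖ ^ α * ‖z‖ := by positivity
      nlinarith
end
end

section
lemma contDiff_polyEval {N : ℕ} (Q : MvPolynomial (Fin N) ℝ) {n : WithTop ℕ∞} : ContDiff ℝ n (fun x : Euc N => polyEval Q x) := by
  unfold polyEval
  induction Q using MvPolynomial.induction_on with
  | C a => simp [contDiff_const]
  | add p q hp hq => simp only [map_add]; exact hp.add hq
  | mul_X p i hp =>
    simp only [map_mul, MvPolynomial.eval_X]
    refine hp.mul ?_
    exact (EuclideanSpace.proj i : Euc N →L[ℝ] ℝ).contDiff

section
variable {N : ℕ}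

def diagPoly {l : ℕ} (c : ContinuousMultilinearMap ℝ (fun _ : Fin l => Euc N) ℝ) : MvPolynomial (Fin N) ℝ :=
  ∑ m : Fin l → Fin N, MvPolynomial.C (c (ev m) / l.factorial) * ∏ i, MvPolynomial.X (m i)

lemma diagPoly_deg {l : ℕ} (c : ContinuousMultilinearMap ℝ (fun _ : Fin l => Euc N) ℝ) :
    (diagPoly c).totalDegree ≤ l := by
  refine MvPolynomial.totalDegree_finsetSum_le fun m _ => ?_
  refine (MvPolynomial.totalDegree_mul _ _).trans ?_
  rw [MvPolynomial.totalDegree_C, zero_add]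
  refine (MvPolynomial.totalDegree_finsetProd _ _).trans ?_
  simp

lemma cmm_expand {l : ℕ} (c : ContinuousMultilinearMap ℝ (fun _ : Fin l => Euc N) ℝ) (v : Fin l → Euc N) :
    c v = ∑ m : Fin l → Fin N, (∏ i, v i (m i)) * c (ev m) := by
  have e : v = fun i => ∑ j : Fin N, v i j • (EuclideanSpace.single j 1 : Euc N) := by
    ext i j
    simp [Finset.sum_apply, Pi.single_apply]
  conv_lhs => rw [e]
  rw [ContinuousMultilinearMap.map_sum]
  refine Finset.sum_congr rfl fun m _ => ?_
  rw [ContinuousMultilinearMap.map_smul_univ]; rfl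

lemma diagPoly_eval {l : ℕ} (c : ContinuousMultilinearMap ℝ (fun _ : Fin l => Euc N) ℝ) (x : Euc N) :
    polyEval (diagPoly c) x = (l.factorial : ℝ)⁻¹ • c (fun _ => x) := by
  rw [cmm_expand c]
  simp only [polyEval, diagPoly, map_sum, map_mul, MvPolynomial.eval_C, map_prod, MvPolynomial.eval_X, smul_eq_mul,
    Finset.mul_sum]
  refine Finset.sum_congr rfl fun m _ => ?_
  ring

lemma diagPoly_iter {l : ℕ} (c : ContinuousMultilinearMap ℝ (fun _ : Fin l => Euc N) ℝ)
    (hc : ∀ (σ : Equiv.Perm (Fin l)) v, c (v ∘ σ) = c v) (x : Euc N) :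
    iteratedFDeriv ℝ l (fun x => polyEval (diagPoly c) x) x = c := by
  have e : (fun x => polyEval (diagPoly c) x) = (l.factorial : ℝ)⁻¹ • (fun x => c (fun _ => x)) := by
    ext x; rw [diagPoly_eval]; rfl
  have hs : ContDiff ℝ l (fun x : Euc N => c (fun _ => x)) :=
    (ContinuousMultilinearMap.contDiff c).comp (by fun_prop)
  rw [e, iteratedFDeriv_const_smul_apply hs.contDiffAt]
  ext v
  rw [_root_.smul_apply, ContinuousMultilinearMap.iteratedFDeriv_comp_diagonal]
  have : ∀ σ : Equiv.Perm (Fin l), (c fun i => v (σ i)) = c v := fun σ => hc σ v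
  simp only [this, Finset.sum_const, Finset.card_univ, Fintype.card_perm, Fintype.card_fin, nsmul_eq_mul, smul_eq_mul]
  have : (l.factorial : ℝ) ≠ 0 := by positivity
  field_simp

lemma norm_fderiv_const' {G : Type*} [NormedAddCommGroup G] [NormedSpace ℝ G] (c : G) (x : Euc N) :
    ‖fderiv ℝ (fun _ : Euc N => c) x‖ = 0 := by simp

lemma diagPoly_iter_high {l : ℕ} (c : ContinuousMultilinearMap ℝ (fun _ : Fin l => Euc N) ℝ)
    (hc : ∀ (σ : Equiv.Perm (Fin l)) v, c (v ∘ σ) = c v) {n : ℕ} (hn : l < n) (x : Euc N) :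
    iteratedFDeriv ℝ n (fun x => polyEval (diagPoly c) x) x = 0 := by
  obtain ⟨m, rfl⟩ := Nat.exists_eq_add_of_lt hn
  clear hn
  induction m generalizing x with
  | zero =>
    rw [← norm_eq_zero, add_zero, ← norm_fderiv_iteratedFDeriv]
    have : iteratedFDeriv ℝ l (fun x => polyEval (diagPoly c) x) = fun _ => c := funext (diagPoly_iter c hc)
    rw [this]; exact norm_fderiv_const' _ _
  | succ m ih =>
    rw [← norm_eq_zero, ← norm_fderiv_iteratedFDeriv]
    have : iteratedFDeriv ℝ (l + (m + 1)) (fun x => polyEval (diagPoly c) x) = fun _ => 0 := funext ih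
    rw [this]; exact norm_fderiv_const' _ _

lemma iter_sub {w w' : Euc N → ℝ} (h : ContDiff ℝ (⊤ : ℕ∞) w) (h' : ContDiff ℝ (⊤ : ℕ∞) w') (n : ℕ) (x : Euc N) :
    iteratedFDeriv ℝ n (fun x => w x - w' x) x = iteratedFDeriv ℝ n w x - iteratedFDeriv ℝ n w' x := by
  have h1 : ContDiffAt ℝ n w x := h.contDiffAt.of_le (by exact_mod_cast le_top)
  have h2 : ContDiffAt ℝ n w' x := h'.contDiffAt.of_le (by exact_mod_cast le_top)
  exact iteratedFDeriv_sub_apply h1 h2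

lemma const_symm (hN : 1 ≤ N) {l : ℕ} {w : Euc N → ℝ} (hw : ContDiff ℝ (⊤ : ℕ∞) w) {r : ℝ} (hr : 1 ≤ r)
    {c : ContinuousMultilinearMap ℝ (fun _ : Fin l => Euc N) ℝ}
    (h : eLpNorm (fun x => iteratedFDeriv ℝ l w x - c) (ENNReal.ofReal r) volume ≠ ⊤) 
    (σ : Equiv.Perm (Fin l)) (v : Fin l → Euc N) : c (v ∘ σ) = c v := by
  rw [← sub_eq_zero]
  refine const_eq_zero_of_eLpNorm hN (r := r) (by linarith) ?_
  have hb := eLpNorm_le_mul_eLpNorm_of_ae_le_mul (μ := volume) (f := fun _ : Euc N => c (v ∘ σ) - c v)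
    (g := fun x => iteratedFDeriv ℝ l w x - c) (c := (∏ i, ‖(v ∘ σ) i‖) + ∏ i, ‖v i‖) 
    (ae_of_all _ fun x => ?_) (ENNReal.ofReal r)
  · exact ne_top_of_le_ne_top (ENNReal.mul_ne_top ENNReal.ofReal_ne_top h) hb
  · have h1 := (iteratedFDeriv ℝ l w x - c).le_opNorm (v ∘ σ)
    have h2 := (iteratedFDeriv ℝ l w x - c).le_opNorm v
    have e : c (v ∘ σ) - c v = (iteratedFDeriv ℝ l w x - c) v - (iteratedFDeriv ℝ l w x - c) (v ∘ σ) := by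
      rw [_root_.sub_apply, _root_.sub_apply, iter_symm hw]; ring
    rw [e]
    refine (norm_sub_le _ _).trans ?_
    linarith

lemma exists_good {k : ℕ} {p : ℝ} (ha : Adm N k p) {u : Euc N → ℝ} (hu : ContDiff ℝ (⊤ : ℕ∞) u)
    (hup : eLpNorm (iteratedFDeriv ℝ k u) (ENNReal.ofReal p) volume ≠ ⊤) :
    ∃ Q : MvPolynomial (Fin N) ℝ, Q.totalDegree ≤ k - 1 ∧ Good N k p (fun x => u x - polyEval Q x) ∧
      iteratedFDeriv ℝ k (fun x => u x - polyEval Q x) = iteratedFDeriv ℝ k u := by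
  have key : ∀ J : ℕ, J ≤ k → ∃ Q : MvPolynomial (Fin N) ℝ, Q.totalDegree ≤ k - 1 ∧
      (∀ j : ℕ, j ≤ J → ((j : ℝ) < N / p →
        eLpNorm (iteratedFDeriv ℝ (k - j) (fun x => u x - polyEval Q x)) (ENNReal.ofReal (ps N p j)) volume ≠ ⊤) ∧
       (N / p < (j : ℝ) → iteratedFDeriv ℝ (k - j) (fun x => u x - polyEval Q x) 0 = 0)) ∧
      iteratedFDeriv ℝ k (fun x => u x - polyEval Q x) = iteratedFDeriv ℝ k u := by
    intro J
    induction J with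
    | zero =>
      intro _
      refine ⟨0, by simp, fun j hj => ?_, by simp [polyEval]⟩
      obtain rfl : j = 0 := by omega
      refine ⟨fun _ => by simpa [polyEval, ps_zero] using hup, fun h => ?_⟩
      have h1 := ha.hp
      have : 0 ≤ N / p := by positivity
      simp at h; linarith
    | succ J ih =>
      intro hJ
      obtain ⟨Q, hQ, h, hk⟩ := ih (by omega)
      set w : Euc N → ℝ := fun x => u x - polyEval Q x with hw
      have hws : ContDiff ℝ (⊤ : ℕ∞) w := hu.sub (contDiff_polyEval Q)
      set l := k - (J + 1) with hl
      have ek : k - J = l + 1 := by omega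
      have hc : ∃ c : ContinuousMultilinearMap ℝ (fun _ : Fin l => Euc N) ℝ,
          (∀ (σ : Equiv.Perm (Fin l)) v, c (v ∘ σ) = c v) ∧
          (((J + 1 : ℕ) : ℝ) < N / p → eLpNorm (fun x => iteratedFDeriv ℝ l w x - c) (ENNReal.ofReal (ps N p (J + 1))) volume ≠ ⊤) ∧
          (N / p < ((J + 1 : ℕ) : ℝ) → iteratedFDeriv ℝ l w 0 = c) := by
        rcases ha.lt_or hJ with h1 | ⟨h1, -⟩
        · have h2 : (J : ℝ) < N / p := by push_cast at h1; linarith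
          obtain ⟨C, hC⟩ := sobolev_exists (F := ContinuousMultilinearMap ℝ (fun _ : Fin l => Euc N) ℝ) ha.hN
            (one_le_ps ha.hN ha.hp h2) (one_le_ps ha.hN ha.hp h1) ps_succ
          have h3 := (h J le_rfl).1 h2
          rw [ek, ← eLpNorm_fderiv_iter] at h3
          obtain ⟨c, hc⟩ := hC _ ((contDiff_iter hws l).of_le one_le_cinf) h3
          have h4 := ne_top_of_le_ne_top (ENNReal.mul_ne_top ENNReal.coe_ne_top h3) hc
          exact ⟨c, const_symm ha.hN hws (one_le_ps ha.hN ha.hp h1) h4, fun _ => h4, fun h => by linarith⟩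
        · exact ⟨iteratedFDeriv ℝ l w 0, fun σ v => iter_symm hws _ _ _ _, fun h => by linarith, fun _ => rfl⟩
      obtain ⟨c, hcs, hc1, hc2⟩ := hc
      have e : (fun x => u x - polyEval (Q + diagPoly c) x) = fun x => w x - polyEval (diagPoly c) x := by
        ext x; simp [hw, polyEval]; ring
      have hhigh : ∀ n, l < n → iteratedFDeriv ℝ n (fun x => w x - polyEval (diagPoly c) x) = iteratedFDeriv ℝ n w := by
        intro n hn; ext1 x
        rw [iter_sub hws (contDiff_polyEval _), diagPoly_iter_high c hcs hn, sub_zero]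
      have hlow : iteratedFDeriv ℝ l (fun x => w x - polyEval (diagPoly c) x) = fun x => iteratedFDeriv ℝ l w x - c := by
        ext1 x
        rw [iter_sub hws (contDiff_polyEval _), diagPoly_iter c hcs]
      refine ⟨Q + diagPoly c, ?_, ?_, ?_⟩
      · refine (MvPolynomial.totalDegree_add _ _).trans (max_le hQ ((diagPoly_deg c).trans (by omega)))
      · rw [e]
        intro j hj
        rcases Nat.lt_or_ge J j with h1 | h1
        · obtain rfl : j = J + 1 := by omega
          rw [hlow]
          exact ⟨hc1, fun h => by beta_reduce; rw [hc2 h, sub_self]⟩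
        · rw [hhigh (k - j) (by omega)]
          exact h j h1
      · rw [e, hhigh k (by omega), hk]
  obtain ⟨Q, hQ, h, hk⟩ := key k le_rfl
  exact ⟨Q, hQ, ⟨hu.sub (contDiff_polyEval Q), fun j hj => (h j hj).1, fun j hj => (h j hj).2⟩, hk⟩
end
end

section
section
variable {N : ℕ}

lemma ae_ne_zero (hN : 1 ≤ N) : ∀ᵐ x : Euc N, x ≠ 0 := by
  have : Nonempty (Fin N) := ⟨⟨0, hN⟩⟩
  exact compl_mem_ae_iff.2 (measure_singleton 0)

lemma wt_le {s a : ℝ} {q : ℝ≥0∞} (h : s + N / q.toReal = a) (ha : 0 ≤ a) {x : Euc N} (hx : x ≠ 0) :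
    ENNReal.ofReal (wt N s q x) ≤ ENNReal.ofReal (‖x‖ ^ (-a)) := by
  have hx' : 0 < ‖x‖ := norm_pos_iff.2 hx
  refine ENNReal.ofReal_le_ofReal ?_
  unfold wt
  have : -s - N / q.toReal = -a := by linarith
  rw [this]
  exact Real.rpow_le_rpow_of_nonpos hx' (by linarith) (by linarith)

lemma interp1 (hN : 1 ≤ N) {e : Euc N → ℝ≥0∞} (he : Measurable e) {p q r θ j : ℝ} (hp : 0 < p) (hq : 0 < q) (hr : 0 < r)
    (hj : 0 ≤ j) (hθ : 0 ≤ θ) (hθ1 : θ ≤ 1) (h1 : 1 / q = θ / p + (1 - θ) / r) (h2 : N / r = N / p - j) :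
    (∫⁻ x, (ENNReal.ofReal (wt N (j - N / p) (ENNReal.ofReal q) x) * e x) ^ q) ^ (1 / q) ≤
      ((∫⁻ x, (ENNReal.ofReal (‖x‖ ^ (-j)) * e x) ^ p) ^ (1 / p)) ^ θ * 
       ((∫⁻ x, e x ^ r) ^ (1 / r)) ^ (1 - θ) := by
  have hexp : j - N / p + N / (ENNReal.ofReal q).toReal = θ * j := by
    rw [ENNReal.toReal_ofReal hq.le, div_eq_mul_one_div (N : ℝ) q, h1]
    have : (N : ℝ) * (θ / p + (1 - θ) / r) = θ * (N / p) + (1 - θ) * (N / r) := by ring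
    rw [this, h2]; ring
  have hpt : ∀ᵐ x : Euc N, (ENNReal.ofReal (wt N (j - N / p) (ENNReal.ofReal q) x) * e x) ^ q ≤
      ((ENNReal.ofReal (‖x‖ ^ (-j)) * e x) ^ p) ^ (θ * q / p) * (e x ^ r) ^ ((1 - θ) * q / r) := by
    filter_upwards [ae_ne_zero hN] with x hx
    have hx' : 0 < ‖x‖ := norm_pos_iff.2 hx
    have h3 := wt_le hexp (by positivity) hx
    rw [← ENNReal.rpow_mul, ← ENNReal.rpow_mul]
    have e1 : p * (θ * q / p) = θ * q := by field_simp
    have e2 : r * ((1 - θ) * q / r) = (1 - θ) * q := by field_simp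
    have e3 : e x ^ q = e x ^ (θ * q) * e x ^ ((1 - θ) * q) := by
      rw [← ENNReal.rpow_add_of_nonneg _ _ (by positivity) (by have : 0 ≤ 1 - θ := by linarith
                                                               positivity)]
      congr 1; ring
    rw [e1, e2, ENNReal.mul_rpow_of_nonneg (ENNReal.ofReal (‖x‖ ^ (-j))) _ (by positivity : 0 ≤ θ * q), ENNReal.mul_rpow_of_nonneg (ENNReal.ofReal (wt N _ _ x)) _ hq.le, e3, ← mul_assoc]
    gcongr ?_ * _ * _
    refine (ENNReal.rpow_le_rpow h3 hq.le).trans (le_of_eq ?_)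
    rw [ENNReal.ofReal_rpow_of_nonneg (by positivity) hq.le, ENNReal.ofReal_rpow_of_nonneg (by positivity) (by positivity),
      ← Real.rpow_mul hx'.le, ← Real.rpow_mul hx'.le]
    congr 2; ring
  have h3 := ENNReal.lintegral_mul_norm_pow_le (μ := volume) (f := fun x : Euc N => (ENNReal.ofReal (‖x‖ ^ (-j)) * e x) ^ p)
    (g := fun x => e x ^ r) (p := θ * q / p) (q := (1 - θ) * q / r) (by fun_prop) (by fun_prop) (by positivity)
    (by have : 0 ≤ 1 - θ := by linarith
        positivity) (by
          have : θ * q / p + (1 - θ) * q / r = q * (θ / p + (1 - θ) / r) := by ring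
          rw [this, ← h1]; field_simp)
  have h4 := ENNReal.rpow_le_rpow ((lintegral_mono_ae hpt).trans h3) (z := 1 / q) (by positivity)
  refine h4.trans (le_of_eq ?_)
  rw [ENNReal.mul_rpow_of_nonneg _ _ (by positivity), ← ENNReal.rpow_mul, ← ENNReal.rpow_mul, ← ENNReal.rpow_mul,
    ← ENNReal.rpow_mul]
  congr 2
  · field_simp
  · field_simp

lemma interp2 (hN : 1 ≤ N) {e : Euc N → ℝ≥0∞} (he : Measurable e) {p q j : ℝ} (hp : 0 < p) (hpq : p ≤ q)
    (hj : N / p ≤ j) {B : ℝ≥0∞} (hB : ∀ x, ENNReal.ofReal (‖x‖ ^ (-(j - N / p))) * e x ≤ B) :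
    (∫⁻ x, (ENNReal.ofReal (wt N (j - N / p) (ENNReal.ofReal q) x) * e x) ^ q) ^ (1 / q) ≤
      ((∫⁻ x, (ENNReal.ofReal (‖x‖ ^ (-j)) * e x) ^ p) ^ (1 / p)) ^ (p / q) * B ^ (1 - p / q) := by
  have hq : 0 < q := by linarith
  have hexp : j - N / p + N / (ENNReal.ofReal q).toReal = (j - N / p) + N / q := by
    rw [ENNReal.toReal_ofReal hq.le]
  have hpt : ∀ᵐ x : Euc N, (ENNReal.ofReal (wt N (j - N / p) (ENNReal.ofReal q) x) * e x) ^ q ≤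
      B ^ (q - p) * ((ENNReal.ofReal (‖x‖ ^ (-j)) * e x) ^ p) := by
    filter_upwards [ae_ne_zero hN] with x hx
    have hx' : 0 < ‖x‖ := norm_pos_iff.2 hx
    have h3 := wt_le hexp (by have : 0 ≤ j - N / p := by linarith
                              positivity) hx
    refine le_trans ?_ (mul_le_mul_left (ENNReal.rpow_le_rpow (hB x) (by linarith)) _)
    have e3 : e x ^ q = e x ^ (q - p) * e x ^ p := by
      rw [← ENNReal.rpow_add_of_nonneg _ _ (by linarith) (by linarith)]
      congr 1; ring
    rw [ENNReal.mul_rpow_of_nonneg (ENNReal.ofReal (‖x‖ ^ (-(j - N / p)))) _ (by linarith : 0 ≤ q - p), ENNReal.mul_rpow_of_nonneg (ENNReal.ofReal (wt N _ _ x)) _ hq.le,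
      ENNReal.mul_rpow_of_nonneg (ENNReal.ofReal (‖x‖ ^ (-j))) _ hp.le, e3, mul_mul_mul_comm]
    gcongr ?_ * _
    refine (ENNReal.rpow_le_rpow h3 hq.le).trans (le_of_eq ?_)
    rw [ENNReal.ofReal_rpow_of_nonneg (by positivity) hq.le, ENNReal.ofReal_rpow_of_nonneg (by positivity) (by linarith),
      ENNReal.ofReal_rpow_of_nonneg (by positivity) hp.le,
      ← Real.rpow_mul hx'.le, ← Real.rpow_mul hx'.le, ← Real.rpow_mul hx'.le, ← ENNReal.ofReal_mul (by positivity),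
      ← Real.rpow_add hx']
    congr 2; field_simp; ring
  have hm := lintegral_const_mul (μ := volume) (B ^ (q - p)) (f := fun x : Euc N => (ENNReal.ofReal (‖x‖ ^ (-j)) * e x) ^ p)
    (by fun_prop)
  have h4 := ENNReal.rpow_le_rpow ((lintegral_mono_ae hpt).trans hm.le) (z := 1 / q) (by positivity)
  refine h4.trans (le_of_eq ?_)
  rw [ENNReal.mul_rpow_of_nonneg _ _ (by positivity), ← ENNReal.rpow_mul, ← ENNReal.rpow_mul, mul_comm]
  congr 2
  · field_simp
  · field_simp

lemma theta_comb {A B C1 C2 M : ℝ≥0∞} {θ : ℝ} (hθ : 0 ≤ θ) (hθ1 : θ ≤ 1) (hA : A ≤ C1 * M) (hB : B ≤ C2 * M) :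
    A ^ θ * B ^ (1 - θ) ≤ max C1 C2 * M := by
  have h1 : A ≤ max C1 C2 * M := hA.trans (by gcongr; exact le_max_left _ _)
  have h2 : B ≤ max C1 C2 * M := hB.trans (by gcongr; exact le_max_right _ _)
  calc A ^ θ * B ^ (1 - θ) ≤ (max C1 C2 * M) ^ θ * (max C1 C2 * M) ^ (1 - θ) := by
        gcongr
    _ = _ := by rw [← ENNReal.rpow_add_of_nonneg _ _ hθ (by linarith), add_sub_cancel, ENNReal.rpow_one]

lemma est5 {k : ℕ} {p : ℝ} (ha : Adm N k p) {j : ℕ} (hj1 : 1 ≤ j) (hj : j ≤ k) {q : ℝ≥0∞} (hq : q ∈ Ijp N j p) :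
    ∃ C : NNReal, ∀ w, Good N k p w →
      eLpNorm (fun x => wt N (j - N / p) q x * ‖iteratedFDeriv ℝ (k - j) w x‖) q volume ≤
        C * eLpNorm (iteratedFDeriv ℝ k w) (ENNReal.ofReal p) volume := by
  have hN := ha.hN
  have hp := ha.hp
  have hp0 : 0 < p := by linarith
  have hN0 : (0:ℝ) < N := by exact_mod_cast hN
  have hj0 : (0:ℝ) < j := by exact_mod_cast hj1
  have hwt0 : ∀ s (q : ℝ≥0∞) (x : Euc N), 0 ≤ wt N s q x := fun s q x => by unfold wt; positivity
  have hne : p ≠ N / j := by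
    intro h
    refine ha.ne j hj1 hj ?_
    rw [h]; field_simp
  obtain ⟨C1, hC1, h1⟩ := est1 ha j hj
  have h1' : ∀ w, Good N k p w → (∫⁻ x, (ENNReal.ofReal (‖x‖ ^ (-(j : ℝ))) * ‖iteratedFDeriv ℝ (k - j) w x‖ₑ) ^ p) ^ (1 / p) ≤
      C1 ^ (1 / p) * eLpNorm (iteratedFDeriv ℝ k w) (ENNReal.ofReal p) volume := by
    intro w hw
    rw [eLpNorm_ofReal _ hp0, ← ENNReal.mul_rpow_of_nonneg _ _ (by positivity)]
    exact ENNReal.rpow_le_rpow (h1 w hw) (by positivity)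
  have hC1' : C1 ^ (1 / p) ≠ ⊤ := ENNReal.rpow_ne_top_of_nonneg (by positivity) hC1
  have hmeas : ∀ w, Good N k p w → Measurable fun x => ‖iteratedFDeriv ℝ (k - j) w x‖ₑ := by
    intro w hw
    have := (contDiff_iter hw.smooth (k - j)).continuous
    exact Continuous.measurable (by fun_prop)
  have hen : ∀ (w : Euc N → ℝ) (q : ℝ≥0∞) (x : Euc N), ‖wt N (j - N / p) q x * ‖iteratedFDeriv ℝ (k - j) w x‖‖ₑ =
      ENNReal.ofReal (wt N (j - N / p) q x) * ‖iteratedFDeriv ℝ (k - j) w x‖ₑ := by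
    intro w q x
    rw [enorm_mul, enorm_norm, Real.enorm_of_nonneg (hwt0 _ _ _)]
  rcases ha.lt_or hj with h2 | ⟨h2, -⟩
  · have hlt : p < N / j := by rw [lt_div_iff₀ hj0]; rw [lt_div_iff₀ hp0] at h2; linarith
    rw [Ijp, if_neg (fun h => hne h.1), if_pos hlt] at hq
    have hps := ps_pos hN hp h2
    have eps : (N : ℝ) * p / (N - j * p) = ps N p j := by
      have := ps_inv_pos hN hp h2
      have h3 : (N : ℝ) - j * p ≠ 0 := by rw [lt_div_iff₀ hp0] at h2; linarith
      have h4 : p⁻¹ - (j : ℝ) / N = (N - j * p) / (N * p) := by field_simp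
      rw [ps, h4, inv_div]
    rw [eps] at hq
    have hqt : q ≠ ⊤ := ne_top_of_le_ne_top ENNReal.ofReal_ne_top hq.2
    obtain ⟨t, ht, rfl⟩ : ∃ t : ℝ, 0 ≤ t ∧ q = ENNReal.ofReal t := ⟨q.toReal, ENNReal.toReal_nonneg, (ENNReal.ofReal_toReal hqt).symm⟩
    have hpt : p ≤ t := (ENNReal.ofReal_le_ofReal_iff ht).1 hq.1
    have htr : t ≤ ps N p j := (ENNReal.ofReal_le_ofReal_iff hps.le).1 hq.2
    have ht0 : 0 < t := by linarith
    obtain ⟨C2, h3⟩ := est2 ha j hj h2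
    refine ⟨(max (C1 ^ (1 / p)) C2).toNNReal, fun w hw => ?_⟩
    rw [ENNReal.coe_toNNReal (max_lt hC1'.lt_top ENNReal.coe_lt_top).ne]
    rw [eLpNorm_ofReal _ ht0]
    simp_rw [hen]
    have hNps := N_div_ps (p := p) (j := j) hN
    -- theta
    set θ := (t⁻¹ - (ps N p j)⁻¹) / (j / N) with hθ
    have hjN : 0 < (j : ℝ) / N := by positivity
    have hθ0 : 0 ≤ θ := div_nonneg (by rw [sub_nonneg]; exact inv_anti₀ ht0 htr) hjN.le
    have hθ1 : θ ≤ 1 := by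
      rw [hθ, div_le_one hjN, ps_inv]
      have := inv_anti₀ hp0 hpt
      linarith
    have hθe : 1 / t = θ / p + (1 - θ) / ps N p j := by
      have : θ * (j / N) = t⁻¹ - (ps N p j)⁻¹ := by rw [hθ]; field_simp
      rw [div_eq_mul_inv (1 - θ), div_eq_mul_inv θ, one_div]
      have h5 : (ps N p j)⁻¹ = p⁻¹ - j / N := ps_inv
      clear_value θ
      linear_combination (-1) * this + θ * h5
    refine (interp1 hN (hmeas w hw) hp0 ht0 hps hj0.le hθ0 hθ1 hθe hNps).trans ?_
    refine theta_comb hθ0 hθ1 (h1' w hw) ?_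
    rw [← eLpNorm_ofReal _ hps]
    exact h3 w hw
  · have hlt : ¬ p < N / j := by rw [lt_div_iff₀ hj0]; rw [div_lt_iff₀ hp0] at h2; linarith
    rw [Ijp, if_neg (fun h => hne h.1), if_neg hlt] at hq
    obtain ⟨C2, h3⟩ := est3 ha j hj h2
    by_cases hqt : q = ⊤
    · subst hqt
      refine ⟨C2, fun w hw => ?_⟩
      rw [eLpNorm_exponent_top]
      refine essSup_le_of_ae_le _ ?_
      filter_upwards [ae_ne_zero hN] with x hx
      rw [hen]
      refine le_trans ?_ (h3 w hw x)
      refine mul_le_mul_left ?_ _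
      exact wt_le (s := (j:ℝ) - N/p) (a := (j:ℝ) - N/p) (q := ⊤) (by simp) (by linarith) hx
    obtain ⟨t, ht, rfl⟩ : ∃ t : ℝ, 0 ≤ t ∧ q = ENNReal.ofReal t := ⟨q.toReal, ENNReal.toReal_nonneg, (ENNReal.ofReal_toReal hqt).symm⟩
    have hpt : p ≤ t := (ENNReal.ofReal_le_ofReal_iff ht).1 hq.1
    have ht0 : 0 < t := by linarith
    refine ⟨(max (C1 ^ (1 / p)) C2).toNNReal, fun w hw => ?_⟩
    rw [ENNReal.coe_toNNReal (max_lt hC1'.lt_top ENNReal.coe_lt_top).ne]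
    rw [eLpNorm_ofReal _ ht0]
    simp_rw [hen]
    refine (interp2 hN (hmeas w hw) hp0 hpt h2.le (h3 w hw)).trans ?_
    exact theta_comb (by positivity) ((div_le_one ht0).2 hpt) (h1' w hw) le_rfl
end
end

section
section
variable {N : ℕ}
open scoped Convolution

lemma pderivList_reflect (l : List (Fin N)) (f : Euc N → ℝ) (hf : ContDiff ℝ (⊤ : ℕ∞) f) (x y : Euc N) :
    pderivList l (fun y => f (x - y)) y = (-1) ^ l.length * pderivList l f (x - y) := by
  induction l generalizing f with
  | nil => simp [pderivList]
  | cons i l ih =>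
    have h1 : (fun y => fderiv ℝ (fun y => f (x - y)) y (EuclideanSpace.single i 1)) =
        fun y => (fun z => - fderiv ℝ f z (EuclideanSpace.single i 1)) (x - y) := by
      funext y
      have hd : HasFDerivAt (fun y => f (x - y)) ((fderiv ℝ f (x - y)).comp (-(ContinuousLinearMap.id ℝ (Euc N)))) y := by
        have h2 : HasFDerivAt (fun y : Euc N => x - y) (-(ContinuousLinearMap.id ℝ (Euc N))) y := by
          simpa using (hasFDerivAt_id y).const_sub x
        exact ((hf.differentiable (by simp)) (x - y)).hasFDerivAt.comp y h2
      rw [hd.fderiv]; simp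
    have hf' : ContDiff ℝ (⊤ : ℕ∞) (fun z => fderiv ℝ f z (EuclideanSpace.single i 1)) :=
      (hf.fderiv_right (m := (⊤ : ℕ∞)) (by simp)).clm_apply contDiff_const
    have hneg : ∀ (l : List (Fin N)) (f : Euc N → ℝ) z, ContDiff ℝ (⊤ : ℕ∞) f → pderivList l (fun z => - f z) z = - pderivList l f z := by
      intro l
      induction l with
      | nil => intro f z _; rfl
      | cons i l ih =>
        intro f z hf
        simp only [pderivList]
        rw [← ih _ _ ((hf.fderiv_right (m := (⊤ : ℕ∞)) (by simp)).clm_apply contDiff_const)]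
        congr 1
        funext z
        rw [fderiv_fun_neg]; simp
    simp only [pderivList]
    rw [h1, ih (fun z => - fderiv ℝ f z (EuclideanSpace.single i 1)) hf'.neg, hneg _ _ _ hf']
    simp [pow_succ]

lemma pderivList_conv (l : List (Fin N)) {f u : Euc N → ℝ} (hf : ContDiff ℝ (⊤ : ℕ∞) f) (hc : HasCompactSupport f)
    (hu : LocallyIntegrable u volume) :
    pderivList l (f ⋆[ContinuousLinearMap.lsmul ℝ ℝ, volume] u) = pderivList l f ⋆[ContinuousLinearMap.lsmul ℝ ℝ, volume] u := by
  induction l generalizing f with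
  | nil => rfl
  | cons i l ih =>
    have hf' : ContDiff ℝ (⊤ : ℕ∞) (fun z => fderiv ℝ f z (EuclideanSpace.single i 1)) :=
      (hf.fderiv_right (m := (⊤ : ℕ∞)) (by simp)).clm_apply contDiff_const
    have hc' : HasCompactSupport (fun z => fderiv ℝ f z (EuclideanSpace.single i 1)) :=
      hc.fderiv_apply (𝕜 := ℝ) _
    simp only [pderivList]
    rw [← ih hf' hc']
    congr 1
    funext x
    have h := hc.hasFDerivAt_convolution_left (ContinuousLinearMap.lsmul ℝ ℝ) (hf.of_le (by exact_mod_cast le_top)) hu x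
    have hi : Integrable (fun t => (ContinuousLinearMap.lsmul ℝ ℝ : ℝ →L[ℝ] ℝ →L[ℝ] ℝ).precompL (Euc N) (fderiv ℝ f t) (u (x - t))) :=
      HasCompactSupport.convolutionExists_left _ (hc.fderiv (𝕜 := ℝ)) (hf.continuous_fderiv (by simp)) hu x
    rw [h.fderiv, convolution_def, convolution_def, ContinuousLinearMap.integral_apply hi]
    rfl

lemma weak_conv {l : List (Fin N)} {f u g : Euc N → ℝ} (hf : ContDiff ℝ (⊤ : ℕ∞) f) (hc : HasCompactSupport f)
    (h : IsWeakDerivList l u g) :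
    pderivList l (f ⋆[ContinuousLinearMap.lsmul ℝ ℝ, volume] u) = f ⋆[ContinuousLinearMap.lsmul ℝ ℝ, volume] g := by
  rw [pderivList_conv l hf hc h.1]
  funext x
  rw [convolution_eq_swap, convolution_eq_swap]
  have h2 := h.2.2 (fun y => f (x - y)) (hf.comp (contDiff_const.sub contDiff_id))
    (hc.comp_homeomorph (Homeomorph.subLeft x))
  simp only [pderivList_reflect l f hf] at h2
  have h3 : (-1 : ℝ) ^ l.length * ∫ y, u y * pderivList l f (x - y) = (-1 : ℝ) ^ l.length * ∫ y, g y * f (x - y) := by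
    rw [← h2, ← integral_const_mul]
    congr 1; funext y; ring
  have h4 := mul_left_cancel₀ (pow_ne_zero _ (by norm_num)) h3
  simp only [ContinuousLinearMap.lsmul_apply, smul_eq_mul]
  simp only [mul_comm _ (u _), mul_comm _ (g _)]
  exact h4

lemma transl_cont {p : ℝ} (hp : 1 ≤ p) {g : Euc N → ℝ} (hg : MemLp g (ENNReal.ofReal p) volume) :
    Tendsto (fun t : Euc N => eLpNorm (fun x => g (t + x) - g x) (ENNReal.ofReal p) volume) (𝓝 0) (𝓝 0) := by
  have : Fact (1 ≤ ENNReal.ofReal p) := ⟨by simpa using hp⟩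
  have : Fact (ENNReal.ofReal p ≠ ⊤) := ⟨by simp⟩
  have h1 : Continuous fun t : Euc N => (DomAddAct.mk t +ᵥ hg.toLp g : Lp ℝ (ENNReal.ofReal p) (volume : Measure (Euc N))) :=
    (DomAddAct.continuous_mk).vadd continuous_const
  have h2 := (h1.tendsto 0).edist (tendsto_const_nhds (x := hg.toLp g))
  simp only [DomAddAct.mk_zero, zero_vadd, edist_self] at h2
  refine h2.congr fun t => ?_
  rw [DomAddAct.mk_vadd_toLp, Lp.edist_toLp_toLp]
  rfl

lemma moll_Lp {p : ℝ} (hp : 1 ≤ p) {g : Euc N → ℝ} (hg : MemLp g (ENNReal.ofReal p) volume)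
    {φ : ℕ → ContDiffBump (0 : Euc N)} (hφ : Tendsto (fun i => (φ i).rOut) atTop (𝓝 0)) :
    Tendsto (fun n => eLpNorm (fun x => ((φ n).normed volume ⋆[ContinuousLinearMap.lsmul ℝ ℝ, volume] g) x - g x) (ENNReal.ofReal p) volume) atTop (𝓝 0) := by
  have hp0 : 0 < p := by linarith
  rw [ENNReal.tendsto_nhds_zero]
  intro ε hε
  have h1 := (ENNReal.tendsto_nhds_zero.1 (transl_cont hp hg)) ε hε
  obtain ⟨δ, hδ, h1⟩ := Metric.eventually_nhds_iff.1 h1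
  filter_upwards [hφ.eventually_lt_const hδ] with n hn
  have hint : LocallyIntegrable g volume := hg.locallyIntegrable (by simpa using hp)
  set ψ := (φ n).normed volume with hψ
  have hψc : Continuous ψ := (φ n).continuous_normed
  set g' := hg.1.mk g
  have hg'm : Measurable g' := hg.1.stronglyMeasurable_mk.measurable
  have hgg' : g =ᵐ[volume] g' := hg.1.ae_eq_mk
  have hconv : ∀ x, (ψ ⋆[ContinuousLinearMap.lsmul ℝ ℝ, volume] g) x = ∫ t, ψ t * g' (x - t) := by
    intro x
    rw [convolution_def]
    refine integral_congr_ae ?_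
    have := (quasiMeasurePreserving_sub_left (volume : Measure (Euc N)) x).ae hgg'
    filter_upwards [this] with t ht
    simp [ht]
  have hint' : LocallyIntegrable g' volume := hint.congr hgg'
  have hex : ∀ x, Integrable (fun t => ψ t * g' (x - t)) := by
    intro x
    exact HasCompactSupport.convolutionExists_left (ContinuousLinearMap.lsmul ℝ ℝ) (φ n).hasCompactSupport_normed hψc hint' x
  have hψ0 : ∀ t, 0 ≤ ψ t := fun t => (φ n).nonneg_normed t
  set ν := (volume : Measure (Euc N)).withDensity fun t => ENNReal.ofReal (ψ t) with hν
  have hνu : ν Set.univ = 1 := by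
    rw [hν, withDensity_apply _ MeasurableSet.univ, Measure.restrict_univ, ← ofReal_integral_eq_lintegral_ofReal
      (φ n).integrable_normed (ae_of_all _ hψ0), (φ n).integral_normed]; simp
  have hdiff : ∀ x, ‖(∫ t, ψ t * g' (x - t)) - g' x‖ₑ ≤ ∫⁻ t, ‖g' (x - t) - g' x‖ₑ ∂ν := by
    intro x
    have : (∫ t, ψ t * g' (x - t)) - g' x = ∫ t, ψ t * (g' (x - t) - g' x) := by
      have e : ∀ t, ψ t * (g' (x - t) - g' x) = ψ t * g' (x - t) - ψ t * g' x := fun t => by ring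
      simp_rw [e]
      rw [integral_sub (hex x) ((φ n).integrable_normed.mul_const _), integral_mul_const, (φ n).integral_normed, one_mul]
    rw [this]
    refine (enorm_integral_le_lintegral_enorm _).trans (le_of_eq ?_)
    rw [hν, lintegral_withDensity_eq_lintegral_mul _ (by fun_prop) (by fun_prop)]
    refine lintegral_congr fun t => ?_
    simp [enorm_mul, Real.enorm_of_nonneg (hψ0 t)]
  have hcongr : eLpNorm (fun x => (ψ ⋆[ContinuousLinearMap.lsmul ℝ ℝ, volume] g) x - g x) (ENNReal.ofReal p) volume =
     eLpNorm (fun x => (∫ t, ψ t * g' (x - t)) - g' x) (ENNReal.ofReal p) volume := by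
    refine eLpNorm_congr_ae ?_
    filter_upwards [hgg'] with x hx
    rw [hconv, hx]
  rw [hcongr, eLpNorm_ofReal _ hp0]
  have hkey : ∫⁻ x, ‖(∫ t, ψ t * g' (x - t)) - g' x‖ₑ ^ p ≤ ε ^ p := by
    calc ∫⁻ x, ‖(∫ t, ψ t * g' (x - t)) - g' x‖ₑ ^ p ≤ ∫⁻ x, ∫⁻ t, ‖g' (x - t) - g' x‖ₑ ^ p ∂ν := by
          refine lintegral_mono fun x => ?_
          refine (ENNReal.rpow_le_rpow (hdiff x) hp0.le).trans ?_
          refine (jensen_pow ν (by fun_prop) hp).trans ?_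
          rw [hνu]; simp
      _ = ∫⁻ t, (∫⁻ x, ‖g' (x - t) - g' x‖ₑ ^ p) ∂ν := by
          have : IsFiniteMeasure ν := ⟨by rw [hνu]; simp⟩
          rw [lintegral_lintegral_swap]
          have : Measurable (fun z : Euc N × Euc N => ‖g' (z.1 - z.2) - g' z.1‖ₑ ^ p) := by fun_prop
          exact this.aemeasurable
      _ ≤ ∫⁻ t, ε ^ p ∂ν := by
          refine lintegral_mono_ae ?_
          rw [hν, ae_withDensity_iff (by fun_prop)]
          refine ae_of_all _ fun t ht => ?_
          have ht' : t ∈ ball (0 : Euc N) (φ n).rOut := by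
            rw [← (φ n).support_normed_eq (μ := volume)]
            intro h0
            apply ht
            have : ψ t = 0 := h0
            simp [this]
          have h3 := h1 (y := -t) (by simp at ht' ⊢; linarith)
          have h4 : eLpNorm (fun x => g (-t + x) - g x) (ENNReal.ofReal p) volume =
              eLpNorm (fun x => g' (x - t) - g' x) (ENNReal.ofReal p) volume := by
            refine eLpNorm_congr_ae ?_
            have := (measurePreserving_add_left (volume : Measure (Euc N)) (-t)).quasiMeasurePreserving.ae hgg'
            filter_upwards [hgg', this] with x hx hx'
            rw [hx, hx', neg_add_eq_sub]
          rw [h4, eLpNorm_ofReal _ hp0] at h3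
          have := ENNReal.rpow_le_rpow h3 hp0.le
          rwa [← ENNReal.rpow_mul, one_div_mul_cancel hp0.ne', ENNReal.rpow_one] at this
      _ = ε ^ p := by rw [lintegral_const, hνu, mul_one]
  have := ENNReal.rpow_le_rpow hkey (z := 1 / p) (by positivity)
  rwa [← ENNReal.rpow_mul, mul_one_div_cancel hp0.ne', ENNReal.rpow_one] at this

lemma mollify {k : ℕ} {p : ℝ} (hp : 1 ≤ p) {u : Euc N → ℝ} {g : (Fin k → Fin N) → Euc N → ℝ} (hu : LocallyIntegrable u volume)
    (hg : ∀ m, IsWeakDerivList (List.ofFn m) u (g m)) (hgp : ∀ m, MemLp (g m) (ENNReal.ofReal p) volume) :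
    ∃ U : ℕ → Euc N → ℝ, (∀ n, ContDiff ℝ (⊤ : ℕ∞) (U n)) ∧
      (∀ m, Tendsto (fun n => eLpNorm (fun x => iteratedFDeriv ℝ k (U n) x (ev m) - g m x) (ENNReal.ofReal p) volume) atTop (𝓝 0)) ∧
      ∀ᵐ x, Tendsto (fun n => U n x) atTop (𝓝 (u x)) := by
  let φ : ℕ → ContDiffBump (0 : Euc N) := fun n => ⟨1 / (n + 1), 2 * (1 / (n + 1)), by positivity, by
    have : (0:ℝ) < 1 / (n + 1) := by positivity
    linarith⟩
  have hφ : Tendsto (fun i => (φ i).rOut) atTop (𝓝 0) := by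
    have := (tendsto_one_div_add_atTop_nhds_zero_nat (𝕜 := ℝ)).const_mul 2
    simpa [φ] using this
  have hs : ∀ n, ContDiff ℝ (⊤ : ℕ∞) ((φ n).normed volume) := fun n => (φ n).contDiff_normed
  have hc : ∀ n, HasCompactSupport ((φ n).normed volume) := fun n => (φ n).hasCompactSupport_normed
  have hU : ∀ n, ContDiff ℝ (⊤ : ℕ∞) ((φ n).normed volume ⋆[ContinuousLinearMap.lsmul ℝ ℝ, volume] u) := fun n =>
    (hc n).contDiff_convolution_left _ (hs n) hu
  refine ⟨fun n => (φ n).normed volume ⋆[ContinuousLinearMap.lsmul ℝ ℝ, volume] u, hU, fun m => ?_, ?_⟩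
  · have := moll_Lp hp (hgp m) hφ
    refine this.congr fun n => ?_
    congr 1
    funext x
    rw [← pderivList_eq k m _ (hU n), weak_conv (hs n) (hc n) (hg m)]
  · exact ContDiffBump.ae_convolution_tendsto_right_of_locallyIntegrable (K := 2) hφ (Eventually.of_forall fun n => le_rfl) hu
end
end

section
section
variable {N : ℕ}

lemma abs_ev_le {l : ℕ} (c : ContinuousMultilinearMap ℝ (fun _ : Fin l => Euc N) ℝ) (m : Fin l → Fin N) : ‖c (ev m)‖ ≤ ‖c‖ := by
  refine (c.le_opNorm _).trans (le_of_eq ?_)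
  simp [ev]

lemma norm_cmm_le {l : ℕ} (c : ContinuousMultilinearMap ℝ (fun _ : Fin l => Euc N) ℝ) : ‖c‖ ≤ ∑ m : Fin l → Fin N, ‖c (ev m)‖ := by
  refine ContinuousMultilinearMap.opNorm_le_bound (by positivity) fun v => ?_
  rw [cmm_expand, Finset.sum_mul]
  refine (norm_sum_le _ _).trans (Finset.sum_le_sum fun m _ => ?_)
  rw [norm_mul, mul_comm, norm_prod]
  gcongr with i
  exact PiLp.norm_apply_le (v i) (m i)

lemma ibp (k : ℕ) (m : Fin k → Fin N) {W φ : Euc N → ℝ} (hW : ContDiff ℝ (⊤ : ℕ∞) W) (hφ : ContDiff ℝ (⊤ : ℕ∞) φ)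
    (hc : HasCompactSupport φ) :
    ∫ x, W x * pderivList (List.ofFn m) φ x = (-1) ^ k * ∫ x, iteratedFDeriv ℝ k W x (ev m) * φ x := by
  induction k generalizing φ with
  | zero => simp [pderivList]
  | succ k ih =>
    rw [List.ofFn_succ]
    simp only [pderivList]
    have hφ' : ContDiff ℝ (⊤ : ℕ∞) (fun z => fderiv ℝ φ z (EuclideanSpace.single (m 0) 1)) :=
      (hφ.fderiv_right (m := (⊤ : ℕ∞)) (by simp)).clm_apply contDiff_const
    have hc' : HasCompactSupport (fun z => fderiv ℝ φ z (EuclideanSpace.single (m 0) 1)) :=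
      hc.fderiv_apply (𝕜 := ℝ) _
    rw [ih (fun i => m i.succ) hφ' hc']
    have hd := contDiff_iter_apply hW k (ev fun i => m i.succ)
    have hd' : ContDiff ℝ (⊤ : ℕ∞) (fun z => fderiv ℝ (fun y => iteratedFDeriv ℝ k W y (ev fun i => m i.succ)) z (EuclideanSpace.single (m 0) 1)) :=
      (hd.fderiv_right (m := (⊤ : ℕ∞)) (by simp)).clm_apply contDiff_const
    rw [integral_mul_fderiv_eq_neg_fderiv_mul_of_integrable
      ((hd'.continuous.mul hφ.continuous).integrable_of_hasCompactSupport hc.mul_left)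
      ((hd.continuous.mul hφ'.continuous).integrable_of_hasCompactSupport hc'.mul_left)
      ((hd.continuous.mul hφ.continuous).integrable_of_hasCompactSupport hc.mul_left)
      (fun x _ => hd.differentiable (by simp) x) (fun x _ => hφ.differentiable (by simp) x)]
    rw [pow_succ, mul_assoc]
    congr 1
    rw [neg_one_mul]
    congr 2
    funext x
    rw [iter_succ_tail hW]
    rfl

lemma pderivList_smooth (l : List (Fin N)) : ∀ {φ : Euc N → ℝ} (_ : ContDiff ℝ (⊤ : ℕ∞) φ)
    (_ : HasCompactSupport φ), ContDiff ℝ (⊤ : ℕ∞) (pderivList l φ) ∧ HasCompactSupport (pderivList l φ) := by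
  induction l with
  | nil => exact fun h h' => ⟨h, h'⟩
  | cons i l ih =>
    intro φ hφ hc
    exact ih ((hφ.fderiv_right (m := (⊤ : ℕ∞)) (by simp)).clm_apply contDiff_const) (hc.fderiv_apply (𝕜 := ℝ) _)

lemma lim_pair (hN : 1 ≤ N) {p : ℝ} (hp : 1 ≤ p) (j : ℕ) {f : ℕ → Euc N → ℝ} {F : Euc N → ℝ} (hf : ∀ n, Continuous (f n))
    (hF : AEStronglyMeasurable F volume)
    (h : Tendsto (fun n => eLpNorm (fun x => ‖x‖ ^ (-(j:ℝ)) * (f n x - F x)) (ENNReal.ofReal p) volume) atTop (𝓝 0)) :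
    LocallyIntegrable F volume ∧ ∀ φ : Euc N → ℝ, Continuous φ → HasCompactSupport φ →
      Tendsto (fun n => ∫ x, f n x * φ x) atTop (𝓝 (∫ x, F x * φ x)) := by
  have hp1 : 1 ≤ ENNReal.ofReal p := by simpa using hp
  have hdm : ∀ n, AEStronglyMeasurable (fun x => ‖x‖ ^ (-(j:ℝ)) * (f n x - F x)) volume := by
    intro n
    have : Measurable (fun x : Euc N => ‖x‖ ^ (-(j:ℝ))) := by fun_prop
    exact this.aestronglyMeasurable.mul ((hf n).aestronglyMeasurable.sub hF)
  have hpc : Continuous (fun x : Euc N => ‖x‖ ^ j) := by fun_prop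
  have hid : ∀ n, ∀ᵐ x, f n x - F x = ‖x‖ ^ j * (‖x‖ ^ (-(j:ℝ)) * (f n x - F x)) := by
    intro n
    filter_upwards [ae_ne_zero hN] with x hx
    have : ‖x‖ ≠ 0 := norm_ne_zero_iff.2 hx
    rw [Real.rpow_neg (norm_nonneg _), Real.rpow_natCast]
    field_simp
  have hloc : LocallyIntegrable F volume := by
    obtain ⟨n, hn⟩ := (h.eventually_lt_const (zero_lt_one)).exists
    have h1 : MemLp (fun x => ‖x‖ ^ (-(j:ℝ)) * (f n x - F x)) (ENNReal.ofReal p) volume := ⟨hdm n, hn.trans (by simp)⟩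
    have h2 := (h1.locallyIntegrable hp1).continuous_mul hpc
    have h3 : LocallyIntegrable (fun x => f n x - F x) volume := h2.congr ((hid n).mono fun x hx => hx.symm)
    have h4 := ((hf n).locallyIntegrable (μ := volume)).sub h3
    refine h4.congr (ae_of_all _ fun x => ?_)
    simp
  refine ⟨hloc, fun φ hφ hc => ?_⟩
  rw [tendsto_iff_edist_tendsto_0]
  have hconj := ENNReal.HolderConjugate.conjExponent hp1
  set p' := ENNReal.conjExponent (ENNReal.ofReal p)
  have hψc : Continuous (fun x : Euc N => ‖x‖ ^ j * φ x) := by fun_prop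
  have hψ : MemLp (fun x : Euc N => ‖x‖ ^ j * φ x) p' volume :=
    hψc.memLp_of_hasCompactSupport hc.mul_left
  have hlim : Tendsto (fun n => eLpNorm (fun x => ‖x‖ ^ (-(j:ℝ)) * (f n x - F x)) (ENNReal.ofReal p) volume * eLpNorm (fun x : Euc N => ‖x‖ ^ j * φ x) p' volume) atTop (𝓝 0) := by
    have := ENNReal.Tendsto.mul_const h (Or.inr hψ.2.ne) (b := eLpNorm (fun x : Euc N => ‖x‖ ^ j * φ x) p' volume)
    simpa using this
  refine tendsto_of_tendsto_of_tendsto_of_le_of_le tendsto_const_nhds hlim (fun _ => zero_le) fun n => ?_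
  have i1 : Integrable (fun x => f n x * φ x) := ((hf n).mul hφ).integrable_of_hasCompactSupport hc.mul_left
  have i2 : Integrable (fun x => F x * φ x) := by
    have := hloc.integrable_smul_right_of_hasCompactSupport hφ hc
    simpa using this
  have h0 := eLpNorm_smul_le_mul_eLpNorm (μ := volume) (p := ENNReal.ofReal p) (q := p') (r := 1) hψ.1 (hdm n)
  refine le_trans ?_ h0
  rw [edist_eq_enorm_sub, ← integral_sub i1 i2, eLpNorm_one_eq_lintegral_enorm]
  refine (enorm_integral_le_lintegral_enorm _).trans (le_of_eq (lintegral_congr_ae ?_))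
  filter_upwards [hid n] with x hx
  have : f n x * φ x - F x * φ x = (f n x - F x) * φ x := by ring
  simp only [Pi.smul_apply', smul_eq_mul]
  congr 1
  rw [this]
  linear_combination φ x * hx

lemma poly_closed (d : ℕ) {Q : ℕ → MvPolynomial (Fin N) ℝ} (hQ : ∀ n, (Q n).totalDegree ≤ d) (S : Set (Euc N)) (h : Euc N → ℝ)
    (hl : ∀ x ∈ S, Tendsto (fun n => polyEval (Q n) x) atTop (𝓝 (h x))) :
    ∃ R : MvPolynomial (Fin N) ℝ, R.totalDegree ≤ d ∧ ∀ x ∈ S, h x = polyEval R x := by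
  have hfin : Module.Finite ℝ (MvPolynomial.restrictTotalDegree (Fin N) ℝ d) := inferInstance
  let T : MvPolynomial (Fin N) ℝ →ₗ[ℝ] (S → ℝ) :=
    LinearMap.pi fun x : S => (MvPolynomial.aeval (fun i => (x : Euc N) i) : MvPolynomial (Fin N) ℝ →ₐ[ℝ] ℝ).toLinearMap
  have hT : ∀ Q x, T Q x = polyEval Q x := fun Q x => by simp [T, polyEval, MvPolynomial.aeval_eq_eval]
  set V := (MvPolynomial.restrictTotalDegree (Fin N) ℝ d).map T with hV
  have hVfin : FiniteDimensional ℝ V := inferInstance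
  have hcl : IsClosed (V : Set (S → ℝ)) := V.closed_of_finiteDimensional
  have hmem : (fun x : S => h x) ∈ (V : Set (S → ℝ)) := by
    refine hcl.mem_of_tendsto (f := fun n => T (Q n)) (b := atTop) ?_ (Eventually.of_forall fun n => ?_)
    · rw [tendsto_pi_nhds]
      intro x
      simp only [hT]
      exact hl x x.2
    · exact Submodule.mem_map_of_mem ((MvPolynomial.mem_restrictTotalDegree _ _ _).2 (hQ n))
  obtain ⟨R, hR, hRe⟩ := hmem
  refine ⟨R, (MvPolynomial.mem_restrictTotalDegree _ _ _).1 hR, fun x hx => ?_⟩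
  rw [← hT R ⟨x, hx⟩, hRe]
end
end

section
section
variable {N : ℕ}

lemma eLpNorm_iter_le {k : ℕ} {p : ℝ} (hp : 1 ≤ p) {w : Euc N → ℝ} (hw : ContDiff ℝ (⊤ : ℕ∞) w) :
    eLpNorm (iteratedFDeriv ℝ k w) (ENNReal.ofReal p) volume ≤
      ∑ m : Fin k → Fin N, eLpNorm (fun x => iteratedFDeriv ℝ k w x (ev m)) (ENNReal.ofReal p) volume := by
  have h1 : eLpNorm (iteratedFDeriv ℝ k w) (ENNReal.ofReal p) volume ≤
      eLpNorm (∑ m : Fin k → Fin N, fun x => ‖iteratedFDeriv ℝ k w x (ev m)‖) (ENNReal.ofReal p) volume := by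
    refine eLpNorm_mono fun x => ?_
    refine (norm_cmm_le _).trans ?_
    simp only [Finset.sum_apply]
    exact Real.le_norm_self _
  refine h1.trans ((eLpNorm_sum_le (fun m _ => ?_) (by simpa using hp)).trans (le_of_eq ?_))
  · exact ((contDiff_iter_apply hw k (ev m)).continuous.norm).aestronglyMeasurable
  · refine Finset.sum_congr rfl fun m _ => ?_
    exact eLpNorm_norm _

lemma approx {k : ℕ} {p : ℝ} (ha : Adm N k p) {u : Euc N → ℝ} {g : (Fin k → Fin N) → Euc N → ℝ} (hu : LocallyIntegrable u volume)
    (hg : ∀ m, IsWeakDerivList (List.ofFn m) u (g m)) (hgp : ∀ m, MemLp (g m) (ENNReal.ofReal p) volume) :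
    ∃ (W : ℕ → Euc N → ℝ) (Q : ℕ → MvPolynomial (Fin N) ℝ), (∀ n, Good N k p (W n)) ∧ (∀ n, (Q n).totalDegree ≤ k - 1) ∧
      (∀ᵐ x, Tendsto (fun n => W n x + polyEval (Q n) x) atTop (𝓝 (u x))) ∧
      (∀ n₀ n n', n₀ ≤ n → n₀ ≤ n' → eLpNorm (iteratedFDeriv ℝ k (W n - W n')) (ENNReal.ofReal p) volume ≤ (1 / 2) ^ n₀) ∧
      (∀ n, eLpNorm (iteratedFDeriv ℝ k (W n)) (ENNReal.ofReal p) volume ≤ (1 / 2) ^ n + ∑ m, eLpNorm (g m) (ENNReal.ofReal p) volume) := by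
  have hp := ha.hp
  have hp1 : 1 ≤ ENNReal.ofReal p := by simpa using hp
  obtain ⟨U, hU, hUg, hUu⟩ := mollify hp hu hg hgp
  set a : ℕ → ℝ≥0∞ := fun n => ∑ m, eLpNorm (fun x => iteratedFDeriv ℝ k (U n) x (ev m) - g m x) (ENNReal.ofReal p) volume with hadef
  have hlim : Tendsto a atTop (𝓝 0) := by
    have := tendsto_finsetSum Finset.univ (fun m _ => hUg m)
    simpa using this
  obtain ⟨φ, hφ, hφa⟩ := extraction_forall_of_eventually' (P := fun i n => a n ≤ (1 / 2) ^ (i + 1)) (fun i =>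
    (hlim.eventually_lt_const (u := (1/2 : ℝ≥0∞) ^ (i + 1)) (by
      refine ENNReal.pow_pos ?_ _
      simp)).exists_forall_of_atTop.imp fun n h b hb => (h b hb).le)
  have hcont : ∀ n m, AEStronglyMeasurable (fun x => iteratedFDeriv ℝ k (U n) x (ev m)) volume := fun n m =>
    (contDiff_iter_apply (hU n) k (ev m)).continuous.aestronglyMeasurable
  have hG : ∀ n, eLpNorm (iteratedFDeriv ℝ k (U n)) (ENNReal.ofReal p) volume ≤ a n + ∑ m, eLpNorm (g m) (ENNReal.ofReal p) volume := by
    intro n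
    refine (eLpNorm_iter_le hp (hU n)).trans ?_
    rw [hadef, ← Finset.sum_add_distrib]
    refine Finset.sum_le_sum fun m _ => ?_
    have := eLpNorm_add_le (((hcont n m).sub (hgp m).1)) (hgp m).1 hp1
    rw [sub_add_cancel] at this
    exact this
  have hhalf : ∀ n : ℕ, (1 / 2 : ℝ≥0∞) ^ (n + 1) ≤ (1 / 2) ^ n := fun n =>
    pow_le_pow_right_of_le_one' (by simp) (by omega)
  have hfin : ∀ n, eLpNorm (iteratedFDeriv ℝ k (U (φ n))) (ENNReal.ofReal p) volume ≠ ⊤ := by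
    intro n
    refine ne_top_of_le_ne_top ?_ (hG (φ n))
    refine ENNReal.add_ne_top.2 ⟨ne_top_of_le_ne_top ?_ (hφa n), ENNReal.sum_ne_top.2 fun m _ => (hgp m).2.ne⟩
    exact ENNReal.pow_ne_top (by simp)
  choose Q hQd hQg hQk using fun n => exists_good ha (hU (φ n)) (hfin n)
  refine ⟨fun n => fun x => U (φ n) x - polyEval (Q n) x, Q, hQg, hQd, ?_, ?_, ?_⟩
  · filter_upwards [hUu] with x hx
    simp only [sub_add_cancel]
    exact hx.comp hφ.tendsto_atTop
  · intro n₀ n n' h h'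
    have hs := (hQg n).smooth
    have hs' := (hQg n').smooth
    refine (eLpNorm_iter_le hp (hs.sub hs')).trans ?_
    have : ∀ m, eLpNorm (fun x => iteratedFDeriv ℝ k ((fun x => U (φ n) x - polyEval (Q n) x) - (fun x => U (φ n') x - polyEval (Q n') x)) x (ev m)) (ENNReal.ofReal p) volume
      ≤ eLpNorm (fun x => iteratedFDeriv ℝ k (U (φ n)) x (ev m) - g m x) (ENNReal.ofReal p) volume +
        eLpNorm (fun x => iteratedFDeriv ℝ k (U (φ n')) x (ev m) - g m x) (ENNReal.ofReal p) volume := by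
      intro m
      have e : (fun x => iteratedFDeriv ℝ k ((fun x => U (φ n) x - polyEval (Q n) x) - (fun x => U (φ n') x - polyEval (Q n') x)) x (ev m)) =
         (fun x => iteratedFDeriv ℝ k (U (φ n)) x (ev m) - g m x) - (fun x => iteratedFDeriv ℝ k (U (φ n')) x (ev m) - g m x) := by
        funext x
        have := iter_sub hs hs' k x
        simp only [Pi.sub_apply]
        rw [show ((fun x => U (φ n) x - polyEval (Q n) x) - (fun x => U (φ n') x - polyEval (Q n') x)) = 
          fun x => (U (φ n) x - polyEval (Q n) x) - (U (φ n') x - polyEval (Q n') x) from rfl, this, hQk n, hQk n']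
        rw [_root_.sub_apply]
        ring
      rw [e]
      exact eLpNorm_sub_le ((hcont _ m).sub (hgp m).1) ((hcont _ m).sub (hgp m).1) hp1
    refine (Finset.sum_le_sum fun m _ => this m).trans ?_
    rw [Finset.sum_add_distrib]
    have h1 : ∀ n, n₀ ≤ n → a (φ n) ≤ (1/2) ^ (n₀ + 1) := fun n hn => (hφa n).trans (pow_le_pow_right_of_le_one' (by simp) (by omega))
    refine (add_le_add (h1 n h) (h1 n' h')).trans (le_of_eq ?_)
    rw [← two_mul, pow_succ, mul_comm, mul_assoc]
    rw [show (1/2 : ℝ≥0∞) * 2 = 1 by rw [one_div]; exact ENNReal.inv_mul_cancel (by simp) (by simp), mul_one]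
  · intro n
    rw [hQk n]
    refine (hG _).trans ?_
    gcongr
    exact (hφa n).trans (hhalf n)

/-- pointwise limit of the derivative components -/
def vlim (W : ℕ → Euc N → ℝ) (i : ℕ) (m : Fin i → Fin N) (x : Euc N) : ℝ :=
  limUnder atTop (fun n => iteratedFDeriv ℝ i (W n) x (ev m))

lemma iter_sub_ev {w w' : Euc N → ℝ} (h : ContDiff ℝ (⊤ : ℕ∞) w) (h' : ContDiff ℝ (⊤ : ℕ∞) w') (i : ℕ) (m : Fin i → Fin N) (x : Euc N) :
    iteratedFDeriv ℝ i (w - w') x (ev m) = iteratedFDeriv ℝ i w x (ev m) - iteratedFDeriv ℝ i w' x (ev m) := by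
  have := iter_sub h h' i x
  rw [show w - w' = fun x => w x - w' x from rfl, this, _root_.sub_apply]

lemma core_ab {k : ℕ} {p : ℝ} (ha : Adm N k p) {W : ℕ → Euc N → ℝ} (hW : ∀ n, Good N k p (W n))
    (hc : ∀ n₀ n n', n₀ ≤ n → n₀ ≤ n' → eLpNorm (iteratedFDeriv ℝ k (W n - W n')) (ENNReal.ofReal p) volume ≤ (1 / 2) ^ n₀)
    {j : ℕ} (hj : j ≤ k) (m : Fin (k - j) → Fin N) :
    (∀ᵐ x, Tendsto (fun n => iteratedFDeriv ℝ (k - j) (W n) x (ev m)) atTop (𝓝 (vlim W (k - j) m x))) ∧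
    Tendsto (fun n => eLpNorm (fun x => ‖x‖ ^ (-(j:ℝ)) * (iteratedFDeriv ℝ (k - j) (W n) x (ev m) - vlim W (k - j) m x)) (ENNReal.ofReal p) volume)
      atTop (𝓝 0) := by
  have hp := ha.hp
  have hp0 : 0 < p := by linarith
  have hp1 : 1 ≤ ENNReal.ofReal p := by simpa using hp
  obtain ⟨C1, hC1, h1⟩ := est1 ha j hj
  have hC : C1 ^ (1 / p) ≠ ⊤ := ENNReal.rpow_ne_top_of_nonneg (by positivity) hC1
  set C := C1 ^ (1 / p)
  have hb : ∀ n₀ n n', n₀ ≤ n → n₀ ≤ n' → eLpNorm (fun x => ‖x‖ ^ (-(j:ℝ)) * (iteratedFDeriv ℝ (k - j) (W n) x (ev m) - iteratedFDeriv ℝ (k - j) (W n') x (ev m))) (ENNReal.ofReal p) volume ≤ C * (1 / 2) ^ n₀ := by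
    intro n₀ n n' h h'
    refine le_trans ?_ (mul_le_mul_right (hc n₀ n n' h h') C)
    have h2 := h1 _ (Good.sub ha (hW n) (hW n'))
    have h3 := ENNReal.rpow_le_rpow h2 (z := 1 / p) (by positivity)
    rw [ENNReal.mul_rpow_of_nonneg _ _ (by positivity), ← eLpNorm_ofReal _ hp0] at h3
    refine le_trans ?_ h3
    rw [eLpNorm_ofReal _ hp0]
    gcongr with x
    rw [enorm_mul, Real.enorm_of_nonneg (by positivity)]
    gcongr
    rw [← iter_sub_ev (hW n).smooth (hW n').smooth]
    exact enorm_le_iff_norm_le.2 (abs_ev_le _ m)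
  have hmw : Measurable (fun x : Euc N => ‖x‖ ^ (-(j:ℝ))) := by fun_prop
  have hcont : ∀ n, Continuous (fun x => iteratedFDeriv ℝ (k - j) (W n) x (ev m)) := fun n =>
    (contDiff_iter_apply (hW n).smooth (k - j) (ev m)).continuous
  have hconv : ∀ᵐ x, Tendsto (fun n => iteratedFDeriv ℝ (k - j) (W n) x (ev m)) atTop (𝓝 (vlim W (k - j) m x)) := by
    have h4 := Lp.ae_tendsto_of_cauchy_eLpNorm (μ := volume) (f := fun n x => ‖x‖ ^ (-(j:ℝ)) * iteratedFDeriv ℝ (k - j) (W n) x (ev m))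
      (B := fun n => (C + 1) * (1 / 2) ^ n)
      (fun n => hmw.aestronglyMeasurable.mul (hcont n).aestronglyMeasurable) hp1 (by
        rw [ENNReal.tsum_mul_left, one_div, ENNReal.tsum_geometric]
        refine ENNReal.mul_ne_top (by simp [hC]) (by simp)) (by
        intro n₀ n n' h h'
        have h5 := hb n₀ n n' h h'
        have e : ((fun x : Euc N => ‖x‖ ^ (-(j:ℝ)) * iteratedFDeriv ℝ (k - j) (W n) x (ev m)) - fun x => ‖x‖ ^ (-(j:ℝ)) * iteratedFDeriv ℝ (k - j) (W n') x (ev m)) =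
          fun x => ‖x‖ ^ (-(j:ℝ)) * (iteratedFDeriv ℝ (k - j) (W n) x (ev m) - iteratedFDeriv ℝ (k - j) (W n') x (ev m)) := by
          funext x; simp only [Pi.sub_apply]; ring
        rw [e]
        refine h5.trans_lt ?_
        rw [add_mul, one_mul]
        refine ENNReal.lt_add_right (ENNReal.mul_ne_top hC (ENNReal.pow_ne_top (by simp))) ?_
        refine (ENNReal.pow_pos ?_ _).ne'
        simp)
    filter_upwards [h4, ae_ne_zero ha.hN] with x ⟨l, hl⟩ hx
    have hx' : 0 < ‖x‖ := norm_pos_iff.2 hx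
    refine tendsto_nhds_limUnder ⟨‖x‖ ^ (j:ℝ) * l, ?_⟩
    refine (hl.const_mul (‖x‖ ^ (j:ℝ))).congr fun n => ?_
    rw [← mul_assoc, ← Real.rpow_add hx']; simp
  refine ⟨hconv, ?_⟩
  have hlim : Tendsto (fun n : ℕ => C * (1 / 2 : ℝ≥0∞) ^ n) atTop (𝓝 0) := by
    have := ENNReal.Tendsto.const_mul (ENNReal.tendsto_pow_atTop_nhds_zero_of_lt_one (r := 1 / 2) (by simp)) (Or.inr hC)
    simpa using this
  refine tendsto_of_tendsto_of_tendsto_of_le_of_le tendsto_const_nhds hlim (fun _ => zero_le) fun n => ?_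
  refine (Lp.eLpNorm_lim_le_liminf_eLpNorm (f := fun n' x => ‖x‖ ^ (-(j:ℝ)) * (iteratedFDeriv ℝ (k - j) (W n) x (ev m) - iteratedFDeriv ℝ (k - j) (W n') x (ev m)))
    (fun n' => hmw.aestronglyMeasurable.mul ((hcont n).sub (hcont n')).aestronglyMeasurable) _ ?_).trans ?_
  · filter_upwards [hconv] with x hx
    exact (tendsto_const_nhds.sub hx).const_mul _
  · refine liminf_le_of_frequently_le' ?_
    refine Eventually.frequently ?_
    filter_upwards [eventually_ge_atTop n] with n' hn'
    exact hb n n n' le_rfl hn'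

lemma core_c {k : ℕ} {p : ℝ} (ha : Adm N k p) {W : ℕ → Euc N → ℝ} (hW : ∀ n, Good N k p (W n))
    (hc : ∀ n₀ n n', n₀ ≤ n → n₀ ≤ n' → eLpNorm (iteratedFDeriv ℝ k (W n - W n')) (ENNReal.ofReal p) volume ≤ (1 / 2) ^ n₀)
    {j : ℕ} (hj : j ≤ k) (hjp : N / p < (j : ℝ)) (m : Fin (k - j) → Fin N) :
    Tendsto (fun x => ‖x‖ ^ (-((j : ℝ) - N / p)) * vlim W (k - j) m x) (cocompact (Euc N)) (𝓝 0) := by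
  have hp := ha.hp
  obtain ⟨C, h3⟩ := est3 ha j hj hjp
  set s := (j : ℝ) - N / p
  have hb : ∀ x n₀ n n', n₀ ≤ n → n₀ ≤ n' → |‖x‖ ^ (-s) * (iteratedFDeriv ℝ (k - j) (W n) x (ev m) - iteratedFDeriv ℝ (k - j) (W n') x (ev m))| ≤ C * (1 / 2) ^ n₀ := by
    intro x n₀ n n' h h'
    have h4 := (h3 _ (Good.sub ha (hW n) (hW n')) x).trans (mul_le_mul_right (hc n₀ n n' h h') C)
    have h5 : ENNReal.ofReal |‖x‖ ^ (-s) * (iteratedFDeriv ℝ (k - j) (W n) x (ev m) - iteratedFDeriv ℝ (k - j) (W n') x (ev m))| ≤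
       ENNReal.ofReal (C * (1 / 2) ^ n₀) := by
      have e : ENNReal.ofReal (C * (1 / 2) ^ n₀) = C * (1 / 2) ^ n₀ := by
        rw [ENNReal.ofReal_mul (by positivity), ENNReal.ofReal_pow (by positivity), ENNReal.ofReal_coe_nnreal]
        congr 2
        rw [one_div, one_div, ENNReal.ofReal_inv_of_pos (by norm_num)]; simp
      rw [e]
      refine le_trans ?_ h4
      rw [abs_mul, ENNReal.ofReal_mul (by positivity), abs_of_nonneg (by positivity), ← Real.enorm_eq_ofReal_abs,
        ← iter_sub_ev (hW n).smooth (hW n').smooth]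
      gcongr
      exact enorm_le_iff_norm_le.2 (abs_ev_le _ m)
    exact (ENNReal.ofReal_le_ofReal_iff (by positivity)).1 h5
  have hlim0 : Tendsto (fun n : ℕ => (C : ℝ) * (1 / 2) ^ n) atTop (𝓝 0) := by
    have := (tendsto_pow_atTop_nhds_zero_of_lt_one (r := (1/2 : ℝ)) (by norm_num) (by norm_num)).const_mul (C : ℝ)
    simpa using this
  have hlim : ∀ x : Euc N, x ≠ 0 → Tendsto (fun n => iteratedFDeriv ℝ (k - j) (W n) x (ev m)) atTop (𝓝 (vlim W (k - j) m x)) := by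
    intro x hx
    have hx' : 0 < ‖x‖ := norm_pos_iff.2 hx
    have hcs : CauchySeq (fun n => ‖x‖ ^ (-s) * iteratedFDeriv ℝ (k - j) (W n) x (ev m)) := by
      refine cauchySeq_of_le_tendsto_0 (fun n => (C : ℝ) * (1 / 2) ^ n) (fun n n' n₀ h h' => ?_) hlim0
      rw [Real.dist_eq, ← mul_sub]
      exact hb x n₀ n n' h h'
    obtain ⟨l, hl⟩ := cauchySeq_tendsto_of_complete hcs
    refine tendsto_nhds_limUnder ⟨‖x‖ ^ s * l, ?_⟩
    refine (hl.const_mul (‖x‖ ^ s)).congr fun n => ?_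
    rw [← mul_assoc, ← Real.rpow_add hx']; simp
  have hunif : ∀ x : Euc N, x ≠ 0 → ∀ n, |‖x‖ ^ (-s) * (iteratedFDeriv ℝ (k - j) (W n) x (ev m) - vlim W (k - j) m x)| ≤ C * (1 / 2) ^ n := by
    intro x hx n
    refine le_of_tendsto (((tendsto_const_nhds.sub (hlim x hx)).const_mul _).abs) ?_
    filter_upwards [eventually_ge_atTop n] with n' hn'
    exact hb x n n n' le_rfl hn'
  rw [Metric.tendsto_nhds]
  intro ε hε
  obtain ⟨n, hn⟩ := (hlim0.eventually_lt_const (half_pos hε)).exists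
  have h5 := (Metric.tendsto_nhds.1 (est4 ha (hW n) j hj hjp)) (ε / 2) (half_pos hε)
  have h6 : ∀ᶠ x : Euc N in cocompact (Euc N), x ≠ 0 := by
    have : ({0} : Set (Euc N))ᶜ ∈ cocompact (Euc N) := isCompact_singleton.compl_mem_cocompact
    exact this
  filter_upwards [h5, h6] with x hx hx0
  have h7 := hunif x hx0 n
  rw [Real.dist_eq, sub_zero] at hx ⊢
  have h8 : |‖x‖ ^ (-s) * iteratedFDeriv ℝ (k - j) (W n) x (ev m)| ≤ |‖x‖ ^ (-s) * ‖iteratedFDeriv ℝ (k - j) (W n) x‖| := by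
    rw [abs_mul, abs_mul, abs_norm]
    gcongr
    exact abs_ev_le _ m
  have h9 : ‖x‖ ^ (-s) * vlim W (k - j) m x = ‖x‖ ^ (-s) * iteratedFDeriv ℝ (k - j) (W n) x (ev m) - ‖x‖ ^ (-s) * (iteratedFDeriv ℝ (k - j) (W n) x (ev m) - vlim W (k - j) m x) := by ring
  rw [h9]
  refine (abs_sub _ _).trans_lt ?_
  linarith
end
end

section
section
variable {N : ℕ}

lemma gradNormK_le_sum {i : ℕ} (g : (Fin i → Fin N) → Euc N → ℝ) (x : Euc N) : gradNormK g x ≤ ∑ m, |g m x| := by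
  unfold gradNormK
  refine Real.sqrt_le_iff.2 ⟨by positivity, ?_⟩
  have := Finset.sum_sq_le_sq_sum_of_nonneg (s := Finset.univ) (f := fun m => |g m x|) (fun m _ => abs_nonneg _)
  simpa using this

lemma le_gradNormK {i : ℕ} (g : (Fin i → Fin N) → Euc N → ℝ) (m : Fin i → Fin N) (x : Euc N) : |g m x| ≤ gradNormK g x := by
  unfold gradNormK
  refine Real.abs_le_sqrt ?_
  exact Finset.single_le_sum (f := fun m => g m x ^ 2) (fun m _ => sq_nonneg _) (Finset.mem_univ m)

lemma gradNormK_nonneg {i : ℕ} (g : (Fin i → Fin N) → Euc N → ℝ) (x : Euc N) : 0 ≤ gradNormK g x := Real.sqrt_nonneg _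

lemma iter_zero_ev {i : ℕ} (hi : i = 0) (w : Euc N → ℝ) (m : Fin i → Fin N) (x : Euc N) :
    iteratedFDeriv ℝ i w x (ev m) = w x := by
  subst hi
  simp

lemma gradNormK_meas {i : ℕ} {g : (Fin i → Fin N) → Euc N → ℝ} (hg : ∀ m, AEStronglyMeasurable (g m) volume) :
    AEStronglyMeasurable (gradNormK g) volume := by
  unfold gradNormK
  have h1 : AEMeasurable (fun x => ∑ m, g m x ^ 2) volume := 
    Finset.aemeasurable_fun_sum _ fun m _ => (hg m).aemeasurable.pow_const 2
  exact h1.sqrt.aestronglyMeasurable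

theorem main_exist {k : ℕ} {p : ℝ} (ha : Adm N k p) (hk : 1 ≤ k) {u : Euc N → ℝ} {g : (Fin k → Fin N) → Euc N → ℝ}
    (hg : ∀ m, IsWeakDerivList (List.ofFn m) u (g m)) (hgp : ∀ m, MemLp (g m) (ENNReal.ofReal p) volume) :
    ∃ Q : MvPolynomial (Fin N) ℝ, Q.totalDegree ≤ k - 1 ∧
      MemLp (fun x => ‖x‖ ^ (-(k:ℝ)) * (u x - polyEval Q x)) (ENNReal.ofReal p) volume ∧
      ∃ v : (i : ℕ) → (Fin i → Fin N) → Euc N → ℝ, ∀ j : ℕ, 1 ≤ j → j ≤ k →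
        (∀ m, IsWeakDerivList (List.ofFn m) (fun x => u x - polyEval Q x) (v (k - j) m)) ∧
        (N / p < (j : ℝ) → ∀ m, Tendsto (fun x => ‖x‖ ^ (-((j : ℝ) - N / p)) * v (k - j) m x) (cocompact (Euc N)) (𝓝 0)) ∧
        ∀ (q : ℝ≥0∞) (C : NNReal), (∀ w, Good N k p w →
            eLpNorm (fun x => wt N (j - N / p) q x * ‖iteratedFDeriv ℝ (k - j) w x‖) q volume ≤
              C * eLpNorm (iteratedFDeriv ℝ k w) (ENNReal.ofReal p) volume) →
          eLpNorm (fun x => wt N (j - N / p) q x * gradNormK (v (k - j)) x) q volume ≤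
            ((Fintype.card (Fin (k - j) → Fin N) : NNReal) * C * (Fintype.card (Fin k → Fin N) : NNReal) : NNReal) *
              eLpNorm (gradNormK g) (ENNReal.ofReal p) volume := by
  have hp := ha.hp
  have hp0 : 0 < p := by linarith
  have hp1 : 1 ≤ ENNReal.ofReal p := by simpa using hp
  have hN := ha.hN
  have hu : LocallyIntegrable u volume := (hg fun _ => ⟨0, hN⟩).1
  obtain ⟨W, Q, hW, hQ, hWu, hc, hbd⟩ := approx ha hu hg hgp
  have hW0 := fun m => core_ab ha hW hc (j := k) le_rfl m
  set m0 : Fin (k - k) → Fin N := fun _ => ⟨0, hN⟩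
  have hkk : k - k = 0 := by omega
  obtain ⟨h0a, h0b⟩ := hW0 m0
  simp only [iter_zero_ev hkk] at h0a h0b
  set V := vlim W (k - k) m0 with hV
  have hSae : ∀ᵐ x, Tendsto (fun n => polyEval (Q n) x) atTop (𝓝 (u x - V x)) := by
    filter_upwards [hWu, h0a] with x h1 h2
    exact (h1.sub h2).congr fun n => by ring
  obtain ⟨R, hRd, hR⟩ := poly_closed (k - 1) hQ {x | Tendsto (fun n => polyEval (Q n) x) atTop (𝓝 (u x - V x))}
    (fun x => u x - V x) (fun x hx => hx)
  have hVR : ∀ᵐ x, V x = u x - polyEval R x := by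
    filter_upwards [hSae] with x hx
    have := hR x hx
    linarith
  have hcont : ∀ n i (m : Fin i → Fin N), Continuous (fun x => iteratedFDeriv ℝ i (W n) x (ev m)) := fun n i m =>
    (contDiff_iter_apply (hW n).smooth i (ev m)).continuous
  have hvm : ∀ j, j ≤ k → ∀ m, AEStronglyMeasurable (vlim W (k - j) m) volume := fun j hj m =>
    aestronglyMeasurable_of_tendsto_ae (f := fun n x => iteratedFDeriv ℝ (k - j) (W n) x (ev m)) atTop
      (fun n => (hcont n _ m).aestronglyMeasurable) (core_ab ha hW hc hj m).1
  have hpair := fun j hj m => lim_pair hN hp j (fun n => hcont n (k - j) m) (hvm j hj m) (core_ab ha hW hc hj m).2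
  have hVpair := lim_pair hN hp k (fun n => (hW n).smooth.continuous) (hvm k le_rfl m0) h0b
  have hmw : ∀ s : ℝ, Measurable (fun x : Euc N => ‖x‖ ^ s) := fun s => by fun_prop
  refine ⟨R, hRd, ?_, fun i m => vlim W i m, fun j hj1 hj => ⟨fun m => ⟨?_, (hpair j hj m).1, fun φ hφ hφc => ?_⟩, fun hjp m => core_c ha hW hc hj hjp m, ?_⟩⟩
  · have hmem : MemLp (fun x => ‖x‖ ^ (-(k:ℝ)) * V x) (ENNReal.ofReal p) volume := by
      obtain ⟨n, hn⟩ := (h0b.eventually_lt_const zero_lt_one).exists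
      have h1 : MemLp (fun x => ‖x‖ ^ (-(k:ℝ)) * (W n x - V x)) (ENNReal.ofReal p) volume :=
        ⟨(hmw _).aestronglyMeasurable.mul ((hW n).smooth.continuous.aestronglyMeasurable.sub (hvm k le_rfl m0)), hn.trans (by simp)⟩
      have h2 : MemLp (fun x => ‖x‖ ^ (-(k:ℝ)) * W n x) (ENNReal.ofReal p) volume := by
        refine ⟨(hmw _).aestronglyMeasurable.mul (hW n).smooth.continuous.aestronglyMeasurable, ?_⟩
        rw [eLpNorm_ofReal _ hp0]
        refine ENNReal.rpow_lt_top_of_nonneg (by positivity) ?_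
        obtain ⟨C, hC, h3⟩ := est1 ha k le_rfl
        have h4 := h3 _ (hW n)
        refine ne_top_of_le_ne_top (ENNReal.mul_ne_top hC ?_) (le_trans (lintegral_mono fun x => ?_) h4)
        · rw [← eLpNorm_ofReal_rpow _ hp0]
          refine ENNReal.rpow_ne_top_of_nonneg hp0.le (ne_top_of_le_ne_top ?_ (hbd n))
          exact ENNReal.add_ne_top.2 ⟨ENNReal.pow_ne_top (by simp), ENNReal.sum_ne_top.2 fun m _ => (hgp m).2.ne⟩
        · rw [enorm_mul, Real.enorm_of_nonneg (by positivity)]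
          gcongr
          refine enorm_le_iff_norm_le.2 ?_
          rw [← iter_zero_ev hkk (W n) m0 x]
          exact abs_ev_le _ m0
      refine (h2.sub h1).ae_eq (ae_of_all _ fun x => ?_)
      simp only [Pi.sub_apply]; ring
    refine hmem.ae_eq ?_
    filter_upwards [hVR] with x hx
    rw [hx]
  · exact hu.sub (contDiff_polyEval R (n := 0)).continuous.locallyIntegrable
  · have hs := pderivList_smooth (List.ofFn m) hφ hφc
    have e1 : ∫ x, (u x - polyEval R x) * pderivList (List.ofFn m) φ x = ∫ x, V x * pderivList (List.ofFn m) φ x := by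
      refine integral_congr_ae ?_
      filter_upwards [hVR] with x hx
      rw [hx]
    rw [e1, List.length_ofFn]
    have t1 := hVpair.2 _ hs.1.continuous hs.2
    have t2 := ((hpair j hj m).2 φ hφ.continuous hφc).const_mul ((-1 : ℝ) ^ (k - j))
    refine tendsto_nhds_unique t1 (t2.congr fun n => ?_)
    exact (ibp (k - j) m (hW n).smooth hφ hφc).symm
  · intro q C hC
    have hwt0 : ∀ x : Euc N, 0 ≤ wt N (j - N / p) q x := fun x => by unfold wt; positivity
    have hwtm : Measurable (fun x : Euc N => wt N (j - N / p) q x) := by unfold wt; fun_prop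
    set A : ℕ → Euc N → ℝ := fun n x => wt N (j - N / p) q x * gradNormK (fun m x => iteratedFDeriv ℝ (k - j) (W n) x (ev m)) x with hA
    have hAm : ∀ n, AEStronglyMeasurable (A n) volume := fun n =>
      hwtm.aestronglyMeasurable.mul (gradNormK_meas fun m => (hcont n _ m).aestronglyMeasurable)
    have hAlim : ∀ᵐ x, Tendsto (fun n => A n x) atTop (𝓝 (wt N (j - N / p) q x * gradNormK (fun m => vlim W (k - j) m) x)) := by
      have h1 : ∀ᵐ x, ∀ m, Tendsto (fun n => iteratedFDeriv ℝ (k - j) (W n) x (ev m)) atTop (𝓝 (vlim W (k - j) m x)) :=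
        ae_all_iff.2 fun m => (core_ab ha hW hc hj m).1
      filter_upwards [h1] with x hx
      refine Tendsto.const_mul _ ?_
      unfold gradNormK
      refine (Real.continuous_sqrt.tendsto _).comp ?_
      exact tendsto_finsetSum _ fun m _ => (hx m).pow 2
    set M := eLpNorm (gradNormK g) (ENNReal.ofReal p) volume
    set K1 := Fintype.card (Fin (k - j) → Fin N)
    set K2 := Fintype.card (Fin k → Fin N)
    have hgM : ∑ m, eLpNorm (g m) (ENNReal.ofReal p) volume ≤ K2 * M := by
      refine (Finset.sum_le_card_nsmul _ _ M fun m _ => ?_).trans (le_of_eq (by simp [K2]))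
      refine eLpNorm_mono fun x => ?_
      rw [Real.norm_of_nonneg (gradNormK_nonneg g x)]
      exact le_gradNormK g m x
    have hAb : ∀ n, eLpNorm (A n) q volume ≤ K1 * (C * ((1/2) ^ n + K2 * M)) := by
      intro n
      have h2 : eLpNorm (A n) q volume ≤ K1 * eLpNorm (fun x => wt N (j - N / p) q x * ‖iteratedFDeriv ℝ (k - j) (W n) x‖) q volume := by
        have := eLpNorm_le_nnreal_smul_eLpNorm_of_ae_le_mul (μ := volume) (f := A n) (g := fun x => wt N (j - N / p) q x * ‖iteratedFDeriv ℝ (k - j) (W n) x‖) (c := K1) (ae_of_all _ fun x => ?_) q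
        · refine this.trans (le_of_eq ?_)
          simp [ENNReal.smul_def]
        · rw [← NNReal.coe_le_coe]
          push_cast
          rw [Real.norm_of_nonneg (mul_nonneg (hwt0 x) (gradNormK_nonneg _ _)), Real.norm_of_nonneg (mul_nonneg (hwt0 x) (norm_nonneg _)),
            mul_left_comm]
          refine mul_le_mul_of_nonneg_left ?_ (hwt0 x)
          refine (gradNormK_le_sum _ _).trans ?_
          refine (Finset.sum_le_card_nsmul _ _ _ fun m _ => abs_ev_le (iteratedFDeriv ℝ (k - j) (W n) x) m).trans (le_of_eq ?_)
          simp [K1]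
      refine h2.trans ?_
      gcongr
      refine (hC _ (hW n)).trans ?_
      gcongr
      exact (hbd n).trans (by gcongr)
    refine (Lp.eLpNorm_lim_le_liminf_eLpNorm hAm _ hAlim).trans ?_
    refine (liminf_le_liminf (Eventually.of_forall hAb)).trans ?_
    have hl : Tendsto (fun n : ℕ => (K1 : ℝ≥0∞) * (C * ((1/2) ^ n + K2 * M))) atTop (𝓝 (K1 * (C * (0 + K2 * M)))) := by
      refine ENNReal.Tendsto.const_mul (ENNReal.Tendsto.const_mul ?_ (Or.inr (by simp))) (Or.inr (by simp))
      exact (ENNReal.tendsto_pow_atTop_nhds_zero_of_lt_one (r := 1 / 2) (by simp)).add tendsto_const_nhds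
    rw [hl.liminf_eq]
    push_cast
    rw [zero_add, mul_assoc, mul_assoc]
end
end

section
section
variable {N : ℕ}

/-- the open annulus -/
def annu (N : ℕ) : Set (Euc N) := {x | 1 < ‖x‖ ∧ ‖x‖ < 2}

lemma annu_open : IsOpen (annu N) :=
  (isOpen_lt continuous_const continuous_norm).inter (isOpen_lt continuous_norm continuous_const)

lemma annu_vol : volume (annu N) ≠ ⊤ := by
  refine ne_top_of_le_ne_top (measure_ball_lt_top (x := (0 : Euc N)) (r := 2) (μ := volume)).ne (measure_mono ?_)
  intro x hx
  simpa using hx.2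

lemma ann_bound {k : ℕ} {p : ℝ} (hp : 1 ≤ p) {f : Euc N → ℝ}
    (hf : MemLp (fun x => ‖x‖ ^ (-(k:ℝ)) * f x) (ENNReal.ofReal p) volume) :
    ∃ C : ℝ≥0∞, C ≠ ⊤ ∧ ∀ R : ℝ, 0 < R → ∫⁻ x in annu N, ‖f (R • x)‖ₑ ≤ C * ENNReal.ofReal (R ^ ((k:ℝ) - N / p)) := by
  have hp0 : 0 < p := by linarith
  set h : Euc N → ℝ≥0∞ := fun x => ‖‖x‖ ^ (-(k:ℝ)) * f x‖ₑ with hh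
  have hfin : ∫⁻ x, h x ^ p ≠ ⊤ := by
    have := eLpNorm_ofReal_rpow (μ := volume) (fun x => ‖x‖ ^ (-(k:ℝ)) * f x) hp0
    rw [← this]
    exact ENNReal.rpow_ne_top_of_nonneg hp0.le hf.2.ne
  set M := ∫⁻ x, h x ^ p with hM
  refine ⟨ENNReal.ofReal (2 ^ k) * ((volume (annu N)) ^ (p - 1) * M) ^ (1 / p), ?_, ?_⟩
  · refine ENNReal.mul_ne_top ENNReal.ofReal_ne_top (ENNReal.rpow_ne_top_of_nonneg (by positivity) ?_)
    exact ENNReal.mul_ne_top (ENNReal.rpow_ne_top_of_nonneg (by linarith) annu_vol) hfin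
  intro R hR
  have h1 : ∀ x ∈ annu N, ‖f (R • x)‖ₑ ≤ ENNReal.ofReal (2 ^ k * R ^ (k:ℝ)) * h (R • x) := by
    intro x hx
    have hx0 : 0 < ‖x‖ := lt_trans one_pos hx.1
    rw [hh]
    simp only
    rw [← Real.enorm_of_nonneg (by positivity : (0:ℝ) ≤ 2 ^ k * R ^ (k:ℝ)), ← enorm_mul]
    refine enorm_le_iff_norm_le.2 ?_
    rw [norm_mul, norm_mul (‖R • x‖ ^ (-(k:ℝ))), norm_smul, Real.norm_of_nonneg hR.le, Real.norm_of_nonneg (by positivity : (0:ℝ) ≤ 2 ^ k * R ^ (k:ℝ)),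
      Real.norm_of_nonneg (by positivity : (0:ℝ) ≤ (R * ‖x‖) ^ (-(k:ℝ))), ← mul_assoc]
    refine le_mul_of_one_le_left (norm_nonneg _) ?_
    rw [Real.rpow_neg (by positivity), Real.rpow_natCast, Real.rpow_natCast, mul_pow, ← div_eq_mul_inv, one_le_div (by positivity), mul_comm]
    gcongr
    exact hx.2.le
  have hme : AEMeasurable (fun x => h (R • x)) volume := by
    have h0 : AEMeasurable h volume := hf.1.enorm
    refine h0.comp_quasiMeasurePreserving (f := fun x : Euc N => R • x) ?_
    refine ⟨by fun_prop, ?_⟩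
    rw [Measure.map_addHaar_smul volume hR.ne']
    exact Measure.smul_absolutelyContinuous
  have h2 : ∫⁻ x in annu N, h (R • x) ≤ ((volume (annu N)) ^ (p - 1) * M) ^ (1 / p) * ENNReal.ofReal (R ^ (-(N:ℝ) / p)) := by
    have hj := jensen_pow (volume.restrict (annu N)) hme.restrict hp
    rw [Measure.restrict_apply_univ] at hj
    have h3 : ∫⁻ x in annu N, h (R • x) ^ p ≤ ENNReal.ofReal (R ^ (-(N:ℝ))) * M := by
      rw [hM, ← lintegral_smul_Euc (fun x => h x ^ p) hR]
      exact setLIntegral_le_lintegral _ _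
    have h4 := hj.trans (mul_le_mul_right h3 _)
    have h5 := ENNReal.rpow_le_rpow h4 (by positivity : 0 ≤ 1 / p)
    rw [← ENNReal.rpow_mul, mul_one_div_cancel hp0.ne', ENNReal.rpow_one] at h5
    refine h5.trans (le_of_eq ?_)
    rw [mul_left_comm, ENNReal.mul_rpow_of_nonneg _ _ (by positivity), ENNReal.ofReal_rpow_of_nonneg (by positivity) (by positivity),
      ← Real.rpow_mul hR.le, mul_comm, mul_one_div]
  calc ∫⁻ x in annu N, ‖f (R • x)‖ₑ ≤ ∫⁻ x in annu N, ENNReal.ofReal (2 ^ k * R ^ (k:ℝ)) * h (R • x) :=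
        setLIntegral_mono' annu_open.measurableSet h1
    _ = ENNReal.ofReal (2 ^ k * R ^ (k:ℝ)) * ∫⁻ x in annu N, h (R • x) := lintegral_const_mul' _ _ ENNReal.ofReal_ne_top
    _ ≤ _ := by
      refine (mul_le_mul_right h2 _).trans (le_of_eq ?_)
      rw [ENNReal.ofReal_mul (by positivity), sub_eq_add_neg (k:ℝ), ← neg_div, Real.rpow_add hR, ENNReal.ofReal_mul (by positivity)]
      ring

/-- evaluation of homogeneous component -/
def hc (Q : MvPolynomial (Fin N) ℝ) (d : ℕ) (x : Euc N) : ℝ := polyEval (MvPolynomial.homogeneousComponent d Q) x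

lemma hc_smul (Q : MvPolynomial (Fin N) ℝ) (d : ℕ) (t : ℝ) (x : Euc N) : hc Q d (t • x) = t ^ d * hc Q d x := by
  unfold hc polyEval
  have h := MvPolynomial.homogeneousComponent_isHomogeneous d Q
  rw [MvPolynomial.eval_eq, MvPolynomial.eval_eq, Finset.mul_sum]
  refine Finset.sum_congr rfl fun s hs => ?_
  have h2 : ∑ i, s i = d := by
    have := h (MvPolynomial.mem_support_iff.1 hs)
    rw [Finsupp.weight_apply, Finsupp.sum_fintype _ _ (by simp)] at this
    simpa using this
  have h3 : ∏ i ∈ s.support, (t • x) i ^ s i = t ^ d * ∏ i ∈ s.support, x i ^ s i := by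
    rw [← h2, ← Finset.prod_pow_eq_pow_sum]
    have e : ∏ i, t ^ s i = ∏ i ∈ s.support, t ^ s i := by
      symm
      refine Finset.prod_subset (Finset.subset_univ _) fun i _ hi => ?_
      simp [Finsupp.notMem_support_iff.1 hi]
    rw [e, ← Finset.prod_mul_distrib]
    refine Finset.prod_congr rfl fun i _ => ?_
    simp [mul_pow]
  rw [h3]; ring

lemma hc_sum (Q : MvPolynomial (Fin N) ℝ) {k : ℕ} (hk : Q.totalDegree < k) (x : Euc N) :
    polyEval Q x = ∑ d ∈ Finset.range k, hc Q d x := by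
  have h : ∑ d ∈ Finset.range k, MvPolynomial.homogeneousComponent d Q = Q := by
    conv_rhs => rw [← MvPolynomial.sum_homogeneousComponent Q]
    symm
    refine Finset.sum_subset (by simpa using hk) fun i _ hi => ?_
    refine MvPolynomial.homogeneousComponent_eq_zero _ _ ?_
    simp at hi; omega
  conv_lhs => rw [← h]
  simp [hc, polyEval, map_sum]

lemma hc_cont (Q : MvPolynomial (Fin N) ℝ) (d : ℕ) : Continuous (hc Q d) :=
  (contDiff_polyEval (n := 0) (MvPolynomial.homogeneousComponent d Q)).continuous

lemma hc_zero_of_annu (hN : 1 ≤ N) (Q : MvPolynomial (Fin N) ℝ) (d : ℕ) (h : ∀ x ∈ annu N, hc Q d x = 0) (x : Euc N) : hc Q d x = 0 := by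
  have : Nonempty (Fin N) := ⟨⟨0, hN⟩⟩
  have hcl : IsClosed {x | hc Q d x = 0} := isClosed_eq (hc_cont Q d) continuous_const
  have hd : Dense ({(0 : Euc N)}ᶜ : Set (Euc N)) := dense_compl_singleton _
  have hsub : ({(0 : Euc N)}ᶜ : Set (Euc N)) ⊆ {x | hc Q d x = 0} := by
    intro y hy
    have hy0 : 0 < ‖y‖ := norm_pos_iff.2 hy
    have h1 : ((3/2 : ℝ) / ‖y‖) • y ∈ annu N := by
      have : ‖((3/2 : ℝ) / ‖y‖) • y‖ = 3 / 2 := by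
        rw [norm_smul, Real.norm_of_nonneg (by positivity), div_mul_cancel₀ _ hy0.ne']
      constructor <;> rw [this] <;> norm_num
    have h2 := h _ h1
    rw [hc_smul] at h2
    rcases mul_eq_zero.1 h2 with h3 | h3
    · exact absurd h3 (by positivity)
    · exact h3
  have := hcl.closure_subset_iff.2 hsub
  rw [hd.closure_eq] at this
  exact this (Set.mem_univ x)

lemma hc_lead (hN : 1 ≤ N) {Q : MvPolynomial (Fin N) ℝ} {k : ℕ} (hk : Q.totalDegree < k) (l : Filter ℝ) [l.NeBot] [l.IsCountablyGenerated]
    (hl : ∀ᶠ R in l, 0 < R) {d : ℕ} (hd : d < k)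
    (he : ∀ e < k, e ≠ d → (∀ x, hc Q e x = 0) ∨ Tendsto (fun R : ℝ => R ^ ((e:ℝ) - d)) l (𝓝 0))
    {B : ℝ → ℝ≥0∞} (hB : ∀ᶠ R in l, ∫⁻ x in annu N, ‖polyEval Q (R • x)‖ₑ ≤ B R)
    (hB0 : Tendsto (fun R => ENNReal.ofReal (R ^ (-(d:ℝ))) * B R) l (𝓝 0)) : ∀ x, hc Q d x = 0 := by
  have hQc : Continuous fun x : Euc N => polyEval Q x := (contDiff_polyEval (n := 0) Q).continuous
  apply hc_zero_of_annu hN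
  have hlim : ∀ x, Tendsto (fun R : ℝ => ‖R ^ (-(d:ℝ)) * polyEval Q (R • x)‖ₑ) l (𝓝 ‖hc Q d x‖ₑ) := by
    intro x
    refine Tendsto.enorm ?_
    have h1 : ∀ᶠ R in l, ∑ e ∈ Finset.range k, R ^ ((e:ℝ) - d) * hc Q e x = R ^ (-(d:ℝ)) * polyEval Q (R • x) := by
      filter_upwards [hl] with R hR
      rw [hc_sum Q hk, Finset.mul_sum]
      refine Finset.sum_congr rfl fun e _ => ?_
      rw [hc_smul, sub_eq_neg_add, Real.rpow_add hR, Real.rpow_natCast, mul_assoc]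
    refine Tendsto.congr' h1 ?_
    have h2 : Tendsto (fun R : ℝ => ∑ e ∈ Finset.range k, R ^ ((e:ℝ) - d) * hc Q e x) l (𝓝 (∑ e ∈ Finset.range k, if e = d then hc Q d x else 0)) := by
      refine tendsto_finsetSum _ fun e hek => ?_
      split_ifs with h
      · subst h; simp
      · rcases he e (Finset.mem_range.1 hek) h with h3 | h3
        · simp [h3 x]
        · simpa using h3.mul_const (hc Q e x)
    simpa [Finset.sum_ite_eq', hd] using h2
  have hfat := lintegral_liminf_le (μ := volume.restrict (annu N)) (u := l)
    (f := fun R x => ‖R ^ (-(d:ℝ)) * polyEval Q (R • x)‖ₑ) (fun R => by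
      refine Continuous.measurable ?_
      exact (continuous_const.mul (hQc.comp (continuous_const_smul R))).enorm)
  have hz : liminf (fun R : ℝ => ∫⁻ x in annu N, ‖R ^ (-(d:ℝ)) * polyEval Q (R • x)‖ₑ) l ≤ 0 := by
    rw [← hB0.liminf_eq]
    refine liminf_le_liminf ?_
    filter_upwards [hB, hl] with R hR hR0
    simp_rw [enorm_mul]
    rw [lintegral_const_mul' _ _ (by simp), Real.enorm_of_nonneg (by positivity)]
    exact mul_le_mul_right hR _
  have h0 : ∫⁻ x in annu N, ‖hc Q d x‖ₑ = 0 := by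
    refine le_antisymm ?_ zero_le
    refine le_trans (le_of_eq ?_) (hfat.trans hz)
    refine lintegral_congr fun x => ?_
    exact (hlim x).liminf_eq.symm
  rw [lintegral_eq_zero_iff (hc_cont Q d).enorm.measurable] at h0
  have h1 : hc Q d =ᵐ[volume.restrict (annu N)] fun _ => 0 := by
    filter_upwards [h0] with x hx
    simpa using hx
  exact Measure.eqOn_open_of_ae_eq h1 annu_open (hc_cont Q d).continuousOn continuousOn_const

lemma rpow_top {a : ℝ} (h : a < 0) : Tendsto (fun R : ℝ => R ^ a) atTop (𝓝 0) := by
  have := tendsto_rpow_neg_atTop (neg_pos.2 h)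
  simpa using this

lemma rpow_bot {a : ℝ} (h : 0 < a) : Tendsto (fun R : ℝ => R ^ a) (𝓝[>] 0) (𝓝 0) := by
  have := (Real.continuousAt_rpow_const 0 a (Or.inr h.le)).tendsto
  rw [Real.zero_rpow h.ne'] at this
  exact this.mono_left nhdsWithin_le_nhds

lemma B_lim {l : Filter ℝ} (hl : ∀ᶠ R in l, 0 < R) {C1 C2 : ℝ≥0∞} (h1 : C1 ≠ ⊤) (h2 : C2 ≠ ⊤) {a1 a2 : ℝ} {d : ℕ}
    (ha1 : Tendsto (fun R : ℝ => R ^ (a1 - d)) l (𝓝 0)) (ha2 : Tendsto (fun R : ℝ => R ^ (a2 - d)) l (𝓝 0)) :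
    Tendsto (fun R => ENNReal.ofReal (R ^ (-(d:ℝ))) * (C1 * ENNReal.ofReal (R ^ a1) + C2 * ENNReal.ofReal (R ^ a2))) l (𝓝 0) := by
  have e1 := ENNReal.Tendsto.const_mul (ENNReal.tendsto_ofReal ha1) (Or.inr h1 : _ ∨ C1 ≠ ⊤)
  have e2 := ENNReal.Tendsto.const_mul (ENNReal.tendsto_ofReal ha2) (Or.inr h2 : _ ∨ C2 ≠ ⊤)
  have e := e1.add e2
  simp only [ENNReal.ofReal_zero, mul_zero, add_zero] at e
  refine e.congr' ?_
  filter_upwards [hl] with R hR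
  rw [sub_eq_neg_add, sub_eq_neg_add, Real.rpow_add hR, Real.rpow_add hR, ENNReal.ofReal_mul (by positivity), ENNReal.ofReal_mul (by positivity)]
  ring

lemma hc_top (hN : 1 ≤ N) {Q : MvPolynomial (Fin N) ℝ} {k : ℕ} (hk : Q.totalDegree < k) {C1 C2 : ℝ≥0∞} (h1 : C1 ≠ ⊤) (h2 : C2 ≠ ⊤) {a1 a2 : ℝ}
    (hB : ∀ R : ℝ, 1 ≤ R → ∫⁻ x in annu N, ‖polyEval Q (R • x)‖ₑ ≤ C1 * ENNReal.ofReal (R ^ a1) + C2 * ENNReal.ofReal (R ^ a2))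
    {d : ℕ} (hd : d < k) (hd1 : a1 < d) (hd2 : a2 < d) : ∀ x, hc Q d x = 0 := by
  induction hn : k - d using Nat.strong_induction_on generalizing d with
  | _ n ih =>
    have hl : ∀ᶠ R : ℝ in atTop, 0 < R := eventually_gt_atTop 0
    refine hc_lead hN hk atTop hl hd ?_ (B := fun R => C1 * ENNReal.ofReal (R ^ a1) + C2 * ENNReal.ofReal (R ^ a2)) ?_
      (B_lim hl h1 h2 (rpow_top (by linarith)) (rpow_top (by linarith)))
    · intro e he hed
      rcases lt_or_gt_of_ne hed with h | h
      · right
        refine rpow_top ?_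
        have : (e:ℝ) < d := by exact_mod_cast h
        linarith
      · left
        have : (d:ℝ) < e := by exact_mod_cast h
        exact ih (k - e) (by omega) he (by linarith) (by linarith) rfl
    · filter_upwards [eventually_ge_atTop 1] with R hR using hB R hR

lemma hc_bot (hN : 1 ≤ N) {Q : MvPolynomial (Fin N) ℝ} {k : ℕ} (hk : Q.totalDegree < k) {C1 C2 : ℝ≥0∞} (h1 : C1 ≠ ⊤) (h2 : C2 ≠ ⊤) {a1 a2 : ℝ}
    (hB : ∀ R : ℝ, 0 < R → ∫⁻ x in annu N, ‖polyEval Q (R • x)‖ₑ ≤ C1 * ENNReal.ofReal (R ^ a1) + C2 * ENNReal.ofReal (R ^ a2))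
    {d : ℕ} (hd : d < k) (hd1 : d < a1) (hd2 : d < a2) : ∀ x, hc Q d x = 0 := by
  induction d using Nat.strong_induction_on with
  | _ d ih =>
    have hl : ∀ᶠ R : ℝ in 𝓝[>] 0, 0 < R := self_mem_nhdsWithin
    refine hc_lead hN hk (𝓝[>] 0) hl hd ?_ (B := fun R => C1 * ENNReal.ofReal (R ^ a1) + C2 * ENNReal.ofReal (R ^ a2)) ?_
      (B_lim hl h1 h2 (rpow_bot (by linarith)) (rpow_bot (by linarith)))
    · intro e he hed
      rcases lt_or_gt_of_ne hed with h | h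
      · left
        have : (e:ℝ) < d := by exact_mod_cast h
        exact ih e h he (by linarith) (by linarith)
      · right
        have : (d:ℝ) < e := by exact_mod_cast h
        exact rpow_bot (by linarith)
    · filter_upwards [hl] with R hR using hB R hR

lemma poly_zero {Q : MvPolynomial (Fin N) ℝ} {k : ℕ} (hk : Q.totalDegree < k) (h : ∀ d < k, ∀ x, hc Q d x = 0) : Q = 0 := by
  refine MvPolynomial.funext fun y => ?_
  have := hc_sum Q hk (WithLp.toLp 2 y)
  rw [Finset.sum_eq_zero fun d hd => h d (Finset.mem_range.1 hd) _] at this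
  simpa [polyEval] using this

lemma int_split (hN : 1 ≤ N) {f1 f2 : Euc N → ℝ} {Q : MvPolynomial (Fin N) ℝ} {k : ℕ} {p1 p2 : ℝ} (hp1 : 1 ≤ p1) (hp2 : 1 ≤ p2) 
    (h1 : MemLp (fun x => ‖x‖ ^ (-(k:ℝ)) * f1 x) (ENNReal.ofReal p1) volume)
    (h2 : MemLp (fun x => ‖x‖ ^ (-(k:ℝ)) * f2 x) (ENNReal.ofReal p2) volume) :
    ∃ C1 C2 : ℝ≥0∞, C1 ≠ ⊤ ∧ C2 ≠ ⊤ ∧ ∀ R : ℝ, 0 < R → (∀ x ∈ annu N, polyEval Q (R • x) = f1 (R • x) - f2 (R • x)) → ∫⁻ x in annu N, ‖polyEval Q (R • x)‖ₑ ≤ 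
      C1 * ENNReal.ofReal (R ^ ((k:ℝ) - N / p1)) + C2 * ENNReal.ofReal (R ^ ((k:ℝ) - N / p2)) := by
  obtain ⟨C1, hC1, hb1⟩ := ann_bound hp1 h1
  obtain ⟨C2, hC2, hb2⟩ := ann_bound hp2 h2
  refine ⟨C1, C2, hC1, hC2, fun R hR hQ => ?_⟩
  refine le_trans ?_ (add_le_add (hb1 R hR) (hb2 R hR))
  have hm : AEMeasurable (fun x => ‖f1 (R • x)‖ₑ) (volume.restrict (annu N)) := by
    have h0 : AEStronglyMeasurable f1 volume := by
      have := (h1.1.aemeasurable.mul (by fun_prop : AEMeasurable (fun x : Euc N => ‖x‖ ^ (k:ℝ)) volume))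
      refine (this.congr ?_).aestronglyMeasurable
      filter_upwards [ae_ne_zero hN] with x hx
      have hx0 : 0 < ‖x‖ := norm_pos_iff.2 hx
      simp only [Pi.mul_apply]
      rw [mul_right_comm, ← Real.rpow_add hx0]
      simp
    refine AEMeasurable.restrict ?_
    refine (h0.aemeasurable.comp_quasiMeasurePreserving (f := fun x : Euc N => R • x) ⟨by fun_prop, ?_⟩).enorm
    rw [Measure.map_addHaar_smul volume hR.ne']
    exact Measure.smul_absolutelyContinuous
  rw [← lintegral_add_left' hm]
  refine setLIntegral_mono' annu_open.measurableSet fun x hx => ?_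
  rw [hQ x hx]
  exact enorm_sub_le

lemma unique1 (hN : 1 ≤ N) {k : ℕ} (hk : 1 ≤ k) {u : Euc N → ℝ} {Q1 Q2 : MvPolynomial (Fin N) ℝ} (hd1 : Q1.totalDegree ≤ k - 1) (hd2 : Q2.totalDegree ≤ k - 1)
    {p1 p2 : ℝ} (hp1 : 1 ≤ p1) (hp2 : 1 ≤ p2) 
    (h1 : MemLp (fun x => ‖x‖ ^ (-(k:ℝ)) * (u x - polyEval Q1 x)) (ENNReal.ofReal p1) volume)
    (h2 : MemLp (fun x => ‖x‖ ^ (-(k:ℝ)) * (u x - polyEval Q2 x)) (ENNReal.ofReal p2) volume)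
    (hsame : ∀ j : ℕ, 1 ≤ j → j ≤ k → ((j:ℝ) < N / p1 ∧ (j:ℝ) < N / p2) ∨ (N / p1 < (j:ℝ) ∧ N / p2 < (j:ℝ))) : Q1 = Q2 := by
  have hdeg : (Q2 - Q1).totalDegree < k := by
    have := MvPolynomial.totalDegree_sub Q2 Q1
    have := max_le hd2 hd1
    omega
  obtain ⟨C1, C2, hC1, hC2, hb'⟩ := int_split hN (Q := Q2 - Q1) hp1 hp2 h1 h2
  have hb := fun R hR => hb' R hR (fun x _ => by simp [polyEval])
  have : Q2 - Q1 = 0 := by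
    refine poly_zero hdeg fun d hd => ?_
    have hc : ((k - d : ℕ) : ℝ) = k - d := by push_cast [hd.le]; rfl
    rcases hsame (k - d) (by omega) (by omega) with h | h
    · rw [hc] at h
      exact hc_top hN hdeg hC1 hC2 (fun R hR => hb R (by linarith)) hd (by linarith [h.1]) (by linarith [h.2])
    · rw [hc] at h
      exact hc_bot hN hdeg hC1 hC2 hb hd (by linarith [h.1]) (by linarith [h.2])
  exact (sub_eq_zero.1 this).symm

lemma unique2 (hN : 1 ≤ N) {k : ℕ} (hk : 1 ≤ k) {u : Euc N → ℝ} {Q1 Q2 : MvPolynomial (Fin N) ℝ} (hd1 : Q1.totalDegree ≤ k - 1) (hd2 : Q2.totalDegree ≤ k - 1)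
    {p : ℝ} (hp : 1 ≤ p) (hpk : (k:ℝ) < N / p)
    (h1 : MemLp (fun x => ‖x‖ ^ (-(k:ℝ)) * (u x - polyEval Q1 x)) (ENNReal.ofReal p) volume)
    (h2 : MemLs N ((k:ℝ) - N / p) (ENNReal.ofReal p) (fun x => u x - polyEval Q2 x)) : Q2 = Q1 := by
  have hdeg : (Q2 - Q1).totalDegree < k := by
    have := MvPolynomial.totalDegree_sub Q2 Q1
    have := max_le hd2 hd1
    omega
  have hp0 : 0 < p := by linarith
  set f2 : Euc N → ℝ := Set.indicator {x | 1 < ‖x‖} (fun x => u x - polyEval Q2 x) with hf2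
  have hS : MeasurableSet {x : Euc N | 1 < ‖x‖} := measurableSet_lt measurable_const measurable_norm
  have h3 : MemLp (fun x => ‖x‖ ^ (-(k:ℝ)) * f2 x) (ENNReal.ofReal p) volume := by
    have hw : ∀ x : Euc N, wt N ((k:ℝ) - N / p) (ENNReal.ofReal p) x = (1 + ‖x‖) ^ (-(k:ℝ)) := by
      intro x; unfold wt; rw [ENNReal.toReal_ofReal hp0.le]; congr 1; ring
    unfold MemLs at h2
    simp_rw [hw] at h2
    have hg : AEMeasurable (fun x : Euc N => (Set.indicator {x | 1 < ‖x‖} (fun x => ‖x‖ ^ (-(k:ℝ)) * (1 + ‖x‖) ^ (k:ℝ)) x) * ((1 + ‖x‖) ^ (-(k:ℝ)) * (u x - polyEval Q2 x))) volume := by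
      refine AEMeasurable.mul ?_ h2.1.aemeasurable
      refine (Measurable.indicator (by fun_prop) hS).aemeasurable
    have heq : ∀ x : Euc N, (Set.indicator {x | 1 < ‖x‖} (fun x => ‖x‖ ^ (-(k:ℝ)) * (1 + ‖x‖) ^ (k:ℝ)) x) * ((1 + ‖x‖) ^ (-(k:ℝ)) * (u x - polyEval Q2 x)) = ‖x‖ ^ (-(k:ℝ)) * f2 x := by
      intro x
      rw [hf2]
      by_cases hx : 1 < ‖x‖
      · rw [Set.indicator_of_mem (show x ∈ {x : Euc N | 1 < ‖x‖} from hx), Set.indicator_of_mem (show x ∈ {x : Euc N | 1 < ‖x‖} from hx)]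
        rw [mul_assoc, ← mul_assoc ((1 + ‖x‖) ^ (k:ℝ)), ← Real.rpow_add (by positivity)]
        simp
      · rw [Set.indicator_of_notMem (show x ∉ {x : Euc N | 1 < ‖x‖} from hx), Set.indicator_of_notMem (show x ∉ {x : Euc N | 1 < ‖x‖} from hx)]
        simp
    refine MemLp.of_le_mul (c := 2 ^ k) h2 ?_ ?_
    · refine (hg.congr ?_).aestronglyMeasurable
      exact Eventually.of_forall heq
    · refine Eventually.of_forall fun x => ?_
      rw [← heq, norm_mul]
      gcongr
      rw [Real.norm_of_nonneg (Set.indicator_nonneg (fun _ _ => by positivity) _)]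
      refine Set.indicator_apply_le' (fun hx => ?_) (fun _ => by positivity)
      have hx : 1 < ‖x‖ := hx
      rw [Real.rpow_neg (by positivity), Real.rpow_natCast, Real.rpow_natCast, inv_mul_le_iff₀ (by positivity), ← mul_pow]
      gcongr
      linarith
  obtain ⟨C1, C2, hC1, hC2, hb'⟩ := int_split hN (Q := Q2 - Q1) hp hp h1 h3
  have hb : ∀ R : ℝ, 1 ≤ R → ∫⁻ x in annu N, ‖polyEval (Q2 - Q1) (R • x)‖ₑ ≤ 
      C1 * ENNReal.ofReal (R ^ ((k:ℝ) - N / p)) + C2 * ENNReal.ofReal (R ^ ((k:ℝ) - N / p)) := by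
    intro R hR
    refine hb' R (by linarith) fun x hx => ?_
    have hx1 : R • x ∈ {x : Euc N | 1 < ‖x‖} := by
      simp only [Set.mem_setOf_eq, norm_smul, Real.norm_of_nonneg (by linarith : (0:ℝ) ≤ R)]
      nlinarith [hx.1]
    rw [hf2, Set.indicator_of_mem hx1]
    simp [polyEval]
  have : Q2 - Q1 = 0 := by
    refine poly_zero hdeg fun d hd => ?_
    have hd0 : (0:ℝ) ≤ d := by positivity
    exact hc_top hN hdeg hC1 hC2 hb hd (by linarith) (by linarith)
  exact sub_eq_zero.1 this
end
end

section

lemma lt_div_flip {a b c : ℝ} (hb : 0 < b) (hc : 0 < c) : b < a / c ↔ c < a / b := by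
  rw [lt_div_iff₀ hc, lt_div_iff₀ hb, mul_comm]

lemma div_lt_flip {a b c : ℝ} (hb : 0 < b) (hc : 0 < c) : a / c < b ↔ a / b < c := by
  rw [div_lt_iff₀ hc, div_lt_iff₀ hb, mul_comm]

lemma comp_same {N k : ℕ} {p₀ p1 p2 : ℝ}
    (h1 : p1 ∈ connectedComponentIn {t : ℝ | ∀ j : ℕ, 1 ≤ j → j ≤ k → t ≠ (N : ℝ) / (j : ℝ)} p₀)
    (h2 : p2 ∈ connectedComponentIn {t : ℝ | ∀ j : ℕ, 1 ≤ j → j ≤ k → t ≠ (N : ℝ) / (j : ℝ)} p₀) (hp1 : 1 ≤ p1) (hp2 : 1 ≤ p2) :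
    ∀ j : ℕ, 1 ≤ j → j ≤ k → ((j:ℝ) < N / p1 ∧ (j:ℝ) < N / p2) ∨ (N / p1 < (j:ℝ) ∧ N / p2 < (j:ℝ)) := by
  intro j hj hjk
  have hoc := (isPreconnected_connectedComponentIn (x := p₀) (F := {t : ℝ | ∀ j : ℕ, 1 ≤ j → j ≤ k → t ≠ (N : ℝ) / (j : ℝ)})).ordConnected
  have hsub := connectedComponentIn_subset {t : ℝ | ∀ j : ℕ, 1 ≤ j → j ≤ k → t ≠ (N : ℝ) / (j : ℝ)} p₀
  have hj0 : (0:ℝ) < j := by exact_mod_cast hj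
  have hp10 : 0 < p1 := by linarith
  have hp20 : 0 < p2 := by linarith
  rw [lt_div_flip hj0 hp10, lt_div_flip hj0 hp20, div_lt_flip hj0 hp10, div_lt_flip hj0 hp20]
  have n1 := hsub h1 j hj hjk
  have n2 := hsub h2 j hj hjk
  rcases lt_or_gt_of_ne n1 with a | a <;> rcases lt_or_gt_of_ne n2 with b | b
  · exact Or.inl ⟨a, b⟩
  · exact absurd rfl (hsub (hoc.out h1 h2 ⟨a.le, b.le⟩) j hj hjk)
  · exact absurd rfl (hsub (hoc.out h2 h1 ⟨b.le, a.le⟩) j hj hjk)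
  · exact Or.inr ⟨a, b⟩

end


/-- Corollary 10. For `k ≥ 1`, `1 ≤ p < ∞` with `p ≠ N/j` for
`j = 1,…,k`: if `∇^k u ∈ (L^p)^{ν(k,N)}`, there is a polynomial `π_u ∈ P_{k-1}` —
chosen independently of `p` within the connected component of
`ℝ \ {N/k,…,N}` containing `p₀`, and unique when `p < N/k` — with
`‖|∇^{k-j}(u - π_u)|‖_{L^q_{j-N/p}} ≤ C ‖|∇^k u|‖_p` for all `1 ≤ j ≤ k`, `q ∈ I_{j,p}`;
moreover `|x|^{-j+N/p}(∇^{k-j}u(x) - ∇^{k-j}π_u(x)) → 0` as `|x| → ∞` when `p > N/j`. -/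
theorem stmt_14 {N : ℕ} (hN : 1 ≤ N) (k : ℕ) (hk : 1 ≤ k) (p₀ : ℝ) (hp₀ : 1 ≤ p₀)
    (hp₀' : ∀ j : ℕ, 1 ≤ j → j ≤ k → p₀ ≠ (N : ℝ) / (j : ℝ)) :
    ∃ P : (Euc N → ℝ) → MvPolynomial (Fin N) ℝ,
      (∀ u, (P u).totalDegree ≤ k - 1) ∧
      ∀ p ∈ connectedComponentIn
          {t : ℝ | ∀ j : ℕ, 1 ≤ j → j ≤ k → t ≠ (N : ℝ) / (j : ℝ)} p₀,
      1 ≤ p →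
      ∀ j : ℕ, 1 ≤ j → j ≤ k →
      ∀ q ∈ Ijp N j p,
      ∃ C : ℝ, 0 < C ∧
        ∀ (u : Euc N → ℝ) (g : (Fin k → Fin N) → Euc N → ℝ),
          (∀ m, IsWeakDerivList (List.ofFn m) u (g m)) →
          (∀ m, MemLp (g m) (ENNReal.ofReal p) volume) →
          (∃ v : (Fin (k - j) → Fin N) → Euc N → ℝ,
            (∀ m, IsWeakDerivList (List.ofFn m)
              (fun x => u x - polyEval (P u) x) (v m)) ∧
            MemLs N ((j : ℝ) - (N : ℝ) / p) q (gradNormK v) ∧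
            LsNorm N ((j : ℝ) - (N : ℝ) / p) q (gradNormK v)
              ≤ C * (eLpNorm (gradNormK g) (ENNReal.ofReal p) volume).toReal ∧
            ((N : ℝ) / j < p →
              ∀ m, Tendsto (fun x : Euc N => ‖x‖ ^ (-(j : ℝ) + (N : ℝ) / p) * v m x)
                (cocompact (Euc N)) (nhds 0))) ∧
          (p < (N : ℝ) / k →
            ∀ π' : MvPolynomial (Fin N) ℝ, π'.totalDegree ≤ k - 1 →
              MemLs N ((k : ℝ) - (N : ℝ) / p) (ENNReal.ofReal p)
                (fun x => u x - polyEval π' x) →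
              π' = P u) := by
  classical
  set S := connectedComponentIn {t : ℝ | ∀ j : ℕ, 1 ≤ j → j ≤ k → t ≠ (N : ℝ) / (j : ℝ)} p₀ with hS
  let Pr : (Euc N → ℝ) → MvPolynomial (Fin N) ℝ → Prop := fun u Q => Q.totalDegree ≤ k - 1 ∧
    ∃ p ∈ S, 1 ≤ p ∧ MemLp (fun x => ‖x‖ ^ (-(k:ℝ)) * (u x - polyEval Q x)) (ENNReal.ofReal p) volume
  let P : (Euc N → ℝ) → MvPolynomial (Fin N) ℝ := fun u => if h : ∃ Q, Pr u Q then h.choose else 0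
  have hPspec : ∀ u, (∃ Q, Pr u Q) → Pr u (P u) := by
    intro u h
    have : P u = h.choose := dif_pos h
    rw [this]; exact h.choose_spec
  have hPu : ∀ u Q, Pr u Q → Q = P u := by
    rintro u Q hQ
    obtain ⟨hd, p1, hp1, hp11, h1⟩ := hQ
    obtain ⟨hd2, p2, hp2, hp21, h2⟩ := hPspec u ⟨Q, hd, p1, hp1, hp11, h1⟩
    exact unique1 hN hk hd hd2 hp11 hp21 h1 h2 (comp_same hp1 hp2 hp11 hp21)
  refine ⟨P, ?_, ?_⟩
  · intro u
    by_cases h : ∃ Q, Pr u Q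
    · exact (hPspec u h).1
    · have : P u = 0 := dif_neg h
      rw [this]; simp
  intro p hpS hp j hj hjk q hq
  have hp0 : 0 < p := by linarith
  have hj0 : (0:ℝ) < j := by exact_mod_cast hj
  have ha : Adm N k p := by
    refine ⟨hN, hp, fun i hi hik h => ?_⟩
    have := comp_same hpS hpS hp hp i hi hik
    rcases this with h' | h'
    · exact absurd h (ne_of_lt h'.1)
    · exact absurd h (ne_of_gt h'.1)
  obtain ⟨C, hC⟩ := est5 ha hj hjk hq
  set K : NNReal := (Fintype.card (Fin (k - j) → Fin N) : NNReal) * C * (Fintype.card (Fin k → Fin N) : NNReal) with hK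
  refine ⟨K + 1, by positivity, fun u g hg hgp => ?_⟩
  obtain ⟨Q, hQd, hQm, v, hv⟩ := main_exist ha hk hg hgp
  have hQP : Q = P u := hPu u Q ⟨hQd, p, hpS, hp, hQm⟩
  subst hQP
  obtain ⟨hw, hlim, hest⟩ := hv j hj hjk
  have hb := hest q C hC
  have hGfin : eLpNorm (gradNormK g) (ENNReal.ofReal p) volume < ⊤ := by
    have h1 : MemLp (fun x => ∑ m, |g m x|) (ENNReal.ofReal p) volume :=
      memLp_finset_sum _ fun m _ => (hgp m).abs
    refine (eLpNorm_mono fun x => ?_).trans_lt h1.2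
    rw [Real.norm_of_nonneg (gradNormK_nonneg _ _), Real.norm_of_nonneg (by positivity)]
    exact gradNormK_le_sum g x
  refine ⟨⟨v (k - j), hw, ?_, ?_, ?_⟩, ?_⟩
  · refine ⟨?_, hb.trans_lt (ENNReal.mul_lt_top ENNReal.coe_lt_top hGfin)⟩
    refine AEStronglyMeasurable.mul ?_ (gradNormK_meas fun m => (hw m).2.1.aestronglyMeasurable)
    unfold wt
    exact Measurable.aestronglyMeasurable (by fun_prop)
  · unfold LsNorm
    have h1 := ENNReal.toReal_mono (ENNReal.mul_lt_top ENNReal.coe_lt_top hGfin).ne hb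
    rw [ENNReal.toReal_mul, ENNReal.coe_toReal] at h1
    refine h1.trans ?_
    gcongr
    linarith
  · intro h m
    have := hlim ((div_lt_flip hj0 hp0).2 h) m
    convert this using 3
    ring_nf
  · intro h π' hd hm
    have hk0 : (0:ℝ) < k := by exact_mod_cast hk
    exact unique2 hN hk hQd hd hp ((lt_div_flip hk0 hp0).2 h) hQm hm

end
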